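/- Let S : F(a,b) → F(Δ) be a set of at least two homomorphisms from the free group of rank two, all of which are injective. Then rk(Eq(S)) ≤ 2. -/

import Mathlib

/-- `rkLe H n` : the (free) subgroup `H` has rank at most `n`. -/
def rkLe {G : Type*} [Group G] (H : Subgroup G) (n : ℕ) : Prop :=
  ∃ S : Finset G, S.card ≤ n ∧ Subgroup.closure (S : Set G) = H

namespace Eq9
open Matrix Polynomial

abbrev Mat := Matrix (Fin 2) (Fin 2) ℤ

def nilp : Bool → Mat
  | true => !![0, 1; 0, 0]
  | false => !![0, 0; 1, 0]

lemma nilp_sq (i : Bool) : nilp i * nilp i = 0 := by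
  cases i <;> simp [nilp] <;> ext i j <;> fin_cases i <;> fin_cases j <;> rfl

lemma nil_poly_sq (i : Bool) : (Polynomial.C (nilp i) * X : Polynomial Mat) * (Polynomial.C (nilp i) * X) = 0 := by
  have : (X : Polynomial Mat) * (C (nilp i) * X) = C (nilp i) * X * X := by
    rw [← mul_assoc, X_mul]
  rw [mul_assoc, this, ← mul_assoc, ← mul_assoc, ← C_mul, nilp_sq]; simp

noncomputable def unitP (i : Bool) : (Polynomial Mat)ˣ where
  val := 1 + C (nilp i) * X
  inv := 1 - C (nilp i) * X
  val_inv := by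
    rw [mul_sub, add_mul, add_mul, nil_poly_sq]; simp
  inv_val := by
    rw [mul_add, sub_mul, sub_mul, nil_poly_sq]; simp

noncomputable def evalThree : Polynomial Mat →+* Mat :=
  Polynomial.eval₂RingHom' (RingHom.id _) (3 : Mat) (fun a => (Nat.cast_commute 3 a).symm)

abbrev NZ := {v : Fin 2 → ℤ // v ≠ 0}

instance actNZ : MulAction Matˣ NZ where
  smul u v := ⟨u.1 *ᵥ v.1, fun h => v.2 (by
    have : u.2 *ᵥ (u.1 *ᵥ v.1) = 0 := by rw [h]; simp
    rw [mulVec_mulVec, u.inv_val] at this; simpa using this)⟩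
  one_smul v := by apply Subtype.ext; change (1 : Mat) *ᵥ v.1 = v.1; simp
  mul_smul u w v := by
    apply Subtype.ext; change (u.1 * w.1) *ᵥ v.1 = u.1 *ᵥ (w.1 *ᵥ v.1); rw [mulVec_mulVec]

lemma actNZ_coe (u : Matˣ) (v : NZ) : (u • v).1 = u.1 *ᵥ v.1 := rfl

def ppX : Bool → Set NZ
  | true => {v | |v.1 1| < |v.1 0| ∧ 0 ≤ v.1 0 * v.1 1}
  | false => {v | |v.1 0| < |v.1 1| ∧ 0 ≤ v.1 0 * v.1 1}
def ppY : Bool → Set NZ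
  | true => {v | |v.1 1| < |v.1 0| ∧ v.1 0 * v.1 1 < 0}
  | false => {v | |v.1 0| < |v.1 1| ∧ v.1 0 * v.1 1 < 0}

noncomputable def unitM (i : Bool) : Matˣ := Units.map (evalThree : Polynomial Mat →* Mat) (unitP i)

lemma unitM_val (i : Bool) : (unitM i).1 = 1 + nilp i * 3 := by
  simp [unitM, unitP, evalThree, eval₂_add, eval₂_mul_X]

lemma unitM_inv (i : Bool) : ((unitM i)⁻¹).1 = 1 - nilp i * 3 := by
  change evalThree (1 - C (nilp i) * X) = _
  simp [evalThree, eval₂_sub, eval₂_mul_X]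

lemma mT (v : Fin 2 → ℤ) (e : ℤ) : ((1 + e • (nilp true * 3)) *ᵥ v) = ![v 0 + e * 3 * v 1, v 1] := by
  have h3 : (3 : Mat) = !![3, 0; 0, 3] := by
    ext i j; fin_cases i <;> fin_cases j <;> rfl
  rw [h3]; ext i; fin_cases i <;> simp [nilp, Matrix.mulVec, dotProduct, Fin.sum_univ_two, Matrix.one_apply]
lemma mF (v : Fin 2 → ℤ) (e : ℤ) : ((1 + e • (nilp false * 3)) *ᵥ v) = ![v 0, v 1 + e * 3 * v 0] := by
  have h3 : (3 : Mat) = !![3, 0; 0, 3] := by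
    ext i j; fin_cases i <;> fin_cases j <;> rfl
  rw [h3]; ext i; fin_cases i <;> simp [nilp, Matrix.mulVec, dotProduct, Fin.sum_univ_two, Matrix.one_apply]
  ring

lemma pp_arith1 (p q : ℤ) (hn : ¬ (p = 0 ∧ q = 0)) (h : ¬ (|q| < |p| ∧ p * q < 0)) :
    |q| < |p + 3 * q| ∧ 0 ≤ (p + 3 * q) * q := by
  rcases lt_trichotomy q 0 with hq | hq | hq
  · have hp : p + 2 * q < 0 := by
      by_contra hc; apply h
      constructor
      · rw [abs_of_neg hq, abs_of_pos (by linarith)]; linarith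
      · nlinarith
    constructor
    · rw [abs_of_neg hq, abs_of_neg (by linarith)]; linarith
    · nlinarith
  · subst hq; simp at hn ⊢; exact hn
  · have hp : 0 < p + 2 * q := by
      by_contra hc; apply h
      constructor
      · rw [abs_of_pos hq, abs_of_neg (by linarith)]; linarith
      · nlinarith
    constructor
    · rw [abs_of_pos hq, abs_of_pos (by linarith)]; linarith
    · nlinarith

lemma pp_arith2 (p q : ℤ) (hn : ¬ (p = 0 ∧ q = 0)) (h : ¬ (|q| < |p| ∧ 0 ≤ p * q)) :
    |q| < |p - 3 * q| ∧ (p - 3 * q) * q < 0 := by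
  rcases lt_trichotomy q 0 with hq | hq | hq
  · have hp : 0 < p - 2 * q := by
      by_contra hc; apply h
      constructor
      · rw [abs_of_neg hq, abs_of_neg (by linarith)]; linarith
      · nlinarith
    constructor
    · rw [abs_of_neg hq, abs_of_pos (by linarith)]; linarith
    · nlinarith
  · subst hq; exfalso; simp at hn h; omega
  · have hp : p - 2 * q < 0 := by
      by_contra hc; apply h
      constructor
      · rw [abs_of_pos hq, abs_of_pos (by linarith)]; linarith
      · nlinarith
    constructor
    · rw [abs_of_pos hq, abs_of_neg (by linarith)]; linarith
    · nlinarith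

lemma NZ_ne (v : NZ) : ¬ (v.1 0 = 0 ∧ v.1 1 = 0) := fun h => v.2 (by
  ext i; fin_cases i; exacts [h.1, h.2])

open scoped Pointwise Function in
lemma liftM_inj : Function.Injective (FreeGroup.lift unitM) := by
  apply FreeGroup.injective_lift_of_ping_pong unitM ppX ppY
  · rintro (_ | _)
    · exact ⟨⟨![0, 1], fun h => by simpa using congrFun h 1⟩, by simp [ppX]⟩
    · exact ⟨⟨![1, 0], fun h => by simpa using congrFun h 0⟩, by simp [ppX]⟩
  · rintro (_ | _) (_ | _) h <;> first | exact absurd rfl h | skip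
    all_goals
      apply Set.disjoint_left.2; intro v hv hw; simp only [ppX, Set.mem_ofPred_eq] at hv hw
      exact lt_asymm hv.1 hw.1
  · rintro (_ | _) (_ | _) h <;> first | exact absurd rfl h | skip
    all_goals
      apply Set.disjoint_left.2; intro v hv hw; simp only [ppY, Set.mem_ofPred_eq] at hv hw
      exact lt_asymm hv.1 hw.1
  · rintro (_ | _) (_ | _) <;>
    · apply Set.disjoint_left.2; intro v hv hw; simp only [ppY, ppX, Set.mem_ofPred_eq] at hv hw
      exact absurd hw.2 (not_lt.2 hv.2)
  · rintro (_ | _) _ ⟨v, hv, rfl⟩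
    · have e := mF v.1 1
      have : (unitM false • v).1 = _ := (actNZ_coe _ _).trans ((by rw [unitM_val, one_smul] : _ = (1 + (1:ℤ) • (nilp false * 3)) *ᵥ v.1).trans e)
      simp only [ppX, ppY, Set.mem_ofPred_eq, Set.mem_compl_iff, this] at hv ⊢
      have := pp_arith1 (v.1 1) (v.1 0) (fun h => NZ_ne v ⟨h.2, h.1⟩) (by rw [mul_comm]; exact hv)
      simpa [mul_comm] using this
    · have e := mT v.1 1
      have : (unitM true • v).1 = _ := (actNZ_coe _ _).trans ((by rw [unitM_val, one_smul] : _ = (1 + (1:ℤ) • (nilp true * 3)) *ᵥ v.1).trans e)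
      simp only [ppX, ppY, Set.mem_ofPred_eq, Set.mem_compl_iff, this] at hv ⊢
      simpa using pp_arith1 (v.1 0) (v.1 1) (NZ_ne v) hv
  · rintro (_ | _) _ ⟨v, hv, rfl⟩
    · have e := mF v.1 (-1)
      have : ((unitM)⁻¹ false • v).1 = _ := (actNZ_coe _ _).trans ((by
        rw [Pi.inv_apply, unitM_inv, sub_eq_add_neg, neg_one_smul] : _ = (1 + (-1:ℤ) • (nilp false * 3)) *ᵥ v.1).trans e)
      simp only [ppX, ppY, Set.mem_ofPred_eq, Set.mem_compl_iff, this] at hv ⊢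
      have := pp_arith2 (v.1 1) (v.1 0) (fun h => NZ_ne v ⟨h.2, h.1⟩) (by rw [mul_comm]; exact hv)
      simpa [mul_comm, sub_eq_add_neg] using this
    · have e := mT v.1 (-1)
      have : ((unitM)⁻¹ true • v).1 = _ := (actNZ_coe _ _).trans ((by
        rw [Pi.inv_apply, unitM_inv, sub_eq_add_neg, neg_one_smul] : _ = (1 + (-1:ℤ) • (nilp true * 3)) *ᵥ v.1).trans e)
      simp only [ppX, ppY, Set.mem_ofPred_eq, Set.mem_compl_iff, this] at hv ⊢
      have := pp_arith2 (v.1 0) (v.1 1) (NZ_ne v) hv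
      simpa [sub_eq_add_neg] using this

noncomputable def rho : FreeGroup Bool →* (Polynomial Mat)ˣ := FreeGroup.lift unitP

lemma rho_inj : Function.Injective rho := by
  have : (Units.map (evalThree : Polynomial Mat →* Mat)).comp rho = FreeGroup.lift unitM := by
    ext i; simp [rho, unitM]
  have h2 := liftM_inj
  rw [← this, MonoidHom.coe_comp] at h2
  exact h2.of_comp

lemma rho_zero (g : FreeGroup Bool) : (rho g).1.coeff 0 = 1 := by
  have : ((Units.map (Polynomial.constantCoeff : Polynomial Mat →+* Mat).toMonoidHom)).comp rho = 1 := by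
    ext i : 1
    apply Units.ext
    simp [rho, unitP, constantCoeff]
  have := DFunLike.congr_fun this g
  have := congrArg Units.val this
  simpa using this

abbrev L4 := ℤ ×ₗ ℤ ×ₗ ℤ ×ₗ ℤ

def vec (M : Mat) : L4 := toLex (M 0 0, toLex (M 0 1, toLex (M 1 0, M 1 1)))

lemma vec_add (M N : Mat) : vec (M + N) = vec M + vec N := rfl

lemma vec_inj : Function.Injective vec := by
  intro M N h
  have h := congrArg ofLex h
  simp only [vec, ofLex_toLex, Prod.mk.injEq, EmbeddingLike.apply_eq_iff_eq] at h
  ext i j; fin_cases i <;> fin_cases j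
  exacts [h.1, h.2.1, h.2.2.1, h.2.2.2]

noncomputable def ordMap (g : FreeGroup Bool) : Lex (ℕ → L4) := toLex fun n => vec ((rho g).1.coeff n)

lemma ordMap_inj : Function.Injective ordMap := by
  intro g h e
  apply rho_inj; apply Units.ext; ext1 n
  exact vec_inj (congrFun (congrArg ofLex e) n)

lemma ord_core (A B : Polynomial Mat) (n : ℕ) (h : ∀ j < n, A.coeff j = B.coeff j)
    (K : Polynomial Mat) (hK : K.coeff 0 = 1) :
    (∀ j < n, (K * A).coeff j = (K * B).coeff j) ∧ (∀ j < n, (A * K).coeff j = (B * K).coeff j) ∧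
    (∃ c : Mat, (K * A).coeff n = A.coeff n + c ∧ (K * B).coeff n = B.coeff n + c) ∧
    (∃ c : Mat, (A * K).coeff n = A.coeff n + c ∧ (B * K).coeff n = B.coeff n + c) := by
  refine ⟨?_, ?_, ?_, ?_⟩
  · intro j hj; rw [coeff_mul, coeff_mul]
    refine Finset.sum_congr rfl fun x hx => ?_
    rw [h]; have := Finset.HasAntidiagonal.mem_antidiagonal.1 hx; omega
  · intro j hj; rw [coeff_mul, coeff_mul]
    refine Finset.sum_congr rfl fun x hx => ?_
    rw [h]; have := Finset.HasAntidiagonal.mem_antidiagonal.1 hx; omega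
  · refine ⟨(K * A).coeff n - A.coeff n, by abel, ?_⟩
    have : (K * (A - B)).coeff n = A.coeff n - B.coeff n := by
      rw [coeff_mul, Finset.sum_eq_single (0, n)]
      · simp [hK]
      · rintro ⟨i, j⟩ hx hne
        have := Finset.HasAntidiagonal.mem_antidiagonal.1 hx
        simp only at this ⊢
        rw [coeff_sub, h j, sub_self, mul_zero]
        rcases Nat.eq_zero_or_pos i with h0 | h0
        · subst h0; exfalso; apply hne; simp at this; simp [this]
        · omega
      · simp
    rw [mul_sub, coeff_sub] at this
    rw [sub_eq_iff_eq_add] at this; rw [this]; abel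
  · refine ⟨(A * K).coeff n - A.coeff n, by abel, ?_⟩
    have : ((A - B) * K).coeff n = A.coeff n - B.coeff n := by
      rw [coeff_mul, Finset.sum_eq_single (n, 0)]
      · simp [hK]
      · rintro ⟨i, j⟩ hx hne
        have := Finset.HasAntidiagonal.mem_antidiagonal.1 hx
        simp only at this ⊢
        rw [coeff_sub, h i, sub_self, zero_mul]
        rcases Nat.eq_zero_or_pos j with h0 | h0
        · subst h0; exfalso; apply hne; simp at this; simp [this]
        · omega
      · simp
    rw [sub_mul, coeff_sub] at this
    rw [sub_eq_iff_eq_add] at this; rw [this]; abel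

noncomputable def ordF : LinearOrder (FreeGroup Bool) := LinearOrder.lift' ordMap ordMap_inj

/-- The bi-order, as a class. -/
class BiOrd (G : Type) [Group G] extends LinearOrder G where
  mul_lt_l : ∀ k {g h : G}, g < h → k * g < k * h
  mul_lt_r : ∀ k {g h : G}, g < h → g * k < h * k

noncomputable def biOrdF : BiOrd (FreeGroup Bool) where
  toLinearOrder := ordF
  mul_lt_l k g h hlt := by
    have hlt : ordMap g < ordMap h := hlt
    change ordMap _ < ordMap _
    obtain ⟨n, h1, h2⟩ := hlt
    obtain ⟨a1, _, ⟨c, c1, c2⟩, _⟩ := ord_core _ _ n (fun j hj => vec_inj (h1 j hj)) (rho k).1 (rho_zero k)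
    refine ⟨n, fun j hj => ?_, ?_⟩
    · change vec ((rho (k * g)).1.coeff j) = vec ((rho (k * h)).1.coeff j)
      rw [map_mul, map_mul, Units.val_mul, Units.val_mul, a1 j hj]
    · change vec ((rho (k * g)).1.coeff n) < vec ((rho (k * h)).1.coeff n)
      rw [map_mul, map_mul, Units.val_mul, Units.val_mul, c1, c2, vec_add, vec_add]
      exact add_lt_add_left h2 _
  mul_lt_r k g h hlt := by
    have hlt : ordMap g < ordMap h := hlt
    change ordMap _ < ordMap _
    obtain ⟨n, h1, h2⟩ := hlt
    obtain ⟨_, a1, _, ⟨c, c1, c2⟩⟩ := ord_core _ _ n (fun j hj => vec_inj (h1 j hj)) (rho k).1 (rho_zero k)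
    refine ⟨n, fun j hj => ?_, ?_⟩
    · change vec ((rho (g * k)).1.coeff j) = vec ((rho (h * k)).1.coeff j)
      rw [map_mul, map_mul, Units.val_mul, Units.val_mul, a1 j hj]
    · change vec ((rho (g * k)).1.coeff n) < vec ((rho (h * k)).1.coeff n)
      rw [map_mul, map_mul, Units.val_mul, Units.val_mul, c1, c2, vec_add, vec_add]
      exact add_lt_add_left h2 _

end Eq9

namespace Eq9
open Filter

abbrev F := FreeGroup Bool

def Z : Type := F ×ₗ Bool

def mkZ (g : F) (x : Bool) : Z := toLex (g, x)

lemma mkZ_surj (z : Z) : ∃ g x, z = mkZ g x := ⟨(ofLex z).1, (ofLex z).2, rfl⟩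

lemma mkZ_inj {g h : F} {x y : Bool} : mkZ g x = mkZ h y ↔ g = h ∧ x = y := by
  constructor
  · intro e
    have e : (g, x) = (h, y) := congrArg (fun z : Z => (ofLex (α := F × Bool) z)) e
    exact Prod.mk.inj e
  · rintro ⟨rfl, rfl⟩; rfl

instance : Inhabited Z := ⟨mkZ 1 true⟩

instance : MulAction F Z where
  smul g z := mkZ (g * (ofLex (α := F × Bool) z).1) (ofLex (α := F × Bool) z).2
  one_smul z := by
    change mkZ (1 * _) _ = z
    rw [one_mul]; rfl
  mul_smul g h z := by
    change mkZ (g * h * _) _ = mkZ (g * (h * _)) _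
    rw [mul_assoc]; rfl

lemma smul_mk (g h : F) (x : Bool) : g • mkZ h x = mkZ (g * h) x := rfl

lemma smul_free {g h : F} {z : Z} (e : g • z = h • z) : g = h := by
  obtain ⟨k, x, rfl⟩ := mkZ_surj z
  rw [smul_mk, smul_mk, mkZ_inj] at e
  exact mul_right_cancel e.1

abbrev Fn := Z → ZMod 2

/-- translate -/
def sh (g : F) (D : Fn) : Fn := fun z => D (g⁻¹ • z)

lemma sh_add (g : F) (D E : Fn) : sh g (D + E) = sh g D + sh g E := rfl
lemma sh_zero (g : F) : sh g 0 = 0 := rfl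
lemma sh_mul (g h : F) (D : Fn) : sh (g * h) D = sh g (sh h D) := by
  funext z; simp [sh, mul_smul]
lemma sh_one (D : Fn) : sh 1 D = D := by
  funext z; simp [sh]
lemma fn_add_self (D : Fn) : D + D = 0 := by
  funext z; exact CharTwo.add_self_eq_zero _
lemma sh_apply (g : F) (D : Fn) (z : Z) : sh g D z = D (g⁻¹ • z) := rfl

open Classical in
noncomputable def del (g : F) (x : Bool) : Fn := fun z => if z = mkZ g x then 1 else 0

lemma sh_del (h g : F) (x : Bool) : sh h (del g x) = del (h * g) x := by
  funext z
  simp only [sh, del]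
  rw [show (h⁻¹ • z = mkZ g x) = (z = mkZ (h * g) x) from by rw [inv_smul_eq_iff, smul_mk]]

noncomputable def genPerm (x : Bool) : Equiv.Perm Fn where
  toFun D := del 1 x + sh (FreeGroup.of x) D
  invFun D := sh (FreeGroup.of x)⁻¹ (del 1 x + D)
  left_inv D := by
    change sh (FreeGroup.of x)⁻¹ (del 1 x + (del 1 x + sh (FreeGroup.of x) D)) = D
    rw [← add_assoc, fn_add_self, zero_add, ← sh_mul, inv_mul_cancel, sh_one]
  right_inv D := by
    change del 1 x + sh (FreeGroup.of x) (sh (FreeGroup.of x)⁻¹ (del 1 x + D)) = D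
    rw [← sh_mul, mul_inv_cancel, sh_one, ← add_assoc, fn_add_self, zero_add]

noncomputable def Lam : F →* Equiv.Perm Fn := FreeGroup.lift genPerm

noncomputable def c (g : F) : Fn := Lam g 0

lemma Lam_eq (g : F) (D : Fn) : Lam g D = c g + sh g D := by
  induction g using FreeGroup.induction_on generalizing D with
  | C1 => simp [c, sh_one]
  | of x =>
    change genPerm x D = genPerm x 0 + _
    simp [genPerm, sh_zero]
  | inv_of x _ =>
    have key : ∀ D, Lam (FreeGroup.of x)⁻¹ D = sh (FreeGroup.of x)⁻¹ (del 1 x + D) := by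
      intro D
      rw [map_inv]
      rfl
    rw [c, key, key, sh_add, sh_add, sh_zero, add_zero]
  | mul g h ih1 ih2 =>
    rw [c, map_mul, Equiv.Perm.mul_apply, Equiv.Perm.mul_apply, ih2, ih1, ih2, ih1, sh_zero,
      sh_mul, sh_add, add_zero, add_assoc]

lemma c_mul (g h : F) : c (g * h) = c g + sh g (c h) := by
  rw [← Lam_eq, c, map_mul]; rfl

lemma c_one : c 1 = 0 := by simp [c]

lemma c_of (x : Bool) : c (FreeGroup.of x) = del 1 x := by
  change genPerm x 0 = _
  simp [genPerm, sh_zero]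

lemma c_mul_of (g : F) (x : Bool) : c (g * FreeGroup.of x) = c g + del g x := by
  rw [c_mul, c_of, sh_del, mul_one]

lemma c_inv (g : F) : c g⁻¹ = sh g⁻¹ (c g) := by
  have := c_mul g⁻¹ g
  rw [inv_mul_cancel, c_one] at this
  have h2 := congrArg (· + sh g⁻¹ (c g)) this
  simp only [zero_add, add_assoc, fn_add_self, add_zero] at h2
  exact h2.symm

lemma supp_sh (g : F) (D : Fn) : Function.support (sh g D) = (fun z => g⁻¹ • z) ⁻¹' Function.support D := rfl

lemma c_fin (g : F) : (Function.support (c g)).Finite := by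
  induction g using FreeGroup.induction_on with
  | C1 => simp [c_one]
  | of x =>
    rw [c_of]
    refine (Set.finite_singleton (mkZ 1 x)).subset fun z hz => ?_
    by_contra h
    exact hz (if_neg h)
  | inv_of x ih =>
    rw [c_inv, supp_sh]
    exact ih.preimage (MulAction.injective _).injOn
  | mul g h ih1 ih2 =>
    rw [c_mul]
    have h3 : (Function.support (sh g (c h))).Finite := by
      rw [supp_sh]
      exact ih2.preimage (MulAction.injective _).injOn
    exact (ih1.union h3).subset (Function.support_add _ _)

lemma ev_const {α : Type} (f : ℕ → α) (h : ∀ᶠ N in atTop, f (N + 1) = f N) : ∃ r, ∀ᶠ N in atTop, f N = r := by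
  obtain ⟨M, hM⟩ := eventually_atTop.1 h
  refine ⟨f M, eventually_atTop.2 ⟨M, fun N hN => ?_⟩⟩
  induction N, hN using Nat.le_induction with
  | base => rfl
  | succ n hn ih => rw [hM n hn, ih]

open Classical in
/-- boundary plus base point -/
noncomputable def bd (D : Fn) (g : F) : ZMod 2 := (if g = 1 then 1 else 0) +
  ((D (mkZ g true) + D (mkZ (g * (FreeGroup.of true)⁻¹) true)) +
   (D (mkZ g false) + D (mkZ (g * (FreeGroup.of false)⁻¹) false)))

lemma bd_gen (x : Bool) (D : Fn) (g : F) : bd (genPerm x D) g = bd D ((FreeGroup.of x)⁻¹ * g) := by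
  classical
  have e1 : ∀ h y, (genPerm x D) (mkZ h y) = (if h = 1 ∧ y = x then 1 else 0) + D (mkZ ((FreeGroup.of x)⁻¹ * h) y) := by
    intro h y
    simp only [genPerm, Equiv.coe_fn_mk, Pi.add_apply, del, mkZ_inj, sh_apply, smul_mk]
  simp only [bd, e1, mul_assoc]
  have h2 : (2 : ZMod 2) = 0 := rfl
  have e2 : ∀ y, (g * (FreeGroup.of y)⁻¹ = 1 ↔ g = FreeGroup.of y) := fun y => by
    rw [mul_inv_eq_one]
  have e3 : ((FreeGroup.of x)⁻¹ * g = 1 ↔ g = FreeGroup.of x) := by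
    rw [inv_mul_eq_one, eq_comm]
  simp only [e2, e3]
  cases x
  · simp only [and_true, Bool.true_eq_false, and_false, if_false]
    linear_combination (if g = 1 then 1 else 0) * h2
  · simp only [and_true, Bool.false_eq_true, and_false, if_false]
    linear_combination (if g = 1 then 1 else 0) * h2

lemma bd_Lam (g : F) (D : Fn) (h : F) : bd (Lam g D) h = bd D (g⁻¹ * h) := by
  induction g using FreeGroup.induction_on generalizing D h with
  | C1 => simp
  | of x => exact bd_gen x D h
  | inv_of x _ =>
    have h1 := bd_gen x (Lam (FreeGroup.of x)⁻¹ D) (FreeGroup.of x * h)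
    have h2 : genPerm x (Lam (FreeGroup.of x)⁻¹ D) = D := by
      rw [map_inv]
      change genPerm x ((genPerm x)⁻¹ D) = D
      simp
    rw [h2] at h1
    simpa using h1.symm
  | mul g k ih1 ih2 =>
    rw [map_mul, Equiv.Perm.mul_apply, ih1, ih2, mul_inv_rev, mul_assoc]

lemma bd_sum (D : Fn) (hD : (Function.support D).Finite) : ∑ᶠ g, bd D g = 1 := by
  classical
  have inj : ∀ x, Function.Injective (fun g => mkZ g x) := fun x g h e => (mkZ_inj.1 e).1
  have f1 : ∀ x, (Function.support (fun g => D (mkZ g x))).Finite := fun x =>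
    hD.preimage (f := fun g => mkZ g x) (inj x).injOn
  have f2 : ∀ x, (Function.support (fun g => D (mkZ (g * (FreeGroup.of x)⁻¹) x))).Finite := fun x =>
    hD.preimage (f := fun g => mkZ (g * (FreeGroup.of x)⁻¹) x) (((inj x).comp (mul_left_injective _)).injOn)
  have s : ∀ x, ∑ᶠ g, (D (mkZ g x) + D (mkZ (g * (FreeGroup.of x)⁻¹) x)) = 0 := by
    intro x
    rw [finsum_add_distrib (f1 x) (f2 x)]
    have := finsum_comp_equiv (Equiv.mulRight (FreeGroup.of x)⁻¹) (f := fun g => D (mkZ g x))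
    simp only [Equiv.coe_mulRight] at this
    rw [this]; exact CharTwo.add_self_eq_zero _
  have f3 : ∀ x, (Function.support (fun g => D (mkZ g x) + D (mkZ (g * (FreeGroup.of x)⁻¹) x))).Finite :=
    fun x => ((f1 x).union (f2 x)).subset (Function.support_add _ _)
  have f4 : (Function.support (fun g : F => if g = 1 then (1 : ZMod 2) else 0)).Finite := by
    refine (Set.finite_singleton (1 : F)).subset fun g hg => ?_
    by_contra h; exact hg (if_neg h)
  unfold bd
  rw [finsum_add_distrib f4 (((f3 true).union (f3 false)).subset (Function.support_add _ _)),
    finsum_add_distrib (f3 true) (f3 false), s, s]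
  rw [finsum_eq_single _ (1 : F) (fun g hg => if_neg hg)]
  simp

lemma bd_fin (D : Fn) (hD : (Function.support D).Finite) : (Function.support (bd D)).Finite := by
  by_contra h
  have := bd_sum D hD
  rw [finsum_of_infinite_support h] at this
  exact zero_ne_one this

lemma comm_of_zpow {u v : F} {i j : ℤ} (hi : i ≠ 0) (h : u ^ i = v ^ j) : u * v = v * u := by
  have h1 : (v * u * v⁻¹) ^ i = u ^ i := by
    rw [conj_zpow, h, mul_inv_eq_iff_eq_mul, ← zpow_one_add, ← zpow_add_one, add_comm]
  have := zpow_left_injective hi h1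
  rw [mul_inv_eq_iff_eq_mul] at this
  exact this.symm

lemma rays_pwo {α : Type} [LinearOrder α] (f : ℕ → α → α) (hf : ∀ p, Monotone (fun n => f n p))
    (P : Set α) (hP : P.Finite) : {z | ∃ n, ∃ p ∈ P, z = f n p}.IsPWO := by
  induction P, hP using Set.Finite.induction_on with
  | empty => simp
  | @insert a s _ _ ih =>
    have h1 : (Set.range (fun n => f n a)).IsPWO := by
      rw [← Set.image_univ]
      exact (Set.isPWO_of_wellQuasiOrderedLE _).image_of_monotone (hf a)
    refine (h1.union ih).mono ?_
    rintro z ⟨n, p, hp, rfl⟩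
    rcases hp with rfl | hp
    · exact Or.inl ⟨n, rfl⟩
    · exact Or.inr ⟨n, p, hp, rfl⟩

section HN
variable [BiOrd F]

noncomputable instance : LinearOrder Z := inferInstanceAs (LinearOrder (F ×ₗ Bool))

lemma mkZ_lt {g h : F} {x y : Bool} : mkZ g x < mkZ h y ↔ g < h ∨ g = h ∧ x < y :=
  Prod.Lex.toLex_lt_toLex

lemma smul_lt_r (g : F) {z w : Z} (h : z < w) : g • z < g • w := by
  obtain ⟨k, x, rfl⟩ := mkZ_surj z
  obtain ⟨l, y, rfl⟩ := mkZ_surj w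
  rw [smul_mk, smul_mk, mkZ_lt]
  rw [mkZ_lt] at h
  rcases h with h | ⟨rfl, h⟩
  · exact Or.inl (BiOrd.mul_lt_l _ h)
  · exact Or.inr ⟨rfl, h⟩

lemma smul_lt_l {g h : F} (hlt : g < h) (z : Z) : g • z < h • z := by
  obtain ⟨k, x, rfl⟩ := mkZ_surj z
  rw [smul_mk, smul_mk, mkZ_lt]
  exact Or.inl (BiOrd.mul_lt_r _ hlt)

lemma smul_le_r (g : F) {z w : Z} (h : z ≤ w) : g • z ≤ g • w := by
  rcases h.lt_or_eq with h | rfl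
  · exact (smul_lt_r g h).le
  · exact le_rfl

lemma inv_lt_of {g h : F} (hlt : g < h) : h⁻¹ < g⁻¹ := by
  have := BiOrd.mul_lt_r h⁻¹ (BiOrd.mul_lt_l g⁻¹ hlt)
  simpa using this

lemma pow_lt {u : F} (hu : 1 < u) : StrictMono (fun n : ℕ => u ^ n) := by
  apply strictMono_nat_of_lt_succ
  intro n
  have := BiOrd.mul_lt_l (u ^ n) hu
  simpa [pow_succ] using this

lemma fin_rel {T : Set F} (hT : T.IsPWO) {X : Set Z} (hX : X.IsPWO) (z : Z) :
    {h | h ∈ T ∧ h⁻¹ • z ∈ X}.Finite := by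
  by_contra hi
  have hi : Set.Infinite _ := hi
  obtain ⟨g, hg⟩ := hT.exists_monotone_subseq (f := fun n => (hi.natEmbedding _ n).1)
    (fun n => (hi.natEmbedding _ n).2.1)
  obtain ⟨m, n, hmn, hle⟩ := Set.PartiallyWellOrderedOn.exists_lt hX
    (f := fun n => ((hi.natEmbedding _ (g n)).1)⁻¹ • z) (fun n => (hi.natEmbedding _ (g n)).2.2)
  have h1 : (hi.natEmbedding _ (g m)).1 < (hi.natEmbedding _ (g n)).1 := by
    refine lt_of_le_of_ne (hg hmn.le) fun e => ?_
    have := g.injective ((hi.natEmbedding _).injective (Subtype.ext e))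
    omega
  exact absurd hle (not_le.2 (smul_lt_l (inv_lt_of h1) z))

lemma ev_not {u : F} (hu : 1 < u) {X : Set Z} (hX : X.IsPWO) (z : Z) :
    ∀ᶠ N : ℕ in atTop, (u ^ N)⁻¹ • z ∉ X := by
  have hT : (Set.range (fun n : ℕ => u ^ n)).IsPWO := by
    rw [← Set.image_univ]
    exact (Set.isPWO_of_wellQuasiOrderedLE _).image_of_monotone (pow_lt hu).monotone
  have := (fin_rel hT hX z).preimage (f := fun n : ℕ => u ^ n) (pow_lt hu).injective.injOn
  rw [← Nat.cofinite_eq_atTop]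
  refine this.subset ?_
  intro n hn
  simp only [Set.mem_compl_iff, Set.mem_ofPred_eq, not_not] at hn
  exact ⟨⟨n, rfl⟩, hn⟩

lemma c_pow_ev {u : F} (hu : 1 < u) (z : Z) : ∃ r, ∀ᶠ N : ℕ in atTop, c (u ^ N) z = r := by
  apply ev_const
  filter_upwards [ev_not hu (c_fin u).isPWO z] with N hN
  rw [pow_succ, c_mul, Pi.add_apply, sh_apply, Function.notMem_support.1 hN, add_zero]

open Classical in
noncomputable def DD (u : F) : Fn := fun z => if h : 1 < u then (c_pow_ev h z).choose else 0

lemma DD_ev {u : F} (hu : 1 < u) (z : Z) : ∀ᶠ N : ℕ in atTop, c (u ^ N) z = DD u z := by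
  have := (c_pow_ev hu z).choose_spec
  simpa [DD, hu] using this

lemma DD_eq {u : F} (hu : 1 < u) : DD u = c u + sh u (DD u) := by
  funext z
  obtain ⟨N, h1, h2⟩ := (((tendsto_add_atTop_nat 1).eventually (DD_ev hu z)).and (DD_ev hu (u⁻¹ • z))).exists
  rw [← h1, Pi.add_apply, sh_apply, ← h2, pow_succ', c_mul]; rfl

lemma smul_pow_mono {u : F} (hu : 1 < u) (z : Z) : Monotone (fun n : ℕ => u ^ n • z) := by
  apply StrictMono.monotone
  intro m n h
  exact smul_lt_l (pow_lt hu h) z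

lemma DD_supp {u : F} (hu : 1 < u) : Function.support (DD u) ⊆ {z | ∃ n : ℕ, ∃ p ∈ Function.support (c u), z = u ^ n • p} := by
  have key : ∀ N : ℕ, Function.support (c (u ^ N)) ⊆ {z | ∃ n : ℕ, ∃ p ∈ Function.support (c u), z = u ^ n • p} := by
    intro N
    induction N with
    | zero => simp [c_one]
    | succ n ih =>
      rw [pow_succ, c_mul]
      refine (Function.support_add _ _).trans (Set.union_subset ih ?_)
      intro z hz
      exact ⟨n, (u ^ n)⁻¹ • z, hz, by simp⟩
  intro z hz
  obtain ⟨N, hN⟩ := (DD_ev hu z).exists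
  exact key N (by rw [Function.mem_support, hN]; exact hz)

lemma DD_pwo {u : F} (hu : 1 < u) : (Function.support (DD u)).IsPWO :=
  (rays_pwo (fun n z => u ^ n • z) (fun p => smul_pow_mono hu p) _ (c_fin u)).mono (DD_supp hu)

lemma DD_inf {u : F} (hu : 1 < u) : (Function.support (DD u)).Infinite := by
  intro hf
  have h1 : Lam u (DD u) = DD u := by rw [Lam_eq, ← DD_eq hu]
  have hb := bd_fin _ hf
  have hne : (Function.support (bd (DD u))).Nonempty := by
    rw [Set.nonempty_iff_ne_empty]
    intro h
    rw [Function.support_eq_empty_iff] at h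
    have := bd_sum _ hf
    rw [h] at this
    simp at this
  obtain ⟨m, hm, hmax⟩ := Set.exists_max_image _ id hb hne
  have : u * m ∈ Function.support (bd (DD u)) := by
    rw [Function.mem_support, ← h1, bd_Lam, inv_mul_cancel_left]; exact hm
  have h3 := hmax _ this
  have h4 := BiOrd.mul_lt_r m hu
  rw [one_mul] at h4
  exact absurd h3 (not_le.2 h4)

lemma DD_ne {u v : F} (hu : 1 < u) (hv : 1 < v) (h : u * v ≠ v * u) : DD u ≠ DD v := by
  intro he
  have hinf := DD_inf hu
  have hQ : ∀ z ∈ Function.support (DD u), ∃ w : (Z × Z), w ∈ (Function.support (c u)) ×ˢ (Function.support (c v)) ∧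
      ∃ n m : ℕ, z = u ^ n • w.1 ∧ z = v ^ m • w.2 := by
    intro z hz
    obtain ⟨n, p, hp, e⟩ := DD_supp hu hz
    rw [he] at hz
    obtain ⟨m, q, hq, e'⟩ := DD_supp hv hz
    exact ⟨(p, q), ⟨hp, hq⟩, n, m, e, e'⟩
  choose! f hf hnm using hQ
  obtain ⟨z, hz, z', hz', hne, hfe⟩ := hinf.exists_ne_map_eq_of_mapsTo (f := f) hf ((c_fin u).prod (c_fin v))
  obtain ⟨n, m, e1, e2⟩ := hnm z hz
  obtain ⟨n', m', e3, e4⟩ := hnm z' hz'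
  rw [← hfe] at e3 e4
  generalize f z = w at e1 e2 e3 e4
  have a1 : u ^ ((n' : ℤ) - n) • z = z' := by
    rw [e3, e1, ← mul_smul, ← zpow_natCast u n, ← zpow_natCast u n', ← zpow_add]; congr 2; ring
  have a2 : v ^ ((m' : ℤ) - m) • z = z' := by
    rw [e4, e2, ← mul_smul, ← zpow_natCast v m, ← zpow_natCast v m', ← zpow_add]; congr 2; ring
  refine h (comm_of_zpow (i := (n' : ℤ) - n) ?_ (smul_free (a1.trans a2.symm)))
  intro h0
  rw [h0, zpow_zero, one_smul] at a1
  exact hne a1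

end HN
end Eq9

namespace Eq9
open Filter

lemma fn_eq_of_add {D E : Fn} (h : D + E = 0) : D = E := by
  have := congrArg (· + E) h
  simpa [add_assoc, fn_add_self] using this

lemma z2_eq_of_add {a b : ZMod 2} (h : a + b = 0) : a = b := by
  rwa [CharTwo.add_eq_zero] at h

noncomputable def lc (Δ : Fn) : (F →₀ ZMod 2) →ₗ[ZMod 2] Fn :=
  Finsupp.linearCombination (ZMod 2) (fun h : F => sh h Δ)

lemma lc_single (Δ : Fn) (h : F) : lc Δ (Finsupp.single h 1) = sh h Δ := by
  simp [lc]

lemma sh_lc (Δ : Fn) (g : F) (a : F →₀ ZMod 2) : sh g (lc Δ a) = lc Δ (a.mapDomain (g * ·)) := by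
  induction a using Finsupp.induction_linear with
  | zero => simp [sh_zero]
  | add a b ha hb => rw [map_add, sh_add, ha, hb, Finsupp.mapDomain_add, map_add]
  | single h r =>
    rw [Finsupp.mapDomain_single]
    simp only [lc, Finsupp.linearCombination_single, sh_mul]
    rfl

lemma supp_mapDomain (g h : F) (a : F →₀ ZMod 2) (hh : h ∈ (a.mapDomain (g * ·)).support) :
    ∃ p ∈ a.support, h = g * p := by
  classical
  have := Finsupp.mapDomain_support hh
  obtain ⟨p, hp, e⟩ := Finset.mem_image.1 this
  exact ⟨p, hp, e.symm⟩

/-- c h + h D + D -/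
noncomputable def kap (D : Fn) (h : F) : Fn := c h + sh h D + D

lemma kap_mul (D : Fn) (g h : F) : kap D (g * h) = kap D g + sh g (kap D h) := by
  simp only [kap, c_mul, sh_mul, sh_add]
  have := fn_add_self (sh g D)
  calc _ = c g + sh g (c h) + sh g (sh h D) + D + 0 := by rw [add_zero]
    _ = c g + sh g (c h) + sh g (sh h D) + D + (sh g D + sh g D) := by rw [this]
    _ = _ := by abel

lemma kap_one (D : Fn) : kap D 1 = 0 := by
  simp [kap, c_one, sh_one, fn_add_self]

lemma kap_inv (D : Fn) (g : F) : kap D g⁻¹ = sh g⁻¹ (kap D g) := by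
  have := kap_mul D g⁻¹ g
  rw [inv_mul_cancel, kap_one] at this
  exact fn_eq_of_add this.symm

lemma kap_lc (D Δ : Fn) (x y : F) (hx : kap D x = 0) (hy : kap D y = sh y Δ + Δ) (h : F)
    (hh : h ∈ Subgroup.closure {x, y}) : ∃ a : F →₀ ZMod 2, (∀ k ∈ a.support, k ∈ Subgroup.closure {x, y}) ∧
      kap D h = lc Δ a := by
  classical
  induction hh using Subgroup.closure_induction with
  | mem g hg =>
    rcases hg with rfl | hg
    · exact ⟨0, by simp, by simp [hx]⟩
    · have hg : g = y := hg
      subst hg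
      refine ⟨Finsupp.single g 1 + Finsupp.single 1 1, ?_, ?_⟩
      · intro k hk
        rcases Finset.mem_union.1 (Finsupp.support_add hk) with hk | hk
        · rw [Finset.mem_singleton.1 (Finsupp.support_single_subset hk)]
          exact Subgroup.subset_closure (by simp)
        · rw [Finset.mem_singleton.1 (Finsupp.support_single_subset hk)]
          exact one_mem _
      · rw [map_add, lc_single, lc_single, hy, sh_one]
  | one => exact ⟨0, by simp, by simp [kap_one]⟩
  | mul g k hg hk ih1 ih2 =>
    obtain ⟨a, ha, ea⟩ := ih1
    obtain ⟨b, hb, eb⟩ := ih2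
    refine ⟨a + b.mapDomain (g * ·), ?_, ?_⟩
    · intro l hl
      rcases Finset.mem_union.1 (Finsupp.support_add hl) with hl | hl
      · exact ha l hl
      · obtain ⟨p, hp, rfl⟩ := supp_mapDomain _ _ _ hl
        exact mul_mem hg (hb p hp)
    · rw [kap_mul, ea, eb, sh_lc, map_add]
  | inv g hg ih =>
    obtain ⟨a, ha, ea⟩ := ih
    refine ⟨a.mapDomain (g⁻¹ * ·), ?_, ?_⟩
    · intro l hl
      obtain ⟨p, hp, rfl⟩ := supp_mapDomain _ _ _ hl
      exact mul_mem (inv_mem hg) (ha p hp)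
    · rw [kap_inv, ea, sh_lc]

noncomputable def aSeq (u : F) (a : F →₀ ZMod 2) : ℕ → (F →₀ ZMod 2)
  | 0 => 0
  | n + 1 => aSeq u a n + a.mapDomain (u ^ n * ·)

lemma aSeq_kap (D Δ : Fn) (u : F) (a : F →₀ ZMod 2) (h : kap D u = lc Δ a) (n : ℕ) :
    kap D (u ^ n) = lc Δ (aSeq u a n) := by
  induction n with
  | zero => simp [kap_one, aSeq]
  | succ n ih => rw [pow_succ, kap_mul, ih, h, sh_lc, aSeq, map_add]

lemma aSeq_supp (u : F) (a : F →₀ ZMod 2) (n : ℕ) (h : F) (hh : aSeq u a n h ≠ 0) :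
    ∃ m : ℕ, ∃ p ∈ (a.support : Set F), h = u ^ m * p := by
  classical
  induction n with
  | zero => simp [aSeq] at hh
  | succ n ih =>
    by_cases h1 : aSeq u a n h = 0
    · rw [aSeq, Finsupp.add_apply, h1, zero_add] at hh
      obtain ⟨p, hp, e⟩ := supp_mapDomain (u ^ n) h a (Finsupp.mem_support_iff.2 hh)
      exact ⟨n, p, hp, e⟩
    · exact ih h1

lemma lc_apply (Δ : Fn) (a : F →₀ ZMod 2) (z : Z) (R : Finset F)
    (hR : ∀ h, a h ≠ 0 → Δ (h⁻¹ • z) ≠ 0 → h ∈ R) : lc Δ a z = ∑ h ∈ R, a h * Δ (h⁻¹ • z) := by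
  classical
  have h1 : lc Δ a z = ∑ h ∈ a.support, a h * Δ (h⁻¹ • z) := by
    simp [lc, Finsupp.linearCombination_apply, Finsupp.sum, Finset.sum_apply, sh_apply]
  rw [h1]
  trans ∑ h ∈ a.support ∪ R, a h * Δ (h⁻¹ • z)
  · apply Finset.sum_subset Finset.subset_union_left
    intro h _ hn
    rw [Finsupp.notMem_support_iff.1 hn, zero_mul]
  · symm
    apply Finset.sum_subset Finset.subset_union_right
    intro h _ hn
    by_contra hc
    exact hn (hR h (left_ne_zero_of_mul hc) (right_ne_zero_of_mul hc))

section HN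
variable [BiOrd F]

def LD (u v : F) (z : Z) : Prop := DD u z ≠ DD v z ∧ ∀ z' < z, DD u z' = DD v z'

lemma exists_LD {u v : F} (hu : 1 < u) (hv : 1 < v) (h : DD u ≠ DD v) : ∃ z, LD u v z := by
  have hp : {z | DD u z ≠ DD v z}.IsPWO := by
    refine ((DD_pwo hu).union (DD_pwo hv)).mono ?_
    intro z hz
    by_contra hc
    simp only [Set.mem_union, Function.mem_support, not_or, not_not] at hc
    exact hz (hc.1.trans hc.2.symm)
  have hne : {z | DD u z ≠ DD v z}.Nonempty := by
    by_contra hc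
    apply h
    funext z
    by_contra h2
    exact hc ⟨z, h2⟩
  refine ⟨hp.isWF.min hne, hp.isWF.min_mem hne, fun z' hz' => ?_⟩
  by_contra hc
  exact hp.isWF.not_lt_min hne hc hz'

lemma mul_pow_mono {u : F} (hu : 1 < u) (p : F) : Monotone (fun n : ℕ => u ^ n * p) := by
  apply StrictMono.monotone
  intro m n h
  exact BiOrd.mul_lt_r _ (pow_lt hu h)

lemma aSeq_ev {u : F} (hu : 1 < u) (a : F →₀ ZMod 2) (h : F) : ∃ r, ∀ᶠ N in atTop, aSeq u a N h = r := by
  apply ev_const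
  have hinj : Function.Injective (fun n : ℕ => (u ^ n)⁻¹ * h) := by
    intro m n e
    exact (pow_lt hu).injective (inv_injective (mul_right_cancel e))
  have hf := (a.support.finite_toSet).preimage hinj.injOn
  have : ∀ᶠ N : ℕ in atTop, N ∉ (fun n : ℕ => (u ^ n)⁻¹ * h) ⁻¹' (a.support : Set F) := by
    rw [← Nat.cofinite_eq_atTop]; exact hf.eventually_cofinite_notMem
  filter_upwards [this] with N hN
  rw [aSeq, Finsupp.add_apply]
  have : (a.mapDomain (u ^ N * ·)) h = 0 := by
    by_contra hc
    obtain ⟨p, hp, e⟩ := supp_mapDomain (u ^ N) h a (Finsupp.mem_support_iff.2 hc)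
    apply hN
    change (u ^ N)⁻¹ * h ∈ (a.support : Set F)
    rw [e, inv_mul_cancel_left]; exact hp
  rw [this, add_zero]

lemma limA {x u : F} (hx : 1 < x) (hu : 1 < u) {Δ : Fn} {a : F →₀ ZMod 2}
    (ha : kap (DD x) u = lc Δ a) (z : Z) : ∀ᶠ N in atTop, lc Δ (aSeq u a N) z + DD x z = DD u z := by
  filter_upwards [DD_ev hu z, ev_not hu (DD_pwo hx) z] with N h1 h2
  rw [← aSeq_kap _ _ _ _ ha, ← h1, kap]
  simp only [Pi.add_apply, sh_apply]
  rw [Function.notMem_support.1 h2, add_zero, add_assoc, CharTwo.add_self_eq_zero, add_zero]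

theorem lemmaA {x y : F} (hx : 1 < x) (hy : 1 < y) (hne : DD x ≠ DD y) :
    ∃ e0 : Z, ∀ u ∈ Subgroup.closure {x, y}, ∀ v ∈ Subgroup.closure {x, y}, 1 < u → 1 < v →
      ∀ z, LD u v z → ∃ h ∈ Subgroup.closure {x, y}, z = h • e0 := by
  obtain ⟨e0, he0, hlt0⟩ := exists_LD hx hy hne
  refine ⟨e0, fun u hu v hv hu1 hv1 z hz => ?_⟩
  set Δ : Fn := DD x + DD y with hΔ
  have hΔ0 : Δ e0 ≠ 0 := fun h => he0 (z2_eq_of_add h)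
  have hΔlt : ∀ z' < e0, Δ z' = 0 := fun z' hz' => by
    rw [hΔ, Pi.add_apply, hlt0 z' hz', CharTwo.add_self_eq_zero]
  have hΔp : (Function.support Δ).IsPWO :=
    ((DD_pwo hx).union (DD_pwo hy)).mono (Function.support_add _ _)
  have kx : kap (DD x) x = 0 := by
    rw [kap, ← DD_eq hx, fn_add_self]
  have ky : kap (DD x) y = sh y Δ + Δ := by
    have e := DD_eq hy
    have e2 : c y = DD y + sh y (DD y) := by
      conv_rhs => rw [e, add_assoc]
      rw [← e, fn_add_self, add_zero]
    rw [kap, hΔ, sh_add, e2]; abel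
  obtain ⟨a, ha, ea⟩ := kap_lc _ Δ x y kx ky u hu
  obtain ⟨b, hb, eb⟩ := kap_lc _ Δ x y kx ky v hv
  choose A hA using aSeq_ev hu1 a
  choose B hB using aSeq_ev hv1 b
  set T : Set F := {h | ∃ m : ℕ, ∃ p ∈ (a.support : Set F), h = u ^ m * p} ∪
    {h | ∃ m : ℕ, ∃ p ∈ (b.support : Set F), h = v ^ m * p} with hT
  have Tp : T.IsPWO := (rays_pwo (fun n p => u ^ n * p) (mul_pow_mono hu1) _ a.support.finite_toSet).union
    (rays_pwo (fun n p => v ^ n * p) (mul_pow_mono hv1) _ b.support.finite_toSet)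
  have TH : ∀ h ∈ T, h ∈ Subgroup.closure {x, y} := by
    rintro h (⟨m, p, hp, rfl⟩ | ⟨m, p, hp, rfl⟩)
    · exact mul_mem (pow_mem hu _) (ha p hp)
    · exact mul_mem (pow_mem hv _) (hb p hp)
  have formula : ∀ z, DD u z + DD v z = ∑ h ∈ (fin_rel Tp hΔp z).toFinset, (A h + B h) * Δ (h⁻¹ • z) := by
    intro z
    set R := (fin_rel Tp hΔp z).toFinset with hR
    have h1 : ∀ᶠ N in atTop, ∀ h ∈ R, aSeq u a N h = A h :=
      (Filter.eventually_all_finset R).2 fun h _ => hA h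
    have h2 : ∀ᶠ N in atTop, ∀ h ∈ R, aSeq v b N h = B h :=
      (Filter.eventually_all_finset R).2 fun h _ => hB h
    obtain ⟨N, h1, h2, h3, h4⟩ := (h1.and (h2.and ((limA hx hu1 ea z).and (limA hx hv1 eb z)))).exists
    rw [← h3, ← h4, lc_apply Δ _ z R, lc_apply Δ _ z R,
      add_add_add_comm, CharTwo.add_self_eq_zero, add_zero, ← Finset.sum_add_distrib]
    · refine Finset.sum_congr rfl fun h hh => ?_
      rw [h1 h hh, h2 h hh, add_mul]
    · intro h n1 n2
      rw [hR, Set.Finite.mem_toFinset]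
      exact ⟨Or.inr (aSeq_supp _ _ _ _ n1), n2⟩
    · intro h n1 n2
      rw [hR, Set.Finite.mem_toFinset]
      exact ⟨Or.inl (aSeq_supp _ _ _ _ n1), n2⟩
  have ST : {h | A h + B h ≠ 0} ⊆ T := by
    intro h hh
    by_contra hc
    apply hh
    have hA0 : A h = 0 := by
      by_contra h0
      obtain ⟨N, hN⟩ := (hA h).exists
      exact hc (Or.inl (aSeq_supp u a N h (by rw [hN]; exact h0)))
    have hB0 : B h = 0 := by
      by_contra h0
      obtain ⟨N, hN⟩ := (hB h).exists
      exact hc (Or.inr (aSeq_supp v b N h (by rw [hN]; exact h0)))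
    rw [hA0, hB0, add_zero]
  have hzne : DD u z + DD v z ≠ 0 := fun h => hz.1 (z2_eq_of_add h)
  have Sne : {h | A h + B h ≠ 0}.Nonempty := by
    by_contra hc
    apply hzne
    rw [formula]
    refine Finset.sum_eq_zero fun h _ => ?_
    have : A h + B h = 0 := by
      by_contra h0; exact hc ⟨h, h0⟩
    rw [this, zero_mul]
  have Swf := (Tp.mono ST).isWF
  set h0 := Swf.min Sne with hh0
  have h0m : A h0 + B h0 ≠ 0 := Swf.min_mem Sne
  have h0le : ∀ h, A h + B h ≠ 0 → h0 ≤ h := fun h hh => Swf.min_le Sne hh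
  refine ⟨h0, TH _ (ST h0m), ?_⟩
  rcases lt_trichotomy z (h0 • e0) with hlt | heq | hgt
  · exfalso; apply hzne
    rw [formula]
    refine Finset.sum_eq_zero fun h _ => ?_
    by_cases hc : A h + B h = 0
    · rw [hc, zero_mul]
    · rw [hΔlt, mul_zero]
      have h1 := h0le h hc
      have h2 : z < h • e0 := by
        rcases h1.lt_or_eq with h1 | h1
        · exact hlt.trans (smul_lt_l h1 _)
        · rw [← h1]; exact hlt
      have := smul_lt_r h⁻¹ h2
      rwa [inv_smul_smul] at this
  · exact heq
  · exfalso
    have h1 := hz.2 _ hgt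
    have h2 := formula (h0 • e0)
    rw [h1, CharTwo.add_self_eq_zero, Finset.sum_eq_single h0] at h2
    · rw [inv_smul_smul] at h2
      exact (mul_ne_zero h0m hΔ0) h2.symm
    · intro h _ hne'
      by_cases hc : A h + B h = 0
      · rw [hc, zero_mul]
      · rw [hΔlt, mul_zero]
        have h1 := lt_of_le_of_ne (h0le h hc) hne'.symm
        have := smul_lt_r h⁻¹ (smul_lt_l h1 e0)
        rwa [inv_smul_smul] at this
    · intro hn
      by_contra _
      apply hn
      rw [Set.Finite.mem_toFinset]
      exact ⟨ST h0m, by rw [inv_smul_smul]; exact hΔ0⟩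

end HN
end Eq9

namespace Eq9
open Filter

def Comm (J : Subgroup F) : Prop := ∀ u ∈ J, ∀ v ∈ J, u * v = v * u

def Gen2 (J : Subgroup F) : Prop := ∃ x y, J = Subgroup.closure {x, y}

lemma free_comm_subsingleton {α : Type*} (h : ∀ x y : FreeGroup α, x * y = y * x) : Subsingleton α := by
  classical
  constructor
  intro a b
  by_contra hne
  have h1 := h (FreeGroup.of a) (FreeGroup.of b)
  have h2 := congrArg (FreeGroup.lift (fun x => if x = a then Equiv.swap (0 : Fin 3) 1 else Equiv.swap 1 2)) h1
  simp only [map_mul, FreeGroup.lift_apply_of, if_true, if_neg (Ne.symm hne)] at h2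
  exact absurd h2 (by decide)

lemma comm_cyclic {β : Type} (J : Subgroup (FreeGroup β)) (h : ∀ u ∈ J, ∀ v ∈ J, u * v = v * u) :
    ∃ x, J = Subgroup.closure {x} := by
  have e := IsFreeGroup.mulEquiv (G := J)
  have hs : Subsingleton (IsFreeGroup.Generators J) := by
    apply free_comm_subsingleton
    intro x y
    apply e.injective
    rw [map_mul, map_mul]
    exact Subtype.ext (h _ (e x).2 _ (e y).2)
  have hc : IsCyclic J := by
    rcases isEmpty_or_nonempty (IsFreeGroup.Generators J) with h0 | h0
    · exact isCyclic_of_surjective (G' := FreeGroup (IsFreeGroup.Generators J)) e e.surjective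
    · obtain ⟨d⟩ := h0
      let _ : Unique (IsFreeGroup.Generators J) := ⟨⟨d⟩, fun _ => Subsingleton.elim _ _⟩
      exact isCyclic_of_surjective (G' := FreeGroup (IsFreeGroup.Generators J)) e e.surjective
  obtain ⟨g, hg⟩ := hc.exists_generator
  refine ⟨g.1, le_antisymm ?_ ?_⟩
  · intro x hx
    obtain ⟨n, hn⟩ := Subgroup.mem_zpowers_iff.1 (hg ⟨x, hx⟩)
    rw [← Subgroup.zpowers_eq_closure, Subgroup.mem_zpowers_iff]
    exact ⟨n, by simpa using congrArg Subtype.val hn⟩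
  · rw [Subgroup.closure_le]; simp

/-- `g ≈ h` relative to the `J`-orbit of `e` -/
def Eqv (J : Subgroup F) (e : Z) (g h : F) : Prop := ∀ j ∈ J, c g (j • e) = c h (j • e)

lemma Eqv.refl (J : Subgroup F) (e : Z) (g : F) : Eqv J e g g := fun _ _ => rfl
lemma Eqv.symm {J : Subgroup F} {e : Z} {g h : F} (H : Eqv J e g h) : Eqv J e h g := fun j hj => (H j hj).symm
lemma Eqv.trans {J : Subgroup F} {e : Z} {g h k : F} (H : Eqv J e g h) (H' : Eqv J e h k) : Eqv J e g k :=
  fun j hj => (H j hj).trans (H' j hj)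
lemma Eqv.mul {J : Subgroup F} {e : Z} {g h : F} (H : Eqv J e g h) {k : F} (hk : k ∈ J) : Eqv J e (k * g) (k * h) := by
  intro j hj
  rw [c_mul, c_mul, Pi.add_apply, Pi.add_apply, sh_apply, sh_apply, ← mul_smul, H _ (mul_mem (inv_mem hk) hj)]

lemma Eqv.cancel {J : Subgroup F} {e : Z} {g h : F} {k : F} (hk : k ∈ J) (H : Eqv J e (k * g) (k * h)) : Eqv J e g h := by
  have := H.mul (inv_mem hk)
  simpa using this

def stabA (J : Subgroup F) (e : Z) (p : F) : Subgroup F where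
  carrier := {j | j ∈ J ∧ Eqv J e (j * p) p}
  one_mem' := ⟨one_mem _, by rw [one_mul]; exact Eqv.refl _ _ _⟩
  mul_mem' := by
    rintro a b ⟨ha, ha'⟩ ⟨hb, hb'⟩
    exact ⟨mul_mem ha hb, by rw [mul_assoc]; exact (hb'.mul ha).trans ha'⟩
  inv_mem' := by
    rintro a ⟨ha, ha'⟩
    refine ⟨inv_mem ha, ?_⟩
    have := ha'.mul (inv_mem ha)
    rw [inv_mul_cancel_left] at this
    exact this.symm

lemma mem_stabA {J : Subgroup F} {e : Z} {p j : F} : j ∈ stabA J e p ↔ j ∈ J ∧ Eqv J e (j * p) p := Iff.rfl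

lemma gen_all (Y : Set F) (p : F) (hp : p ∈ Y) (h1 : ∀ g ∈ Y, ∀ x, g * FreeGroup.of x ∈ Y)
    (h2 : ∀ g ∈ Y, ∀ x, g * (FreeGroup.of x)⁻¹ ∈ Y) (g : F) : g ∈ Y := by
  have key : ∀ w : F, ∀ g ∈ Y, g * w ∈ Y := by
    intro w
    induction w using FreeGroup.induction_on with
    | C1 => intro g hg; simpa using hg
    | of x => intro g hg; exact h1 g hg x
    | inv_of x _ => intro g hg; exact h2 g hg x
    | mul a b ha hb => intro g hg; rw [← mul_assoc]; exact hb _ (ha _ hg)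
  have := key (p⁻¹ * g) p hp
  rwa [mul_inv_cancel_left] at this

lemma Eqv_edge (J : Subgroup F) (e : Z) (g : F) (x : Bool) (h : ∀ j ∈ J, mkZ g x ≠ j • e) :
    Eqv J e (g * FreeGroup.of x) g := by
  intro j hj
  rw [c_mul_of, Pi.add_apply, del, if_neg (h j hj).symm, add_zero]

lemma J_gen (J : Subgroup F) (g0 : F) (x0 : Bool) (L : Subgroup F) (hL : L ≤ J)
    (hp : stabA J (mkZ g0 x0) g0 ≤ L)
    (key : (stabA J (mkZ g0 x0) (g0 * FreeGroup.of x0) ≤ L ∧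
      ¬ ∃ t ∈ J, Eqv J (mkZ g0 x0) (g0 * FreeGroup.of x0) (t * g0)) ∨
      ∃ t ∈ L, Eqv J (mkZ g0 x0) (g0 * FreeGroup.of x0) (t * g0)) : J = L := by
  set e := mkZ g0 x0 with he
  set q := g0 * FreeGroup.of x0 with hq
  set Y : Set F := {g | ∃ l ∈ L, Eqv J e g (l * g0) ∨ Eqv J e g (l * q)} with hY
  have F1 : ∀ j ∈ J, ∀ l ∈ L, Eqv J e (j * g0) (l * g0) → j ∈ L := by
    intro j hj l hl H
    have : l⁻¹ * j ∈ stabA J e g0 := by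
      refine ⟨mul_mem (inv_mem (hL hl)) hj, ?_⟩
      have := H.mul (inv_mem (hL hl))
      rwa [inv_mul_cancel_left, ← mul_assoc] at this
    have := mul_mem hl (hp this)
    rwa [mul_inv_cancel_left] at this
  have F2 : ∀ j ∈ J, ∀ l ∈ L, Eqv J e (j * g0) (l * q) → j ∈ L := by
    intro j hj l hl H
    rcases key with ⟨_, k2⟩ | ⟨t, ht, k⟩
    · exfalso; apply k2
      refine ⟨l⁻¹ * j, mul_mem (inv_mem (hL hl)) hj, ?_⟩
      have := H.symm.mul (inv_mem (hL hl))
      rwa [inv_mul_cancel_left, ← mul_assoc] at this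
    · refine F1 j hj (l * t) (mul_mem hl ht) (H.trans ?_)
      rw [mul_assoc]; exact k.mul (hL hl)
  have F3 : ∀ j ∈ J, ∀ l ∈ L, Eqv J e (j * q) (l * q) → j ∈ L := by
    intro j hj l hl H
    rcases key with ⟨k1, k2⟩ | ⟨t, ht, k⟩
    · have : l⁻¹ * j ∈ stabA J e q := by
        refine ⟨mul_mem (inv_mem (hL hl)) hj, ?_⟩
        have := H.mul (inv_mem (hL hl))
        rwa [inv_mul_cancel_left, ← mul_assoc] at this
      have := mul_mem hl (k1 this)
      rwa [mul_inv_cancel_left] at this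
    · have h1 : j * t ∈ L := by
        apply F2 (j * t) (mul_mem hj (hL ht)) l hl
        rw [mul_assoc]; exact (k.mul hj).symm.trans H
      have := mul_mem h1 (inv_mem ht)
      rwa [mul_inv_cancel_right] at this
  have F4 : ∀ j ∈ J, ∀ l ∈ L, Eqv J e (j * q) (l * g0) → j ∈ L := by
    intro j hj l hl H
    have h := F2 l (hL hl)
    rcases key with ⟨k1, k2⟩ | ⟨t, ht, k⟩
    · exfalso; apply k2
      refine ⟨j⁻¹ * l, mul_mem (inv_mem hj) (hL hl), ?_⟩
      have := H.mul (inv_mem hj)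
      rwa [inv_mul_cancel_left, ← mul_assoc] at this
    · have h1 : j * t ∈ L := by
        apply F1 (j * t) (mul_mem hj (hL ht)) l hl
        rw [mul_assoc]; exact (k.mul hj).symm.trans H
      have := mul_mem h1 (inv_mem ht)
      rwa [mul_inv_cancel_right] at this
  have all : ∀ g, g ∈ Y := by
    apply gen_all Y g0
    · exact ⟨1, one_mem _, Or.inl (by rw [one_mul]; exact Eqv.refl _ _ _)⟩
    · rintro g ⟨l, hl, hg⟩ x
      by_cases hc : ∃ j ∈ J, mkZ g x = j • e
      · obtain ⟨j, hj, ej⟩ := hc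
        rw [he, smul_mk, mkZ_inj] at ej
        obtain ⟨rfl, rfl⟩ := ej
        have hjL : j ∈ L := by
          rcases hg with hg | hg
          · exact F1 j hj l hl hg
          · exact F2 j hj l hl hg
        exact ⟨j, hjL, Or.inr (by rw [mul_assoc]; exact Eqv.refl _ _ _)⟩
      · push Not at hc
        have := Eqv_edge J e g x hc
        exact ⟨l, hl, hg.imp this.trans this.trans⟩
    · rintro g ⟨l, hl, hg⟩ x
      by_cases hc : ∃ j ∈ J, mkZ (g * (FreeGroup.of x)⁻¹) x = j • e
      · obtain ⟨j, hj, ej⟩ := hc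
        rw [he, smul_mk, mkZ_inj] at ej
        obtain ⟨e1, rfl⟩ := ej
        have e2 : g = j * q := by rw [hq, ← mul_assoc, ← e1]; simp
        rw [e2] at hg
        have hjL : j ∈ L := by
          rcases hg with hg | hg
          · exact F4 j hj l hl hg
          · exact F3 j hj l hl hg
        exact ⟨j, hjL, Or.inl (by rw [e1]; exact Eqv.refl _ _ _)⟩
      · push Not at hc
        have := Eqv_edge J e _ x hc
        rw [inv_mul_cancel_right] at this
        exact ⟨l, hl, hg.imp this.symm.trans this.symm.trans⟩
  refine le_antisymm (fun j hj => ?_) hL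
  obtain ⟨l, hl, h | h⟩ := all (j * g0)
  · exact F1 j hj l hl h
  · exact F2 j hj l hl h

lemma closure_comm {x y : F} (h : x * y = y * x) : Comm (Subgroup.closure {x, y}) := by
  have : ∀ u ∈ ({x, y} : Set F), ∀ v ∈ ({x, y} : Set F), u * v = v * u := by
    rintro u (rfl | rfl) v (rfl | rfl) <;> simp [h]
  intro u hu v hv
  have hc := Subgroup.closure_le_centralizer_centralizer ({x, y} : Set F)
  have h1 : Subgroup.closure {x, y} ≤ Subgroup.centralizer ({x, y} : Set F) := by
    rw [Subgroup.closure_le]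
    intro a ha
    exact Subgroup.mem_centralizer_iff.2 fun b hb => this b hb a ha
  have h2 := Subgroup.mem_centralizer_iff.1 (hc hu) v (h1 hv)
  exact h2.symm

section HN
variable [BiOrd F]

lemma pos_or {x : F} (h : x ≠ 1) : 1 < x ∨ 1 < x⁻¹ := by
  rcases lt_trichotomy 1 x with h1 | h1 | h1
  · exact Or.inl h1
  · exact absurd h1.symm h
  · right
    have := inv_lt_of h1
    simpa using this

/-- can choose positive representatives -/
lemma pos_rep {u v : F} (h : u * v ≠ v * u) : ∃ u' v', (u' = u ∨ u' = u⁻¹) ∧ (v' = v ∨ v' = v⁻¹) ∧ 1 < u' ∧ 1 < v' ∧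
    u' * v' ≠ v' * u' := by
  have hu : u ≠ 1 := by rintro rfl; simp at h
  have hv : v ≠ 1 := by rintro rfl; simp at h
  have key : ∀ u' v', (u' = u ∨ u' = u⁻¹) → (v' = v ∨ v' = v⁻¹) → u' * v' ≠ v' * u' := by
    intro u' v' h1 h2 h3
    have h3 : Commute u' v' := h3
    apply h
    change Commute u v
    rcases h1 with rfl | rfl <;> rcases h2 with rfl | rfl
    · exact h3
    · simpa using h3
    · simpa using h3
    · simpa using h3
  rcases pos_or hu with h1 | h1 <;> rcases pos_or hv with h2 | h2
  · exact ⟨u, v, Or.inl rfl, Or.inl rfl, h1, h2, h⟩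
  · exact ⟨u, v⁻¹, Or.inl rfl, Or.inr rfl, h1, h2, key _ _ (Or.inl rfl) (Or.inr rfl)⟩
  · exact ⟨u⁻¹, v, Or.inr rfl, Or.inl rfl, h1, h2, key _ _ (Or.inr rfl) (Or.inl rfl)⟩
  · exact ⟨u⁻¹, v⁻¹, Or.inr rfl, Or.inr rfl, h1, h2, key _ _ (Or.inr rfl) (Or.inr rfl)⟩

lemma stabA_DD {J : Subgroup F} {e : Z} {p u : F} (hu : u ∈ stabA J e p) (h1 : 1 < u) (j : F) (hj : j ∈ J) :
    DD u (j • e) = c p (j • e) := by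
  obtain ⟨N, h2, h3⟩ := ((DD_ev h1 (j • e)).and (ev_not h1 (c_fin p).isPWO (j • e))).exists
  have h4 := (pow_mem hu N).2 j hj
  rw [c_mul, Pi.add_apply, sh_apply, Function.notMem_support.1 h3, add_zero, h2] at h4
  exact h4

lemma stabA_comm {J : Subgroup F} {e : Z}
    (hB : ∀ u ∈ J, ∀ v ∈ J, 1 < u → 1 < v → ∀ z, LD u v z → ∃ h ∈ J, z = h • e) (p : F) :
    Comm (stabA J e p) := by
  intro u hu v hv
  by_contra hne
  obtain ⟨u', v', eu, ev, hu1, hv1, hne'⟩ := pos_rep hne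
  have hu' : u' ∈ stabA J e p := by
    rcases eu with rfl | rfl
    exacts [hu, inv_mem hu]
  have hv' : v' ∈ stabA J e p := by
    rcases ev with rfl | rfl
    exacts [hv, inv_mem hv]
  obtain ⟨z, hz⟩ := exists_LD hu1 hv1 (DD_ne hu1 hv1 hne')
  obtain ⟨j, hj, rfl⟩ := hB u' hu'.1 v' hv'.1 hu1 hv1 z hz
  exact hz.1 ((stabA_DD hu' hu1 j hj).trans (stabA_DD hv' hv1 j hj).symm)

theorem lemmaB {J : Subgroup F} {e : Z}
    (hB : ∀ u ∈ J, ∀ v ∈ J, 1 < u → 1 < v → ∀ z, LD u v z → ∃ h ∈ J, z = h • e) : Gen2 J := by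
  obtain ⟨g0, x0, rfl⟩ := mkZ_surj e
  obtain ⟨s, hs⟩ := comm_cyclic _ (stabA_comm hB g0)
  have hsJ : s ∈ J := by
    have : s ∈ stabA J (mkZ g0 x0) g0 := by rw [hs]; exact Subgroup.subset_closure rfl
    exact this.1
  by_cases hc : ∃ t ∈ J, Eqv J (mkZ g0 x0) (g0 * FreeGroup.of x0) (t * g0)
  · obtain ⟨t, ht, hE⟩ := hc
    refine ⟨s, t, J_gen J g0 x0 _ ?_ ?_ (Or.inr ⟨t, Subgroup.subset_closure (by simp), hE⟩)⟩
    · rw [Subgroup.closure_le]; rintro x (rfl | rfl); exacts [hsJ, ht]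
    · rw [hs]; exact Subgroup.closure_mono (by simp)
  · obtain ⟨t, ht⟩ := comm_cyclic _ (stabA_comm hB (g0 * FreeGroup.of x0))
    have htJ : t ∈ J := by
      have : t ∈ stabA J (mkZ g0 x0) (g0 * FreeGroup.of x0) := by rw [ht]; exact Subgroup.subset_closure rfl
      exact this.1
    refine ⟨s, t, J_gen J g0 x0 _ ?_ ?_ (Or.inl ⟨?_, hc⟩)⟩
    · rw [Subgroup.closure_le]; rintro x (rfl | rfl); exacts [hsJ, htJ]
    · rw [hs]; exact Subgroup.closure_mono (by simp)
    · rw [ht]; exact Subgroup.closure_mono (by simp)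

theorem hn_aux (S : Set (Subgroup F)) (hne : S.Nonempty) (hS : ∀ H ∈ S, Gen2 H) (hnc : ¬ Comm (sInf S)) :
    Gen2 (sInf S) := by
  unfold Comm at hnc
  push Not at hnc
  obtain ⟨u, hu, v, hv, huv⟩ := hnc
  obtain ⟨u', v', eu, ev, hu1, hv1, hne'⟩ := pos_rep huv
  have hu' : u' ∈ sInf S := by
    rcases eu with rfl | rfl
    exacts [hu, inv_mem hu]
  have hv' : v' ∈ sInf S := by
    rcases ev with rfl | rfl
    exacts [hv, inv_mem hv]
  obtain ⟨e, he⟩ := exists_LD hu1 hv1 (DD_ne hu1 hv1 hne')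
  apply lemmaB (e := e)
  intro u2 hu2 v2 hv2 hu2' hv2' z hz
  have key : ∀ H ∈ S, ∃ h ∈ H, z = h • e := by
    intro H hH
    obtain ⟨x, y, hxy⟩ := hS H hH
    have hn : x * y ≠ y * x := by
      intro hc
      have := closure_comm hc
      rw [← hxy] at this
      exact huv (this u (Subgroup.mem_sInf.1 hu H hH) v (Subgroup.mem_sInf.1 hv H hH))
    obtain ⟨x', y', ex, ey, hx1, hy1, hn'⟩ := pos_rep hn
    have hxy' : H = Subgroup.closure {x', y'} := by
      rw [hxy]
      apply le_antisymm <;> rw [Subgroup.closure_le]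
      · rintro w (rfl | rfl)
        · rcases ex with rfl | rfl
          · exact Subgroup.subset_closure (by simp)
          · exact inv_mem_iff.1 (Subgroup.subset_closure (by simp))
        · rcases ey with rfl | rfl
          · exact Subgroup.subset_closure (by simp)
          · exact inv_mem_iff.1 (Subgroup.subset_closure (by simp))
      · rintro w (rfl | rfl)
        · rcases ex with rfl | rfl
          · exact Subgroup.subset_closure (by simp)
          · exact inv_mem (Subgroup.subset_closure (by simp))
        · rcases ey with rfl | rfl
          · exact Subgroup.subset_closure (by simp)
          · exact inv_mem (Subgroup.subset_closure (by simp))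
    obtain ⟨e0, he0⟩ := lemmaA hx1 hy1 (DD_ne hx1 hy1 hn')
    rw [← hxy'] at he0
    obtain ⟨h1, hh1, q1⟩ := he0 _ (Subgroup.mem_sInf.1 hu' H hH) _ (Subgroup.mem_sInf.1 hv' H hH) hu1 hv1 e he
    obtain ⟨h2, hh2, q2⟩ := he0 _ (Subgroup.mem_sInf.1 hu2 H hH) _ (Subgroup.mem_sInf.1 hv2 H hH) hu2' hv2' z hz
    refine ⟨h2 * h1⁻¹, mul_mem hh2 (inv_mem hh1), ?_⟩
    rw [q1, q2, ← mul_smul, inv_mul_cancel_right]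
  obtain ⟨H0, hH0⟩ := hne
  obtain ⟨h, hh, eh⟩ := key H0 hH0
  refine ⟨h, Subgroup.mem_sInf.2 fun H hH => ?_, eh⟩
  obtain ⟨h', hh', eh'⟩ := key H hH
  rw [smul_free (eh.symm.trans eh')]; exact hh'

end HN

theorem hn (S : Set (Subgroup F)) (hne : S.Nonempty) (hS : ∀ H ∈ S, Gen2 H) (hnc : ¬ Comm (sInf S)) :
    Gen2 (sInf S) := by
  letI := biOrdF
  exact hn_aux S hne hS hnc

end Eq9

namespace Eq9

/-- letters -/
abbrev Lt := Bool × Bool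
def lt (s : Lt) : F := FreeGroup.mk [s]
def iv (s : Lt) : Lt := (s.1, !s.2)
def hd (g : F) : Option Lt := g.toWord.head?

lemma iv_iv (s : Lt) : iv (iv s) = s := by simp [iv]
lemma iv_ne (s : Lt) : iv s ≠ s := by rcases s with ⟨x, y⟩; cases y <;> simp [iv]
lemma lt_iv (s : Lt) : lt (iv s) = (lt s)⁻¹ := by simp [lt, iv, FreeGroup.invRev]
lemma lt_word (s : Lt) : (lt s).toWord = [s] := by simp [lt, FreeGroup.reduce_singleton]
lemma hd_lt (s : Lt) : hd (lt s) = some s := by simp [hd, lt_word]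
lemma norm_lt (s : Lt) : (lt s).norm = 1 := by simp [FreeGroup.norm, lt_word]
lemma hd_one : hd 1 = none := by simp [hd]
lemma hd_none {g : F} : hd g = none ↔ g = 1 := by simp [hd]
lemma of_eq_lt (x : Bool) : FreeGroup.of x = lt (x, true) := rfl
lemma lt_inj {s t : Lt} (h : lt s = lt t) : s = t := by
  have := congrArg hd h
  simpa [hd_lt] using this

lemma hd_inv_none {g : F} : hd g⁻¹ = none ↔ g = 1 := by rw [hd_none, inv_eq_one]

lemma hd_inv (g : F) (s : Lt) : hd g⁻¹ = some s ↔ g.toWord.getLast? = some (iv s) := by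
  rw [hd, FreeGroup.toWord_inv, FreeGroup.invRev, List.head?_reverse, List.getLast?_map]
  cases g.toWord.getLast? with
  | none => simp
  | some t => simp only [Option.map_some, Option.some.injEq]
              rcases t with ⟨t1, t2⟩; rcases s with ⟨s1, s2⟩
              cases t2 <;> cases s2 <;> simp [iv]

lemma mul_word {g h : F} (H : ∀ s, hd g⁻¹ = some s → hd h ≠ some s) :
    (g * h).toWord = g.toWord ++ h.toWord := by
  rw [FreeGroup.toWord_mul]
  apply FreeGroup.IsReduced.reduce_eq
  rw [FreeGroup.IsReduced, List.isChain_append]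
  refine ⟨FreeGroup.isReduced_toWord, FreeGroup.isReduced_toWord, ?_⟩
  intro x hx y hy hxy
  by_contra hne
  have h1 : hd g⁻¹ = some (iv x) := by rw [hd_inv, iv_iv]; simpa using hx
  apply H _ h1
  have : y = iv x := by
    rcases x with ⟨x1, x2⟩; rcases y with ⟨y1, y2⟩
    simp only at hxy hne; subst hxy
    cases x2 <;> cases y2 <;> simp_all [iv]
  rw [← this]; exact Option.mem_def.1 hy

lemma mul_norm {g h : F} (H : ∀ s, hd g⁻¹ = some s → hd h ≠ some s) :
    (g * h).norm = g.norm + h.norm := by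
  simp [FreeGroup.norm, mul_word H]

lemma mul_hd {g h : F} (H : ∀ s, hd g⁻¹ = some s → hd h ≠ some s) (hg : g ≠ 1) :
    hd (g * h) = hd g := by
  rw [hd, mul_word H, List.head?_append_of_ne_nil _ (by simpa using hg)]; rfl

lemma hd_inv_lt (s : Lt) : hd (lt s)⁻¹ = some (iv s) := by rw [← lt_iv, hd_lt]

lemma lt_ne (s : Lt) : lt s ≠ 1 := by
  intro h; have := norm_lt s; rw [h] at this; simp at this

lemma lt_mul {g : F} {s : Lt} (H : hd g ≠ some (iv s)) : hd (lt s * g) = some s ∧ (lt s * g).norm = g.norm + 1 := by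
  have : ∀ t, hd (lt s)⁻¹ = some t → hd g ≠ some t := by
    intro t ht; rw [hd_inv_lt] at ht; rwa [← ht]
  refine ⟨by rw [mul_hd this (lt_ne s), hd_lt], by rw [mul_norm this, norm_lt, add_comm]⟩

lemma hd_cons {g : F} {s : Lt} (h : hd g = some s) : hd ((lt s)⁻¹ * g) ≠ some (iv s) ∧ ((lt s)⁻¹ * g).norm + 1 = g.norm := by
  have key : ∃ g' : F, g = lt s * g' ∧ hd g' ≠ some (iv s) := by
    rw [hd, List.head?_eq_some_iff] at h
    obtain ⟨L, hL⟩ := h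
    have hr : FreeGroup.IsReduced (s :: L) := by rw [← hL]; exact FreeGroup.isReduced_toWord
    have hr' : FreeGroup.IsReduced L := hr.infix (List.suffix_cons s L).isInfix
    refine ⟨FreeGroup.mk L, ?_, ?_⟩
    · rw [lt, FreeGroup.mul_mk, List.singleton_append, ← hL, FreeGroup.mk_toWord]
    · rw [hd, FreeGroup.toWord_mk, hr'.reduce_eq]
      intro h
      rw [List.head?_eq_some_iff] at h
      obtain ⟨L', rfl⟩ := h
      rw [FreeGroup.IsReduced, List.isChain_cons_cons] at hr
      have := hr.1 rfl
      simp [iv] at this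
  obtain ⟨g', rfl, hg'⟩ := key
  rw [inv_mul_cancel_left]
  exact ⟨hg', (lt_mul hg').2.symm⟩

/-- right multiplication by a letter keeps the first letter -/
lemma hd_mul_lt {g : F} {s t : Lt} (h : hd g = some s) (hn : g * lt t ≠ 1) : hd (g * lt t) = some s := by
  by_cases H : hd g⁻¹ = some t
  · obtain ⟨h1, h2⟩ := hd_cons H
    have hk : g = (g * lt t) * (lt (iv t)) := by rw [lt_iv]; group
    have h3 : hd (g * lt t)⁻¹ ≠ some (iv t) := by rwa [mul_inv_rev]
    rw [hk, mul_hd _ hn] at h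
    · exact h
    · intro u hu hu'
      rw [hd_lt] at hu'; rw [hu, hu'] at h3; exact h3 rfl
  · rw [mul_hd, h]
    · intro u hu hu'
      rw [hd_lt] at hu'; rw [hu, hu'] at H; exact H rfl
    · rintro rfl; simp [hd_one] at h

lemma hd_mul_lt' {g : F} {s t : Lt} (h : hd g = some s) (hn : iv t ≠ s) : hd (g * lt t) = some s := by
  apply hd_mul_lt h
  intro h1
  rw [mul_eq_one_iff_eq_inv, ← lt_iv] at h1
  rw [h1, hd_lt] at h; simp at h; exact hn h

lemma norm_hd_le (g : F) (s : Lt) : (lt s * g).norm ≤ g.norm + 1 := by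
  have := FreeGroup.norm_mul_le (lt s) g; rw [norm_lt] at this; omega

lemma norm_ge {g : F} (h : g ≠ 1) : 1 ≤ g.norm := by
  by_contra h'
  exact h (FreeGroup.norm_eq_zero.1 (by omega))

lemma exists_hd {g : F} (h : g ≠ 1) : ∃ s, hd g = some s := by
  cases h' : hd g with
  | none => exact absurd (hd_none.1 h') h
  | some s => exact ⟨s, rfl⟩

/-- powers keep the first letter -/
lemma hd_pow (n : ℕ) : ∀ (P : F), P.norm ≤ n → P ≠ 1 → ∀ k : ℕ, hd (P ^ (k + 1)) = hd P ∧ P ^ (k + 1) ≠ 1 := by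
  induction n using Nat.strong_induction_on with
  | _ n ih =>
    intro P hP h1
    by_cases hc : hd P⁻¹ = hd P
    · obtain ⟨s, hs⟩ := exists_hd h1
      have hs' := hc.trans hs
      obtain ⟨h2, h3⟩ := hd_cons hs
      -- P = s Q, Q⁻¹ = P⁻¹ s
      set Q := (lt s)⁻¹ * P * lt s with hQ
      have hPQ : P = lt s * Q * (lt s)⁻¹ := by rw [hQ]; group
      have hQ1 : Q ≠ 1 := by
        intro h; rw [h] at hPQ; apply h1; rw [hPQ]; group
      have hP1 : (lt s)⁻¹ * P ≠ 1 := by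
        intro h
        have : P = lt s := by rw [inv_mul_eq_one] at h; exact h.symm
        rw [this, hd_inv_lt, hd_lt] at hc; simp at hc; exact iv_ne s hc
      have h4 : hd ((lt s)⁻¹ * P)⁻¹ = some s := by
        rw [mul_inv_rev, inv_inv]; apply hd_mul_lt hs'
        intro h; apply hP1; rw [← inv_eq_one, mul_inv_rev, inv_inv, h]
      obtain ⟨h5, h6⟩ := hd_cons h4
      have h7 : Q⁻¹ = (lt s)⁻¹ * ((lt s)⁻¹ * P)⁻¹ := by rw [hQ]; group
      rw [← h7] at h5 h6
      rw [FreeGroup.norm_inv_eq] at h6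
      rw [FreeGroup.norm_inv_eq] at h6
      have hQn : hd Q ≠ some (iv s) := by
        intro h
        have : hd (Q * lt (iv s)) = some (iv s) := by
          apply hd_mul_lt h
          intro h8; apply hP1
          rw [hQ, lt_iv] at h8
          simpa [mul_assoc] using h8
        apply h2
        rw [hQ, lt_iv] at this
        simpa [mul_assoc] using this
      intro k
      have hk := ih Q.norm (by omega) Q le_rfl hQ1 k
      have hk' := ih Q⁻¹.norm (by rw [FreeGroup.norm_inv_eq]; omega) Q⁻¹ le_rfl (by simpa using hQ1) k
      have e : P ^ (k + 1) = lt s * (Q ^ (k + 1) * (lt (iv s))) := by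
        rw [hPQ, conj_pow, lt_iv]; group
      have h9 : hd (Q ^ (k + 1) * lt (iv s)) = hd Q := by
        rw [mul_hd, hk.1]
        · intro u hu hu'
          rw [← inv_pow, hk'.1] at hu; rw [hd_lt] at hu'; rw [hu, hu'] at h5; exact h5 rfl
        · exact hk.2
      have h10 := lt_mul (s := s) (g := Q ^ (k + 1) * lt (iv s)) (by rw [h9]; exact hQn)
      rw [← e] at h10
      refine ⟨by rw [h10.1, hs], ?_⟩
      intro h; rw [h] at h10; simp [hd_one] at h10
    · intro k
      induction k with
      | zero => simpa using h1
      | succ k ihk =>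
        have : ∀ s, hd P⁻¹ = some s → hd (P ^ (k + 1)) ≠ some s := by
          intro s hs h; rw [ihk.1] at h; exact hc (hs.trans h.symm)
        rw [pow_succ' P (k + 1)]
        refine ⟨mul_hd this h1, ?_⟩
        intro h
        have h' := mul_hd this h1
        rw [h, hd_one] at h'; exact h1 (hd_none.1 h'.symm)

lemma hd_zpow {P : F} (h1 : P ≠ 1) {k : ℤ} (hk : k ≠ 0) : P ^ k ≠ 1 ∧ (hd (P ^ k) = hd P ∧ hd (P ^ k)⁻¹ = hd P⁻¹ ∨
    hd (P ^ k) = hd P⁻¹ ∧ hd (P ^ k)⁻¹ = hd P) := by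
  have h1' : P⁻¹ ≠ 1 := by simpa using h1
  obtain ⟨n, hn⟩ : ∃ n : ℕ, k = (n + 1 : ℕ) ∨ k = -((n + 1 : ℕ) : ℤ) := ⟨k.natAbs - 1, by omega⟩
  have ha := hd_pow _ P le_rfl h1 n
  have hb := hd_pow _ P⁻¹ le_rfl h1' n
  rcases hn with rfl | rfl
  · rw [zpow_natCast, ← inv_pow]
    exact ⟨ha.2, Or.inl ⟨ha.1, hb.1⟩⟩
  · rw [zpow_neg, zpow_natCast, inv_inv, ← inv_pow]
    exact ⟨hb.2, Or.inr ⟨hb.1, ha.1⟩⟩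

end Eq9

namespace Eq9

abbrev ga : F := FreeGroup.of true
abbrev gb : F := FreeGroup.of false

def GP (x y : F) : Prop := Subgroup.closure {x, y} = ⊤

structure NPr (Pr : F → F → Prop) : Prop where
  conj : ∀ g x y, Pr x y → Pr (g * x * g⁻¹) (g * y * g⁻¹)
  swap : ∀ x y, Pr x y → Pr y x
  inv : ∀ x y, Pr x y → Pr x y⁻¹
  sh : ∀ x y, Pr x y → Pr (x * y⁻¹) y⁻¹

lemma GP_of {x y x' y' : F} (h : GP x y) (hx : x ∈ Subgroup.closure {x', y'}) (hy : y ∈ Subgroup.closure {x', y'}) : GP x' y' := by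
  rw [GP, eq_top_iff, ← h, Subgroup.closure_le]
  rintro z (rfl | rfl)
  exacts [hx, hy]

lemma mem1 (x y : F) : x ∈ Subgroup.closure {x, y} := Subgroup.subset_closure (by simp)
lemma mem2 (x y : F) : y ∈ Subgroup.closure {x, y} := Subgroup.subset_closure (by simp)

lemma GP_npr : NPr GP where
  conj := by
    intro g x y h
    rw [GP, eq_top_iff]
    intro z _
    have : ∀ u ∈ Subgroup.closure {x, y}, g * u * g⁻¹ ∈ Subgroup.closure {g * x * g⁻¹, g * y * g⁻¹} := by
      intro u hu
      induction hu using Subgroup.closure_induction with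
      | mem u hu => rcases hu with rfl | rfl
                    · exact mem1 _ _
                    · exact mem2 _ _
      | one => simp
      | mul u v _ _ h1 h2 => have := mul_mem h1 h2; simpa [mul_assoc] using this
      | inv u _ h1 => have := inv_mem h1; simpa [mul_assoc] using this
    rw [h] at this
    have := this (g⁻¹ * z * g) trivial
    simpa [mul_assoc] using this
  swap := fun x y h => GP_of h (mem2 _ _) (mem1 _ _)
  inv := fun x y h => GP_of h (mem1 _ _) (by simpa using inv_mem (mem2 x y⁻¹))
  sh := fun x y h => GP_of h (by simpa using mul_mem (mem1 (x * y⁻¹) y⁻¹) (inv_mem (mem2 (x * y⁻¹) y⁻¹)))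
    (by simpa using inv_mem (mem2 (x * y⁻¹) y⁻¹))

lemma NPr.imp {Pr : F → F → Prop} (h : NPr Pr) : NPr (fun x y => GP x y → Pr x y) where
  conj := by
    intro g x y H hg
    apply h.conj; apply H
    have := GP_npr.conj g⁻¹ _ _ hg
    simpa [mul_assoc] using this
  swap := fun x y H hg => h.swap _ _ (H (GP_npr.swap _ _ hg))
  inv := fun x y H hg => h.inv _ _ (H (by simpa using GP_npr.inv _ _ hg))
  sh := fun x y H hg => h.sh _ _ (H (by simpa using GP_npr.sh _ _ hg))

lemma GP_ncomm {x y : F} (h : GP x y) (hc : x * y = y * x) : False := by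
  have h1 := closure_comm hc
  rw [h] at h1
  have := h1 ga trivial gb trivial
  revert this; decide

lemma closure_left (Y : Set F) (x y : F) (h1 : (1 : F) ∈ Y) (hx : ∀ h ∈ Y, x * h ∈ Y) (hx' : ∀ h ∈ Y, x⁻¹ * h ∈ Y)
    (hy : ∀ h ∈ Y, y * h ∈ Y) (hy' : ∀ h ∈ Y, y⁻¹ * h ∈ Y) : ∀ h ∈ Subgroup.closure {x, y}, h ∈ Y := by
  have : ∀ u ∈ Subgroup.closure {x, y}, (∀ h ∈ Y, u * h ∈ Y) ∧ (∀ h ∈ Y, u⁻¹ * h ∈ Y) := by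
    intro u hu
    induction hu using Subgroup.closure_induction with
    | mem u hu => rcases hu with rfl | rfl; exacts [⟨hx, hx'⟩, ⟨hy, hy'⟩]
    | one => simp
    | mul u v _ _ h1 h2 =>
      refine ⟨fun h hh => ?_, fun h hh => ?_⟩
      · rw [mul_assoc]; exact h1.1 _ (h2.1 _ hh)
      · rw [mul_inv_rev, mul_assoc]; exact h2.2 _ (h1.2 _ hh)
    | inv u _ h1 => exact ⟨h1.2, by simpa using h1.1⟩
  intro h hh
  simpa using (this h hh).1 1 h1

inductive SS (P : Fin 3 → F) : Fin 3 → F → Prop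
  | base (i j) : i ≠ j → SS P i (P i * (P j)⁻¹)
  | step (i j k h) : i ≠ j → j ≠ k → SS P k h → SS P i (P i * (P j)⁻¹ * h)

lemma hd_ne_aux {g h : F} (H : hd g ≠ hd h) : ∀ s, hd g = some s → hd h ≠ some s :=
  fun _ h1 h2 => H (h1.trans h2.symm)

lemma SS_norm (P : Fin 3 → F) (h1 : ∀ i, P i ≠ 1) (h2 : ∀ i j, i ≠ j → hd (P i) ≠ hd (P j))
    (h3 : ∀ i j, i ≠ j → hd (P i)⁻¹ ≠ hd (P j)⁻¹) (i : Fin 3) (h : F) (H : SS P i h) :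
    hd h = hd (P i) ∧ 2 ≤ h.norm := by
  have key : ∀ i j, i ≠ j → hd (P i * (P j)⁻¹) = hd (P i) ∧ 2 ≤ (P i * (P j)⁻¹).norm := by
    intro i j hij
    have := hd_ne_aux (h3 i j hij)
    refine ⟨mul_hd this (h1 i), ?_⟩
    rw [mul_norm this, FreeGroup.norm_inv_eq]
    have := norm_ge (h1 i); have := norm_ge (h1 j); omega
  induction H with
  | base i j hij => exact key i j hij
  | step i j k h hij hjk _ ih =>
    have e : hd (P j * (P i)⁻¹) = hd (P j) := (key j i hij.symm).1
    have hk : hd (P i * (P j)⁻¹)⁻¹ ≠ hd h := by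
      rw [mul_inv_rev, inv_inv, e, ih.1]; exact h2 _ _ hjk
    have := hd_ne_aux hk
    refine ⟨?_, ?_⟩
    · rw [mul_hd this, (key i j hij).1]
      intro h0
      have := (key i j hij).2
      rw [h0] at this; simp at this
    · rw [mul_norm this]; have := (key i j hij).2; omega

lemma case3a (P : Fin 3 → F) (h1 : ∀ i, P i ≠ 1) (h2 : ∀ i j, i ≠ j → hd (P i) ≠ hd (P j))
    (h3 : ∀ i j, i ≠ j → hd (P i)⁻¹ ≠ hd (P j)⁻¹) : ¬ GP (P 0 * (P 2)⁻¹) (P 1 * (P 2)⁻¹) := by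
  intro hG
  have key : ∀ i j, i ≠ j → ∀ h, (h = 1 ∨ ∃ k, SS P k h) → (P i * (P j)⁻¹ * h = 1 ∨ ∃ k, SS P k (P i * (P j)⁻¹ * h)) := by
    rintro i j hij h (rfl | ⟨k, hk⟩)
    · rw [mul_one]; exact Or.inr ⟨_, SS.base i j hij⟩
    · by_cases hjk : j = k
      · subst hjk
        cases hk with
        | base _ l hl =>
          by_cases hil : i = l
          · subst hil; left; group
          · right; refine ⟨i, ?_⟩
            have := SS.base (P := P) i l hil
            simpa [mul_assoc] using this
        | step _ l k h hl hlk hk =>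
          by_cases hil : i = l
          · subst hil; right; refine ⟨k, ?_⟩; simpa [mul_assoc] using hk
          · right; refine ⟨i, ?_⟩
            have := SS.step (P := P) i l k h hil hlk hk
            simpa [mul_assoc] using this
      · exact Or.inr ⟨_, SS.step i j k h hij hjk hk⟩
  have := closure_left {h | h = 1 ∨ ∃ k, SS P k h} (P 0 * (P 2)⁻¹) (P 1 * (P 2)⁻¹) (Or.inl rfl)
    (fun h hh => key 0 2 (by decide) h hh) (fun h hh => by rw [mul_inv_rev, inv_inv]; exact key 2 0 (by decide) h hh)
    (fun h hh => key 1 2 (by decide) h hh) (fun h hh => by rw [mul_inv_rev, inv_inv]; exact key 2 1 (by decide) h hh)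
  have h4 := this ga (by rw [hG]; trivial)
  rcases h4 with h4 | ⟨k, hk⟩
  · exact absurd h4 (by decide)
  · have := (SS_norm P h1 h2 h3 k _ hk).2
    rw [FreeGroup.norm_of] at this; omega

inductive AA (P : Bool → F) : Bool → F → Prop
  | base (i) (k : ℤ) : k ≠ 0 → AA P i (P i ^ k)
  | step (i) (k : ℤ) (h) : k ≠ 0 → AA P (!i) h → AA P i (P i ^ k * h)

lemma AA_norm (P : Bool → F) (h1 : ∀ i, P i ≠ 1) (ha : hd (P true) ≠ hd (P false)) (hb : hd (P true) ≠ hd (P false)⁻¹)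
    (hc : hd (P true)⁻¹ ≠ hd (P false)) (hd' : hd (P true)⁻¹ ≠ hd (P false)⁻¹)
    (i : Bool) (h : F) (H : AA P i h) :
    (hd h = hd (P i) ∨ hd h = hd (P i)⁻¹) ∧ h ≠ 1 ∧ (h.norm = 1 → h ∈ Subgroup.zpowers (P i)) := by
  induction H with
  | base i k hk =>
    have := hd_zpow (h1 i) hk
    refine ⟨?_, this.1, fun _ => ⟨k, rfl⟩⟩
    tauto
  | step i k h hk _ ih =>
    have := hd_zpow (h1 i) hk
    have hne : hd (P i ^ k)⁻¹ ≠ hd h := by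
      cases i <;> simp only [Bool.not_false, Bool.not_true] at ih <;> rcases this.2 with h | h <;> rcases ih.1 with h' | h' <;>
        rw [h.2, h'] <;> first | assumption | (apply Ne.symm; assumption)
    have hm := hd_ne_aux hne
    have hn := mul_norm hm
    have := norm_ge this.1
    have := norm_ge ih.2.1
    refine ⟨?_, ?_, fun h => by omega⟩
    · rw [mul_hd hm (hd_zpow (h1 i) hk).1]; tauto
    · intro h0; rw [h0] at hn; simp at hn; omega

def Base (x y : F) : Prop := ∃ c s t, x = lt (c, s) ∧ y = lt (!c, t)

/-- exponent sums -/
def ex (c : Bool) : F →* Multiplicative ℤ := FreeGroup.lift fun d => Multiplicative.ofAdd (if d = c then 1 else 0)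
def e (c : Bool) (g : F) : ℤ := (ex c g).toAdd
lemma e_mul (c : Bool) (g h : F) : e c (g * h) = e c g + e c h := by simp [e]
lemma e_inv (c : Bool) (g : F) : e c g⁻¹ = - e c g := by simp [e]
lemma e_one (c : Bool) : e c 1 = 0 := by simp [e]
lemma e_zpow (c : Bool) (g : F) (n : ℤ) : e c (g ^ n) = n * e c g := by simp [e]
lemma e_of (c d : Bool) : e c (FreeGroup.of d) = if d = c then 1 else 0 := by simp [e, ex]

lemma root_gen {x : F} {c : Bool} {k : ℤ} (h : x ^ k = FreeGroup.of c) : ∃ s, x = lt (c, s) := by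
  have := congrArg (e c) h
  rw [e_zpow, e_of, if_pos rfl] at this
  rcases Int.eq_one_or_neg_one_of_mul_eq_one this with rfl | rfl
  · exact ⟨true, by rw [zpow_one] at h; exact h⟩
  · refine ⟨false, ?_⟩
    rw [zpow_neg_one] at h
    have : x = (FreeGroup.of c)⁻¹ := by rw [← h, inv_inv]
    rw [this, of_eq_lt, ← lt_iv]; rfl

lemma case3b {x y : F} (hx : x ≠ 1) (hy : y ≠ 1) (ha : hd x ≠ hd y) (hb : hd x ≠ hd y⁻¹)
    (hc : hd x⁻¹ ≠ hd y) (hd' : hd x⁻¹ ≠ hd y⁻¹) (hG : GP x y) : Base x y := by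
  let P : Bool → F := fun i => if i then x else y
  have h1 : ∀ i, P i ≠ 1 := by intro i; cases i <;> simpa [P]
  have key : ∀ i, ∀ k : ℤ, k ≠ 0 → ∀ h, (h = 1 ∨ ∃ j, AA P j h) → (P i ^ k * h = 1 ∨ ∃ j, AA P j (P i ^ k * h)) := by
    rintro i k hk h (rfl | ⟨j, hj⟩)
    · rw [mul_one]; exact Or.inr ⟨_, AA.base i k hk⟩
    · by_cases hij : j = i
      · subst hij
        cases hj with
        | base _ l hl =>
          rw [← zpow_add]
          by_cases h0 : k + l = 0
          · left; rw [h0, zpow_zero]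
          · right; exact ⟨_, AA.base _ _ h0⟩
        | step _ l h hl hj =>
          rw [← mul_assoc, ← zpow_add]
          by_cases h0 : k + l = 0
          · right; rw [h0, zpow_zero, one_mul]; exact ⟨_, hj⟩
          · right; exact ⟨_, AA.step _ _ _ h0 hj⟩
      · have : j = !i := by cases i <;> cases j <;> simp_all
        subst this
        right; exact ⟨_, AA.step _ _ _ hk hj⟩
  have hall := closure_left {h | h = 1 ∨ ∃ k, AA P k h} x y (Or.inl rfl)
    (fun h hh => by simpa [P] using key true 1 (by decide) h hh)
    (fun h hh => by simpa [P] using key true (-1) (by decide) h hh)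
    (fun h hh => by simpa [P] using key false 1 (by decide) h hh)
    (fun h hh => by simpa [P] using key false (-1) (by decide) h hh)
  have hgen : ∀ c, ∃ i s, P i = lt (c, s) := by
    intro c
    rcases hall (FreeGroup.of c) (by rw [hG]; trivial) with h | ⟨i, hi⟩
    · exact absurd h (FreeGroup.of_ne_one c)
    · have := (AA_norm P h1 (by simpa [P]) (by simpa [P]) (by simpa [P]) (by simpa [P]) i _ hi).2.2 (FreeGroup.norm_of c)
      obtain ⟨k, hk⟩ := this
      exact ⟨i, root_gen hk⟩
  obtain ⟨i, s, hi⟩ := hgen true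
  obtain ⟨j, t, hj⟩ := hgen false
  cases i <;> cases j <;> simp only [P, if_true] at hi hj
  · exact absurd (lt_inj (hi.symm.trans hj)) (by simp)
  · exact ⟨false, t, s, hj, hi⟩
  · exact ⟨true, s, t, hi, hj⟩
  · exact absurd (lt_inj (hi.symm.trans hj)) (by simp)

lemma Base.pr {Pr : F → F → Prop} (h : NPr Pr) (h0 : Pr ga gb) {x y : F} (hB : Base x y) : Pr x y := by
  have hinv : ∀ x y, Pr x y → Pr x⁻¹ y := fun x y H => h.swap _ _ (h.inv _ _ (h.swap _ _ H))
  have e : ∀ c, lt (c, false) = (FreeGroup.of c)⁻¹ := by intro c; rw [of_eq_lt, ← lt_iv]; rfl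
  have e' : ∀ c, lt (c, true) = FreeGroup.of c := fun c => rfl
  have h0' := h.swap _ _ h0
  obtain ⟨c, s, t, rfl, rfl⟩ := hB
  cases c <;> cases s <;> cases t <;> simp only [Bool.not_true, Bool.not_false, e, e'] <;>
    first | assumption | (apply hinv; assumption) | (apply h.inv; assumption) | (apply h.inv; apply hinv; assumption)

section
variable {Pr : F → F → Prop} (h : NPr Pr)

def Tr (Pr : F → F → Prop) (P Q R : F) : Prop := Pr (P * R⁻¹) (Q * R⁻¹)

lemma Tr.s12 (h : NPr Pr) {P Q R : F} (H : Tr Pr P Q R) : Tr Pr Q P R := h.swap _ _ H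
lemma Tr.s23 (h : NPr Pr) {P Q R : F} (H : Tr Pr P Q R) : Tr Pr P R Q := by
  have := h.sh _ _ H
  simpa [Tr] using this
lemma Tr.lmul (h : NPr Pr) {P Q R : F} (g : F) (H : Tr Pr (g * P) (g * Q) (g * R)) : Tr Pr P Q R := by
  have := h.conj g⁻¹ _ _ H
  simpa [Tr, mul_assoc] using this
lemma Tr.rmul {P Q R : F} (g : F) (H : Tr Pr (P * g) (Q * g) (R * g)) : Tr Pr P Q R := by
  simpa [Tr, mul_assoc] using H

def Bad (Pr : F → F → Prop) (n : ℕ) (P Q R : F) : Prop := P.norm + Q.norm + R.norm ≤ n ∧ ¬ Tr Pr P Q R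

lemma Bad.s12 (h : NPr Pr) {n : ℕ} {P Q R : F} (H : Bad Pr n P Q R) : Bad Pr n Q P R :=
  ⟨by have := H.1; omega, fun h' => H.2 (h'.s12 h)⟩
lemma Bad.s23 (h : NPr Pr) {n : ℕ} {P Q R : F} (H : Bad Pr n P Q R) : Bad Pr n P R Q :=
  ⟨by have := H.1; omega, fun h' => H.2 (h'.s23 h)⟩

lemma Bad.ne (h : NPr Pr) {n : ℕ} {P Q R : F} (H : Bad Pr (n + 1) P Q R) (ih : ∀ P Q R, ¬ Bad Pr n P Q R)
    (hP : P ≠ 1) : hd P ≠ hd Q := by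
  intro he
  obtain ⟨s, hs⟩ := exists_hd hP
  have h1 := (hd_cons hs).2
  have h2 := (hd_cons (he.symm.trans hs)).2
  have h3 := norm_hd_le R (iv s)
  rw [lt_iv] at h3
  exact ih ((lt s)⁻¹ * P) ((lt s)⁻¹ * Q) ((lt s)⁻¹ * R) ⟨by have := H.1; omega, fun h' => H.2 (h'.lmul h)⟩

lemma Bad.ne' {n : ℕ} {P Q R : F} (H : Bad Pr (n + 1) P Q R) (ih : ∀ P Q R, ¬ Bad Pr n P Q R)
    (hP : P ≠ 1) : hd P⁻¹ ≠ hd Q⁻¹ := by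
  intro he
  obtain ⟨s, hs⟩ := exists_hd (inv_ne_one.2 hP)
  have h1 := (hd_cons hs).2
  have h2 := (hd_cons (he.symm.trans hs)).2
  have h3 := norm_hd_le R⁻¹ (iv s)
  rw [lt_iv] at h3
  rw [← mul_inv_rev, FreeGroup.norm_inv_eq, FreeGroup.norm_inv_eq] at h1 h2 h3
  exact ih (P * lt s) (Q * lt s) (R * lt s) ⟨by have := H.1; omega, fun h' => H.2 h'.rmul⟩
end

lemma bad_none {Pr : F → F → Prop} (h : NPr Pr) (h0 : Pr ga gb) (n : ℕ) :
    ∀ P Q R, ¬ Bad (fun x y => GP x y → Pr x y) n P Q R := by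
  have h' := h.imp
  set Pr' := (fun x y => GP x y → Pr x y) with hPr'
  induction n with
  | zero =>
    intro P Q R H
    have h1 := H.1
    have hP : P = 1 := FreeGroup.norm_eq_zero.1 (by omega)
    have hQ : Q = 1 := FreeGroup.norm_eq_zero.1 (by omega)
    apply H.2
    intro hG
    rw [hP, hQ] at hG
    exact (GP_ncomm hG rfl).elim
  | succ n ih =>
    have caseR : ∀ P Q, ¬ Bad Pr' (n + 1) P Q 1 := by
      intro P Q H
      by_cases hP : P = 1
      · subst hP; apply H.2; intro hG; exact (GP_ncomm hG (by simp)).elim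
      by_cases hQ : Q = 1
      · subst hQ; apply H.2; intro hG; exact (GP_ncomm hG (by simp)).elim
      have hf : Bad Pr' (n + 1) P Q⁻¹ 1 := by
        refine ⟨by rw [FreeGroup.norm_inv_eq]; exact H.1, fun hT => H.2 ?_⟩
        have := h'.inv _ _ hT
        simpa [Tr] using this
      have h1 := H.ne h' ih hP
      have h2 := H.ne' ih hP
      have h3 := hf.ne h' ih hP
      have h4 := hf.ne' ih hP
      rw [inv_inv] at h4
      apply H.2
      intro hG
      simp only [inv_one, mul_one] at hG ⊢
      exact (case3b hP hQ h1 h3 h4 h2 hG).pr h h0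
    intro P Q R H
    by_cases hR : R = 1
    · subst hR; exact caseR _ _ H
    by_cases hQ : Q = 1
    · subst hQ; exact caseR _ _ (H.s23 h')
    by_cases hP : P = 1
    · subst hP; exact caseR _ _ ((H.s12 h').s23 h')
    have H13 := H.s23 h'
    have H23 := (H.s12 h').s23 h'
    apply H.2
    intro hG
    exfalso
    refine case3a ![P, Q, R] ?_ ?_ ?_ hG
    · intro i; fin_cases i <;> simpa
    · intro i j hij
      have a1 := H.ne h' ih hP
      have a2 := H13.ne h' ih hP
      have a3 := H23.ne h' ih hQ
      fin_cases i <;> fin_cases j <;> first | (exact absurd rfl hij) | assumption | (apply Ne.symm; assumption)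
    · intro i j hij
      have a1 := H.ne' ih hP
      have a2 := H13.ne' ih hP
      have a3 := H23.ne' ih hQ
      fin_cases i <;> fin_cases j <;> first | (exact absurd rfl hij) | assumption | (apply Ne.symm; assumption)

theorem nielsen {Pr : F → F → Prop} (h : NPr Pr) (h0 : Pr ga gb) {x y : F} (hG : GP x y) : Pr x y := by
  by_contra hn
  refine bad_none h h0 _ x y 1 ⟨le_rfl, fun hT => hn ?_⟩
  have := hT (by simpa using hG)
  simpa using this

end Eq9

namespace Eq9

def cm (x y : F) : F := x⁻¹ * y⁻¹ * x * y

def CC (x y : F) : Prop := ∃ g, cm x y = g⁻¹ * cm ga gb * g ∨ cm x y = g⁻¹ * (cm ga gb)⁻¹ * g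

lemma CC_npr : NPr CC where
  conj := by
    rintro g x y ⟨w, h⟩
    refine ⟨w * g⁻¹, ?_⟩
    have e : cm (g * x * g⁻¹) (g * y * g⁻¹) = g * cm x y * g⁻¹ := by simp only [cm]; group
    rw [e]
    rcases h with h | h <;> rw [h]
    · left; group
    · right; group
  swap := by
    rintro x y ⟨w, h⟩
    refine ⟨w, ?_⟩
    have e : cm y x = (cm x y)⁻¹ := by simp only [cm]; group
    rw [e]
    rcases h with h | h <;> rw [h]
    · right; group
    · left; group
  inv := by
    rintro x y ⟨w, h⟩
    refine ⟨w * y⁻¹, ?_⟩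
    have e : cm x y⁻¹ = y * (cm x y)⁻¹ * y⁻¹ := by simp only [cm]; group
    rw [e]
    rcases h with h | h <;> rw [h]
    · right; group
    · left; group
  sh := by
    rintro x y ⟨w, h⟩
    refine ⟨w * y⁻¹ * y⁻¹, ?_⟩
    have e : cm (x * y⁻¹) y⁻¹ = y * y * (cm x y)⁻¹ * y⁻¹ * y⁻¹ := by simp only [cm]; group
    rw [e]
    rcases h with h | h <;> rw [h]
    · right; simp [mul_assoc]
    · left; simp [mul_assoc]

theorem cm_conj {x y : F} (h : GP x y) : CC x y := nielsen CC_npr ⟨1, Or.inl (by simp)⟩ h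

inductive PosC : F → F → Prop
  | base (p q) : Base p q → PosC p q
  | conj (g p q) : PosC p q → PosC (g * p * g⁻¹) (g * q * g⁻¹)
  | mulr (p q) : PosC p q → PosC p (p * q)
  | mull (p q) : PosC p q → PosC (p * q) q

lemma Base.swap {p q : F} (h : Base p q) : Base q p := by
  obtain ⟨c, s, t, rfl, rfl⟩ := h
  exact ⟨!c, t, s, rfl, by simp⟩

lemma Base.inv {p q : F} (h : Base p q) : Base p q⁻¹ := by
  obtain ⟨c, s, t, rfl, rfl⟩ := h
  exact ⟨c, s, !t, rfl, by rw [← lt_iv]; rfl⟩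

lemma PosC.cj {p q p' q' : F} (g : F) (h : PosC p q) (hp : p' = g * p * g⁻¹) (hq : q' = g * q * g⁻¹) : PosC p' q' := by
  subst hp hq; exact PosC.conj _ _ _ h

lemma PosC.swap {p q : F} (h : PosC p q) : PosC q p := by
  induction h with
  | base p q h => exact PosC.base _ _ h.swap
  | conj g p q _ ih => exact PosC.conj _ _ _ ih
  | mulr p q _ ih => exact (PosC.mull _ _ ih).cj p (by group) (by group)
  | mull p q _ ih => exact (PosC.mulr _ _ ih).cj q⁻¹ (by group) (by group)

def NN (x y : F) : Prop := PosC x y ∨ PosC x⁻¹ y ∨ PosC x y⁻¹ ∨ PosC x⁻¹ y⁻¹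

lemma NN.inv {x y : F} (h : NN x y) : NN x y⁻¹ := by
  unfold NN at *; rw [inv_inv]; tauto
lemma NN.inv' {x y : F} (h : NN x y) : NN x⁻¹ y := by
  unfold NN at *; rw [inv_inv]; tauto
lemma NN.swap {x y : F} (h : NN x y) : NN y x := by
  rcases h with h | h | h | h <;> have := h.swap <;> unfold NN <;> tauto
lemma NN.cj {x y x' y' : F} (g : F) (h : NN x y) (hp : x' = g * x * g⁻¹) (hq : y' = g * y * g⁻¹) : NN x' y' := by
  subst hp hq
  unfold NN
  rw [conj_inv, conj_inv]
  rcases h with h | h | h | h <;> have := PosC.conj g _ _ h <;> tauto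

lemma PosC.key {p q : F} (h : PosC p q) : NN (p * q⁻¹) q := by
  induction h with
  | base p q h => 
    have h1 : NN (p * q⁻¹) q⁻¹ := Or.inl (PosC.mull _ _ (PosC.base _ _ h.inv))
    simpa using h1.inv
  | conj g p q _ ih => exact ih.cj g (by group) (by group)
  | mulr p q h _ =>
    have h1 : NN q (q * p) := Or.inl (PosC.mulr _ _ h.swap)
    exact h1.inv'.cj p (by group) (by group)
  | mull p q h _ => left; simpa using h

lemma NN_npr : NPr NN where
  conj := fun g x y h => h.cj g rfl rfl
  swap := fun x y h => h.swap
  inv := fun x y h => h.inv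
  sh := by
    intro x y h
    apply NN.inv
    rcases h with h | h | h | h
    · exact h.key
    · have h1 : NN (x⁻¹ * y) y := Or.inl (PosC.mull _ _ h)
      exact h1.inv'.cj y (by group) (by group) 
    · have h1 : NN (x * y⁻¹) y⁻¹ := Or.inl (PosC.mull _ _ h)
      simpa using h1.inv
    · have h1 := h.key.inv'.inv
      exact h1.cj y (by group) (by group)

def CB (p q : F) : Prop := ∃ g, Base (g * p * g⁻¹) (g * q * g⁻¹)

lemma e_conj (c : Bool) (g x : F) : e c (g * x * g⁻¹) = e c x := by rw [e_mul, e_mul, e_inv]; ring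
lemma e_lt (c d s : Bool) : e c (lt (d, s)) = if d = c then (if s then 1 else -1) else 0 := by
  cases s
  · have : lt (d, false) = (FreeGroup.of d)⁻¹ := by rw [of_eq_lt, ← lt_iv]; rfl
    rw [this, e_inv, e_of]; split_ifs <;> simp_all
  · have : lt (d, true) = FreeGroup.of d := rfl
    rw [this, e_of]; split_ifs <;> simp_all

lemma abs_add_same {u v : ℤ} (h : 0 ≤ u * v) : |u + v| = |u| + |v| := by
  rcases le_total 0 u with hu | hu <;> rcases le_total 0 v with hv | hv <;>
    rcases eq_or_lt_of_le hu with h1 | h1 <;> rcases eq_or_lt_of_le hv with h2 | h2 <;>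
    first
      | (subst h1; simp; done)
      | (subst h2; simp; done)
      | (rw [abs_of_nonneg hu, abs_of_nonneg hv, abs_of_nonneg (by linarith)]; done)
      | (rw [abs_of_nonpos hu, abs_of_nonpos hv, abs_of_nonpos (by linarith)]; ring; done)
      | (exfalso; nlinarith)

lemma PosC.ab {p q : F} (h : PosC p q) : 0 ≤ e true p * e true q ∧ 0 ≤ e false p * e false q ∧
    1 ≤ |e true p| + |e false p| ∧ 1 ≤ |e true q| + |e false q| ∧
    (CB p q ∨ 3 ≤ |e true p| + |e false p| + |e true q| + |e false q|) := by
  induction h with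
  | base p q h =>
    have : CB p q := ⟨1, by simpa using h⟩
    obtain ⟨c, s, t, rfl, rfl⟩ := h
    refine ⟨?_, ?_, ?_, ?_, Or.inl this⟩ <;> simp only [e_lt] <;> cases c <;> cases s <;> cases t <;> simp
  | conj g p q _ ih =>
    simp only [e_conj]
    refine ⟨ih.1, ih.2.1, ih.2.2.1, ih.2.2.2.1, ?_⟩
    rcases ih.2.2.2.2 with ⟨w, h⟩ | h
    · left; refine ⟨w * g⁻¹, ?_⟩
      simpa [mul_assoc] using h
    · exact Or.inr h
  | mulr p q _ ih =>
    obtain ⟨h1, h2, h3, h4, -⟩ := ih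
    simp only [e_mul]
    rw [abs_add_same h1, abs_add_same h2]
    have := abs_nonneg (e true p); have := abs_nonneg (e false p)
    refine ⟨?_, ?_, by omega, by omega, Or.inr (by omega)⟩
    · nlinarith [mul_self_nonneg (e true p)]
    · nlinarith [mul_self_nonneg (e false p)]
  | mull p q _ ih =>
    obtain ⟨h1, h2, h3, h4, -⟩ := ih
    simp only [e_mul]
    rw [abs_add_same h1, abs_add_same h2]
    have := abs_nonneg (e true q); have := abs_nonneg (e false q)
    refine ⟨?_, ?_, by omega, by omega, Or.inr (by omega)⟩
    · nlinarith [mul_self_nonneg (e true q)]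
    · nlinarith [mul_self_nonneg (e false q)]

lemma lt_of_e {c s : Bool} (d : Bool) (h : e d (lt (c, s)) = 1) : lt (c, s) = FreeGroup.of d := by
  rw [e_lt] at h
  cases c <;> cases d <;> cases s <;> simp at h <;> rfl

lemma lt_of_e' {c s : Bool} (d : Bool) (h : e d (lt (c, s)) = -1) : lt (c, s) = (FreeGroup.of d)⁻¹ := by
  rw [e_lt] at h
  cases c <;> cases d <;> cases s <;> simp at h <;> rfl

theorem ia_inn {x y : F} (hG : GP x y) (h1 : e true x = 1) (h2 : e false x = 0) (h3 : e true y = 0) (h4 : e false y = 1) :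
    ∃ g, x = g * ga * g⁻¹ ∧ y = g * gb * g⁻¹ := by
  have hN : NN x y := nielsen NN_npr (Or.inl (PosC.base _ _ ⟨true, true, true, rfl, rfl⟩)) hG
  have fin : ∀ x' y', PosC x' y' → (x' = x ∨ x' = x⁻¹) → (y' = y ∨ y' = y⁻¹) → ∃ g, x = g * ga * g⁻¹ ∧ y = g * gb * g⁻¹ := by
    intro x' y' hP hx hy
    have hcb : CB x' y' := by
      rcases hP.ab.2.2.2.2 with h | h
      · exact h
      · rcases hx with rfl | rfl <;> rcases hy with rfl | rfl <;> simp [e_inv, h1, h2, h3, h4] at h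
    obtain ⟨g, c, s, t, hx', hy'⟩ := hcb
    refine ⟨g⁻¹, ?_, ?_⟩
    · rcases hx with rfl | rfl
      · have := lt_of_e true (c := c) (s := s) (by rw [← hx', e_conj, h1])
        rw [← hx'] at this
        rw [ga, ← this]; group
      · have := lt_of_e' true (c := c) (s := s) (by rw [← hx', e_conj, e_inv, h1])
        rw [← hx'] at this
        rw [ga, ← inv_inj, ← mul_left_inj g, mul_inv_rev, mul_inv_rev, ← this]; group
    · rcases hy with rfl | rfl
      · have := lt_of_e false (c := !c) (s := t) (by rw [← hy', e_conj, h4])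
        rw [← hy'] at this
        rw [gb, ← this]; group
      · have := lt_of_e' false (c := !c) (s := t) (by rw [← hy', e_conj, e_inv, h4])
        rw [← hy'] at this
        rw [gb, ← inv_inj, ← mul_left_inj g, mul_inv_rev, mul_inv_rev, ← this]; group
  rcases hN with h | h | h | h
  · exact fin _ _ h (Or.inl rfl) (Or.inl rfl)
  · exact fin _ _ h (Or.inr rfl) (Or.inl rfl)
  · exact fin _ _ h (Or.inl rfl) (Or.inr rfl)
  · exact fin _ _ h (Or.inr rfl) (Or.inr rfl)

end Eq9

namespace Eq9

def tw (α : F →* F) (y s : F) : F := s⁻¹ * y * α s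

lemma tw_mul (α : F →* F) (y s t : F) : tw α (tw α y s) t = tw α y (s * t) := by
  simp [tw, mul_assoc]
lemma tw_one (α : F →* F) (y : F) : tw α y 1 = y := by simp [tw]

def fl (α : F →* F) (φ : F → F) (y : F) : F := tw α y (φ y)

def ph (α : F →* F) (φ : F → F) : ℕ → F → F
  | 0, _ => 1
  | n + 1, y => φ y * ph α φ n (fl α φ y)

lemma right_induction {Q : F → Prop} (h1 : Q 1) (hm : ∀ w c, Q w → Q (w * FreeGroup.of c))
    (hm' : ∀ w c, Q w → Q (w * (FreeGroup.of c)⁻¹)) (w : F) : Q w := by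
  have : ∀ v w : F, (Q w → Q (w * v)) := by
    intro v
    induction v using FreeGroup.induction_on with
    | C1 => intro w h; simpa using h
    | of x => intro w h; exact hm w x h
    | inv_of x _ => intro w h; exact hm' w x h
    | mul x y hx hy => intro w h; rw [← mul_assoc]; exact hy _ (hx _ h)
  simpa using this w 1 h1

theorem flow (α : F →* F) (φ : F → F) (x : F)
    (hE : ∀ w c, φ (tw α x w) = FreeGroup.of c ∨ φ (tw α x (w * FreeGroup.of c)) = (FreeGroup.of c)⁻¹)
    (u v : F) (hu : tw α x u = x) (hv : tw α x v = x) : u * v = v * u := by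
  have key : ∀ w, ∃ p q : ℕ, ∀ n, w * ph α φ (q + n) (tw α x w) = ph α φ (p + n) x := by
    intro w
    induction w using right_induction with
    | h1 => exact ⟨0, 0, fun n => by simp [tw_one]⟩
    | hm w c ih =>
      obtain ⟨p, q, ih⟩ := ih
      rcases hE w c with h | h
      · refine ⟨p + 1, q, fun n => ?_⟩
        have := ih (n + 1)
        rw [← add_assoc, ph, fl, h, tw_mul] at this
        rw [mul_assoc, this]; congr 1; omega
      · refine ⟨p, q + 1, fun n => ?_⟩
        have e : q + 1 + n = (q + n) + 1 := by omega
        rw [e, ph, fl, h, tw_mul, ← ih n]; simp [mul_assoc]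
    | hm' w c ih =>
      obtain ⟨p, q, ih⟩ := ih
      have hE' := hE (w * (FreeGroup.of c)⁻¹) c
      rw [inv_mul_cancel_right] at hE'
      rcases hE' with h | h
      · refine ⟨p, q + 1, fun n => ?_⟩
        have e : q + 1 + n = (q + n) + 1 := by omega
        rw [e, ph, fl, h, tw_mul, ← ih n]; simp [mul_assoc]
      · refine ⟨p + 1, q, fun n => ?_⟩
        have := ih (n + 1)
        rw [← add_assoc, ph, fl, h, tw_mul] at this
        rw [mul_assoc, this]; congr 1; omega
  obtain ⟨p, q, h1⟩ := key u
  obtain ⟨p', q', h2⟩ := key v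
  rw [hu] at h1; rw [hv] at h2
  have e1 : u * v * ph α φ (q + q') x = ph α φ (p + p') x := by
    rw [mul_assoc, add_comm q q', h2 q, add_comm p' q, h1]
  have e2 : v * u * ph α φ (q + q') x = ph α φ (p + p') x := by
    rw [mul_assoc, h1 q', add_comm p q', h2, add_comm]
  exact mul_right_cancel (e1.trans e2.symm)

def phi (d : F) (y : F) : F := (hd y).elim d lt

lemma phi_some {d y : F} {s : Lt} (h : hd y = some s) : phi d y = lt s := by simp [phi, h]
lemma phi_one (d : F) : phi d 1 = d := by simp [phi, hd_one]

/-- the letter `s` does not occur in `g` -/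
def NoL (s : Lt) (g : F) : Prop := ∀ y, hd y = some (iv s) → hd (y * g) = some (iv s)

lemma NoL.mul {s : Lt} {g h : F} (hg : NoL s g) (hh : NoL s h) : NoL s (g * h) := by
  intro y hy; rw [← mul_assoc]; exact hh _ (hg _ hy)
lemma NoL.one {s : Lt} : NoL s 1 := by intro y hy; simpa using hy
lemma NoL.lt {s t : Lt} (h : t ≠ s) : NoL s (lt t) := by
  intro y hy
  apply hd_mul_lt' hy
  intro h'; apply h; rw [← iv_iv t, h', iv_iv]
lemma NoL.pow {s : Lt} {g : F} (h : NoL s g) (n : ℕ) : NoL s (g ^ n) := by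
  induction n with
  | zero => simpa using NoL.one
  | succ n ih => rw [pow_succ]; exact ih.mul h
lemma NoL.zpow {s : Lt} {c : Bool} (h : c ≠ s.1) (n : ℤ) : NoL s (FreeGroup.of c ^ n) := by
  obtain ⟨m, rfl | rfl⟩ := n.eq_nat_or_neg
  · rw [zpow_natCast, of_eq_lt]; apply NoL.pow; apply NoL.lt; rintro rfl; simp at h
  · rw [zpow_neg, zpow_natCast, ← inv_pow, of_eq_lt, ← lt_iv]; apply NoL.pow; apply NoL.lt
    rintro rfl; simp [iv] at h

lemma edge (d : F) (α : F →* F) (c : Bool) (h : NoL (c, true) (α (FreeGroup.of c))) (y : F) :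
    phi d y = FreeGroup.of c ∨ phi d (tw α y (FreeGroup.of c)) = (FreeGroup.of c)⁻¹ := by
  by_cases hy : hd y = some (c, true)
  · left; rw [phi_some hy]; rfl
  · right
    have h1 : hd (lt (iv (c, true)) * y) = some (iv (c, true)) := (lt_mul (by rwa [iv_iv])).1
    have h2 := h _ h1
    rw [lt_iv, ← of_eq_lt] at h2
    rw [tw, phi_some h2, lt_iv, ← of_eq_lt]

/-- Edges of the form `s ↦ s * g`, `g` without letter `s`: only the vertex `1` is bad. -/
lemma edge' (d : F) (α : F →* F) (c : Bool) (g : F) (hg : NoL (c, true) g) (h : α (FreeGroup.of c) = FreeGroup.of c * g)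
    (y : F) (hy1 : y ≠ 1) :
    phi d y = FreeGroup.of c ∨ phi d (tw α y (FreeGroup.of c)) = (FreeGroup.of c)⁻¹ := by
  by_cases hy : hd y = some (c, true)
  · left; rw [phi_some hy]; rfl
  · right
    have h1 : hd (lt (iv (c, true)) * y) = some (iv (c, true)) := (lt_mul (by rwa [iv_iv])).1
    have h2 : hd (lt (iv (c, true)) * y * lt (c, true)) = some (iv (c, true)) := by
      apply hd_mul_lt h1
      intro h3; apply hy1
      rw [lt_iv] at h3
      have : y = lt (c, true) * ((lt (c, true))⁻¹ * y * lt (c, true)) * (lt (c, true))⁻¹ := by group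
      rw [this, h3]; group
    have h2 := hg _ h2
    rw [lt_iv, ← of_eq_lt, mul_assoc, ← h] at h2
    rw [tw, phi_some h2, lt_iv, ← of_eq_lt]

/-- flow theorem for automorphisms where each generator's image avoids it -/
theorem flow1 (α : F →* F) (h : ∀ c, NoL (c, true) (α (FreeGroup.of c))) (x u v : F) (hu : tw α x u = x)
    (hv : tw α x v = x) : u * v = v * u := by
  refine flow α (phi 1) x (fun w c => ?_) u v hu hv
  rw [← tw_mul]; exact edge 1 α c (h c) _

/-- reflections -/
theorem flow2 (α : F →* F) (ha : α ga = ga) (h : NoL (false, true) (α gb)) (x u v : F) (hu : tw α x u = x)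
    (hv : tw α x v = x) : u * v = v * u := by
  refine flow α (phi ga) x (fun w c => ?_) u v hu hv
  rw [← tw_mul]
  cases c
  · exact edge ga α false h _
  · by_cases hy : tw α x w = 1
    · left; rw [hy, phi_one]
    · exact edge' ga α true 1 NoL.one (by rw [mul_one]; exact ha) _ hy

/-- shears, orbit avoiding 1 -/
theorem flow3 (α : F →* F) (n : ℤ) (ha : α ga = ga) (hb : α gb = gb * ga ^ n) (x u v : F) (hx : ∀ w, tw α x w ≠ 1)
    (hu : tw α x u = x) (hv : tw α x v = x) : u * v = v * u := by
  refine flow α (phi ga) x (fun w c => ?_) u v hu hv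
  rw [← tw_mul]
  cases c
  · exact edge' ga α false (ga ^ n) (NoL.zpow (by simp) n) hb _ (hx w)
  · exact edge' ga α true 1 NoL.one (by rw [mul_one]; exact ha) _ (hx w)

lemma fl_iter (α : F →* F) (φ : F → F) (n : ℕ) : ∀ y, tw α y (ph α φ n y) = (fl α φ)^[n] y := by
  induction n with
  | zero => intro y; simp [ph, tw_one]
  | succ n ih => intro y; rw [ph, ← tw_mul, Function.iterate_succ_apply, ← ih]; rfl

lemma hd_gapow {n : ℤ} (hn : n ≠ 0) : ga ^ n ≠ 1 ∧ (hd (ga ^ n) = some (true, true) ∨ hd (ga ^ n) = some (true, false)) := by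
  have := hd_zpow (P := ga) (by decide) hn
  refine ⟨this.1, ?_⟩
  have h1 : hd ga = some (true, true) := hd_lt _
  have h2 : hd ga⁻¹ = some (true, false) := by rw [ga, of_eq_lt, hd_inv_lt]; rfl
  rw [h1, h2] at this
  tauto

/-- shears, orbit of 1 -/
theorem flow4 (α : F →* F) (n : ℤ) (hn : n ≠ 0) (ha : α ga = ga) (hb : α gb = gb * ga ^ n) (u : F)
    (hu : α u = u) : u ∈ Subgroup.closure {ga, gb * ga * gb⁻¹} := by
  set L := Subgroup.closure {ga, gb * ga * gb⁻¹} with hL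
  have hLa : ga ∈ L := mem1 _ _
  have hLb : gb * ga * gb⁻¹ ∈ L := mem2 _ _
  set φ := phi ga
  have f1 : fl α φ 1 = 1 := by simp [fl, φ, phi_one, tw, ha]
  obtain ⟨hn1, hn2⟩ := hd_gapow hn
  have p2 : φ (ga ^ n) = ga ∨ φ (ga ^ n) = ga⁻¹ := by
    rcases hn2 with h | h
    · left; exact phi_some h
    · right; show phi ga (ga ^ n) = _
      rw [phi_some h]; rfl
  have f2 : fl α φ (ga ^ n) = ga ^ n := by
    rw [fl]; rcases p2 with h | h <;> rw [h, tw] <;> simp only [map_inv, ha] <;> group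
  have f1' : ∀ q, (fl α φ)^[q] 1 = 1 := fun q => Function.iterate_fixed f1 q
  have f2' : ∀ q, (fl α φ)^[q] (ga ^ n) = ga ^ n := fun q => Function.iterate_fixed f2 q
  have ph_succ : ∀ q y, ph α φ (q + 1) y = ph α φ q y * φ ((fl α φ)^[q] y) := by
    intro q
    induction q with
    | zero => intro y; simp [ph]
    | succ q ih => intro y; rw [ph, ih, ph, mul_assoc, Function.iterate_succ_apply]
  let G : ℕ → F → F → Prop := fun q w y => ((fl α φ)^[q] y = 1 ∧ w * ph α φ q y ∈ L) ∨
    ((fl α φ)^[q] y = ga ^ n ∧ w * ph α φ q y * gb⁻¹ ∈ L)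
  have Gs : ∀ q w y, G q w y → G (q + 1) w y := by
    intro q w y hG
    rcases hG with ⟨h1, h2⟩ | ⟨h1, h2⟩
    · left; rw [Function.iterate_succ_apply', h1, f1]; refine ⟨rfl, ?_⟩
      rw [ph_succ, h1, ← mul_assoc]; exact mul_mem h2 (by simpa [φ, phi_one] using hLa)
    · right; rw [Function.iterate_succ_apply', h1, f2]; refine ⟨rfl, ?_⟩
      rw [ph_succ, h1]
      rcases p2 with h | h <;> rw [h]
      · have := mul_mem h2 hLb; simpa [mul_assoc] using this
      · have := mul_mem h2 (inv_mem hLb); simpa [mul_assoc] using this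
  have Gf : ∀ q w y, G (q + 1) w y ↔ G q (w * φ y) (fl α φ y) := by
    intro q w y; simp only [G, ph, Function.iterate_succ_apply, mul_assoc]
  have ph1 : ∀ q, ph α φ q 1 ∈ L := by
    intro q
    induction q with
    | zero => exact one_mem _
    | succ q ih => rw [ph, f1]; exact mul_mem (by simpa [φ, phi_one] using hLa) ih
  have ph2 : ∀ q, gb * ph α φ q (ga ^ n) * gb⁻¹ ∈ L := by
    intro q
    induction q with
    | zero => simp [ph]
    | succ q ih =>
      rw [ph, f2]
      rcases p2 with h | h <;> rw [h]
      · have := mul_mem hLb ih; simpa [mul_assoc] using this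
      · have := mul_mem (inv_mem hLb) ih; simpa [mul_assoc] using this
  have t1 : tw α 1 gb = ga ^ n := by simp [tw, hb]
  have reg : ∀ y c, ¬ (y = 1 ∧ c = false) → φ y = FreeGroup.of c ∨ φ (tw α y (FreeGroup.of c)) = (FreeGroup.of c)⁻¹ := by
    intro y c hc
    cases c
    · exact edge' ga α false (ga ^ n) (NoL.zpow (by simp) n) hb _ (fun h => hc ⟨h, rfl⟩)
    · by_cases hy : y = 1
      · left; rw [hy]; exact phi_one _
      · exact edge' ga α true 1 NoL.one (by rw [mul_one]; exact ha) _ hy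
  -- equivalence along an edge
  have Ge : ∀ w y c, (∃ q, G q w y) ↔ ∃ q, G q (w * FreeGroup.of c) (tw α y (FreeGroup.of c)) := by
    intro w y c
    by_cases hc : y = 1 ∧ c = false
    · obtain ⟨rfl, rfl⟩ := hc
      rw [t1]
      constructor
      · rintro ⟨q, ⟨-, h⟩ | ⟨h, -⟩⟩
        · refine ⟨0, Or.inr ⟨rfl, ?_⟩⟩
          have := mul_mem h (inv_mem (ph1 q))
          simpa [ph] using this
        · rw [f1'] at h; exact absurd h.symm hn1
      · rintro ⟨q, ⟨h, -⟩ | ⟨-, h⟩⟩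
        · rw [f2'] at h; exact absurd h hn1
        · refine ⟨0, Or.inl ⟨rfl, ?_⟩⟩
          have := mul_mem h (inv_mem (ph2 q))
          simpa [ph, mul_assoc] using this
    · rcases reg y c hc with h | h
      · have hf : fl α φ y = tw α y (FreeGroup.of c) := by rw [fl, h]
        constructor
        · rintro ⟨q, hq⟩
          refine ⟨q, ?_⟩
          have := (Gf q w y).1 (Gs _ _ _ hq)
          rwa [h, hf] at this
        · rintro ⟨q, hq⟩
          refine ⟨q + 1, ?_⟩
          rw [Gf, h, hf]; exact hq
      · have hf : fl α φ (tw α y (FreeGroup.of c)) = y := by rw [fl, h, tw_mul, mul_inv_cancel, tw_one]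
        constructor
        · rintro ⟨q, hq⟩
          refine ⟨q + 1, ?_⟩
          rw [Gf, h, hf]; simpa using hq
        · rintro ⟨q, hq⟩
          refine ⟨q, ?_⟩
          have := (Gf q _ _).1 (Gs _ _ _ hq)
          rw [h, hf] at this; simpa using this
  have all : ∀ w, ∃ q, G q w (tw α 1 w) := by
    intro w
    induction w using right_induction with
    | h1 => exact ⟨0, Or.inl ⟨by simp [tw_one], by simp [ph]⟩⟩
    | hm w c ih => rw [← tw_mul]; exact (Ge w _ c).1 ih
    | hm' w c ih =>
      rw [Ge _ _ c, tw_mul, inv_mul_cancel_right]; exact ih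
  obtain ⟨q, hq⟩ := all u
  have : tw α 1 u = 1 := by simp [tw, hu]
  rw [this] at hq
  rcases hq with ⟨-, h⟩ | ⟨h, -⟩
  · have := mul_mem h (inv_mem (ph1 q)); simpa using this
  · rw [f1'] at h; exact absurd h.symm hn1

end Eq9

namespace Eq9

abbrev V2 := ℤ × ℤ
abbrev Fr := FreeGroup V2

def vc (g : F) : V2 := (e true g, e false g)
lemma vc_mul (g h : F) : vc (g * h) = vc g + vc h := by simp [vc, e_mul]
lemma vc_inv (g : F) : vc g⁻¹ = - vc g := by simp [vc, e_inv]
lemma vc_one : vc 1 = 0 := by simp [vc, e_one]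
lemma vc_a : vc ga = (1, 0) := by simp [vc, e_of]
lemma vc_b : vc gb = (0, 1) := by simp [vc, e_of]

def hh (v : V2) : Fr := match v.2 with
  | Int.ofNat n => ((List.range n).map fun k : ℕ => FreeGroup.of (v.1, (k : ℤ))).prod
  | Int.negSucc n => ((List.range (n + 1)).map fun k : ℕ => (FreeGroup.of (v.1, (-(k + 1 : ℤ))))⁻¹).prod

lemma hh_nat (i : ℤ) (n : ℕ) : hh (i, (n : ℤ)) = ((List.range n).map fun k : ℕ => FreeGroup.of (i, (k : ℤ))).prod := rfl
lemma hh_neg (i : ℤ) (n : ℕ) : hh (i, Int.negSucc n) = ((List.range (n + 1)).map fun k : ℕ => (FreeGroup.of (i, (-(k + 1 : ℤ))))⁻¹).prod := rfl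

lemma hh_zero (i : ℤ) : hh (i, 0) = 1 := by
  have := hh_nat i 0
  simpa using this

lemma hh_succ (i j : ℤ) : hh (i, j + 1) = hh (i, j) * FreeGroup.of (i, j) := by
  cases j with
  | ofNat n =>
    have h1 := hh_nat i (n + 1)
    have h2 := hh_nat i n
    simp only [Int.ofNat_eq_natCast]
    push_cast at h1
    rw [h1, h2, List.range_succ, List.map_append, List.prod_append]; simp
  | negSucc n =>
    cases n with
    | zero =>
      have : (Int.negSucc 0 + 1 : ℤ) = 0 := rfl
      rw [this, hh_zero, hh_neg]
      simp
    | succ n =>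
      have : (Int.negSucc (n + 1) + 1 : ℤ) = Int.negSucc n := rfl
      rw [this, hh_neg, hh_neg, List.range_succ (n := n + 1), List.map_append, List.prod_append]
      have e : Int.negSucc (n + 1) = -(((n + 1 : ℕ) : ℤ) + 1) := by omega
      rw [e]
      simp

def sig : Bool → Equiv.Perm (V2 × Fr)
  | true => ⟨fun p => (p.1 + (1, 0), hh p.1 * p.2), fun p => (p.1 - (1, 0), (hh (p.1 - (1, 0)))⁻¹ * p.2),
      fun p => by simp, fun p => by simp⟩
  | false => ⟨fun p => (p.1 + (0, 1), p.2), fun p => (p.1 - (0, 1), p.2), fun p => by simp, fun p => by simp⟩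

def Phi : F →* Equiv.Perm (V2 × Fr) := FreeGroup.lift sig

def lam (v : V2) (w : F) : Fr := (Phi w (v, 1)).2

lemma Phi_eq (w : F) : ∀ v x, Phi w (v, x) = (v + vc w, lam v w * x) := by
  have hg : ∀ c v x, sig c (v, x) = (v + vc (FreeGroup.of c), (sig c (v, 1)).2 * x) := by
    intro c v x
    cases c
    · simp [vc_b, sig]
    · simp [vc_a, sig]
  have hL : ∀ c, Phi (FreeGroup.of c) = sig c := fun c => by simp [Phi]
  have main : ∀ w : F, (∀ v x, Phi w (v, x) = (v + vc w, (Phi w (v, 1)).2 * x)) := by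
    intro w
    induction w using right_induction with
    | h1 => intro v x; simp [vc_one]
    | hm w c ih =>
      intro v x
      rw [map_mul, Equiv.Perm.mul_apply, Equiv.Perm.mul_apply, hL, hg c v x, hg c v 1, ih, ih _ (_ * 1), vc_mul]
      simp only [mul_assoc, Prod.mk.injEq, and_true, mul_one]
      abel
    | hm' w c ih =>
      intro v x
      have hinv : ∀ x, (sig c)⁻¹ (v, x) = (v - vc (FreeGroup.of c), ((sig c (v - vc (FreeGroup.of c), 1)).2)⁻¹ * x) := by
        intro x
        rw [Equiv.Perm.inv_eq_iff_eq, hg]; simp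
      rw [map_mul, map_inv, Equiv.Perm.mul_apply, Equiv.Perm.mul_apply, hL, hinv, hinv, ih, ih _ (_ * 1), vc_mul, vc_inv]
      simp only [mul_assoc, Prod.mk.injEq, and_true, mul_one]
      abel
  exact main w

lemma lam_mul (v : V2) (w w' : F) : lam v (w * w') = lam (v + vc w') w * lam v w' := by
  rw [lam, map_mul, Equiv.Perm.mul_apply, Phi_eq w' v, Phi_eq w]; simp
lemma lam_one (v : V2) : lam v 1 = 1 := by simp [lam]
lemma lam_a (v : V2) : lam v ga = hh v := by simp [lam, Phi, sig]
lemma lam_b (v : V2) : lam v gb = 1 := by simp [lam, Phi, sig]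
lemma lam_inv (v : V2) (w : F) : lam (v + vc w) w⁻¹ = (lam v w)⁻¹ := by
  rw [eq_inv_iff_mul_eq_one, ← lam_mul, inv_mul_cancel, lam_one]

lemma lam_ainv (v : V2) : lam v ga⁻¹ = (hh (v - (1, 0)))⁻¹ := by
  have := lam_inv (v - (1, 0)) ga
  rwa [vc_a, sub_add_cancel, lam_a] at this
lemma lam_binv (v : V2) : lam v gb⁻¹ = 1 := by
  have := lam_inv (v - (0, 1)) gb
  rwa [vc_b, sub_add_cancel, lam_b, inv_one] at this

lemma lam_c (v : V2) : lam v (cm ga gb) = FreeGroup.of v := by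
  obtain ⟨i, j⟩ := v
  rw [cm, lam_mul, lam_mul, lam_mul, lam_a, lam_b, lam_binv, lam_ainv, vc_a, vc_b, vc_inv, vc_b]
  have e1 : ((i, j) + (0, 1) : V2) = (i, j + 1) := by simp
  have e2 : ((i, j) + (0, 1) + (1, 0) + -(0, 1) - (1, 0) : V2) = (i, j) := by simp
  rw [e2, e1, hh_succ]; simp

lemma vc_c : vc (cm ga gb) = 0 := by simp [cm, vc_mul, vc_inv, vc_a, vc_b]

lemma lam_conj (v : V2) (g : F) : lam v (g⁻¹ * cm ga gb * g) = (lam v g)⁻¹ * FreeGroup.of (v + vc g) * lam v g := by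
  rw [lam_mul, lam_mul, lam_c, vc_c, add_zero, lam_inv]

def pv (v : V2) : F := gb ^ v.2 * ga ^ v.1
lemma vc_pv (v : V2) : vc (pv v) = v := by
  simp [vc, pv, e_mul, e_zpow, e_of]

def Psi : Fr →* F := FreeGroup.lift fun v => (pv v)⁻¹ * cm ga gb * pv v

lemma Psi_hh (i j : ℤ) : Psi (hh (i, j)) = (pv (i + 1, j))⁻¹ * ga * pv (i, j) := by
  have hs : ∀ j, Psi (hh (i, j + 1)) = Psi (hh (i, j)) * ((pv (i, j))⁻¹ * cm ga gb * pv (i, j)) := by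
    intro j; rw [hh_succ, map_mul]; simp [Psi]
  have hs' : ∀ j, (pv (i + 1, j + 1))⁻¹ * ga * pv (i, j + 1) = (pv (i + 1, j))⁻¹ * ga * pv (i, j) * ((pv (i, j))⁻¹ * cm ga gb * pv (i, j)) := by
    intro j; simp only [pv, cm]; group
  induction j using Int.induction_on with
  | zero => rw [hh_zero, map_one]; simp only [pv]; group
  | succ j ih => rw [hs, hs', ih]
  | pred j ih =>
    have h1 := hs (-j - 1); have h2 := hs' (-j - 1)
    rw [sub_add_cancel] at h1 h2
    rw [ih, h2] at h1
    exact (mul_right_cancel h1).symm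

lemma Psi_lam (w : F) : ∀ v, Psi (lam v w) = (pv (v + vc w))⁻¹ * w * pv v := by
  have hg : ∀ c v, Psi (lam v (FreeGroup.of c)) = (pv (v + vc (FreeGroup.of c)))⁻¹ * FreeGroup.of c * pv v := by
    rintro c ⟨i, j⟩
    cases c
    · rw [show lam (i, j) (FreeGroup.of false) = 1 from lam_b _, show vc (FreeGroup.of false) = (0, 1) from vc_b]
      simp only [pv, Prod.mk_add_mk, map_one]; group
    · rw [show lam (i, j) (FreeGroup.of true) = hh _ from lam_a _, show vc (FreeGroup.of true) = (1, 0) from vc_a, Psi_hh]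
      simp
  induction w using right_induction with
  | h1 => intro v; simp [lam_one, vc_one]
  | hm w c ih =>
    intro v
    rw [lam_mul, map_mul, hg, ih, vc_mul, add_comm (vc w), ← add_assoc]; group
  | hm' w c ih =>
    intro v
    have h1 := lam_inv (v - vc (FreeGroup.of c)) (FreeGroup.of c)
    rw [sub_add_cancel] at h1
    rw [lam_mul, map_mul, h1, map_inv, hg, ih, vc_mul, sub_add_cancel, vc_inv, sub_eq_add_neg, add_comm (vc w), ← add_assoc]; group

lemma Psi_lam0 {w : F} (h : vc w = 0) : Psi (lam 0 w) = w := by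
  rw [Psi_lam, h, add_zero]; simp [pv]

def ND (D : Set V2) : Subgroup F := Subgroup.closure {x | ∃ g, vc g ∈ D ∧ x = g⁻¹ * cm ga gb * g}

lemma ND_mem {D : Set V2} {g : F} (h : vc g ∈ D) : g⁻¹ * cm ga gb * g ∈ ND D := Subgroup.subset_closure ⟨g, h, rfl⟩
lemma ND_mono {D D' : Set V2} (h : D ⊆ D') : ND D ≤ ND D' := Subgroup.closure_mono (by
  rintro x ⟨g, hg, rfl⟩; exact ⟨g, h hg, rfl⟩)

lemma ND_vec {D : Set V2} {x : F} (h : x ∈ ND D) : vc x = 0 := by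
  induction h using Subgroup.closure_induction with
  | mem x hx => obtain ⟨g, _, rfl⟩ := hx; simp [vc_mul, vc_inv, vc_c]
  | one => exact vc_one
  | mul x y _ _ h1 h2 => simp [vc_mul, h1, h2]
  | inv x _ h1 => simp [vc_inv, h1]

lemma ND_conj {D : Set V2} {x f : F} (h : x ∈ ND D) (hf : vc f = 0) : f * x * f⁻¹ ∈ ND D := by
  induction h using Subgroup.closure_induction with
  | mem x hx =>
    obtain ⟨g, hg, rfl⟩ := hx
    have := ND_mem (D := D) (g := g * f⁻¹) (by simpa [vc_mul, vc_inv, hf] using hg)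
    simpa [mul_assoc] using this
  | one => simp
  | mul x y _ _ h1 h2 => have := mul_mem h1 h2; simpa [mul_assoc] using this
  | inv x _ h1 => have := inv_mem h1; simpa [mul_assoc] using this

lemma ND_fin {S : Set V2} {x : F} (h : x ∈ ND S) : ∃ D : Finset V2, (D : Set V2) ⊆ S ∧ x ∈ ND D := by
  classical
  induction h using Subgroup.closure_induction with
  | mem x hx =>
    obtain ⟨g, hg, rfl⟩ := hx
    exact ⟨{vc g}, by simpa using hg, ND_mem (by simp)⟩
  | one => exact ⟨∅, by simp, one_mem _⟩
  | mul x y _ _ h1 h2 =>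
    obtain ⟨D, hD, h1⟩ := h1
    obtain ⟨D', hD', h2⟩ := h2
    refine ⟨D ∪ D', by simp [hD, hD'], mul_mem (ND_mono (by simp) h1) (ND_mono (by simp) h2)⟩
  | inv x _ h1 => obtain ⟨D, hD, h1⟩ := h1; exact ⟨D, hD, inv_mem h1⟩

lemma Psi_form (v : V2) (X : Fr) : ∃ n ∈ ND {w | w ≠ v}, ∃ m : ℤ, Psi X = n * ((pv v)⁻¹ * cm ga gb * pv v) ^ m := by
  set z := (pv v)⁻¹ * cm ga gb * pv v with hz
  have hzv : ∀ m : ℤ, vc (z ^ m) = 0 := by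
    intro m
    have : vc z = 0 := by simp [hz, vc_mul, vc_inv, vc_c]
    simp only [vc, Prod.mk_eq_zero] at this ⊢
    rw [e_zpow, e_zpow, this.1, this.2]; simp
  have hof : ∀ w, ∃ n ∈ ND {w | w ≠ v}, ∃ m : ℤ, Psi (FreeGroup.of w) = n * z ^ m := by
    intro w
    by_cases hw : w = v
    · subst hw; exact ⟨1, one_mem _, 1, by simp [Psi, hz]⟩
    · exact ⟨Psi (FreeGroup.of w), by simp only [Psi, FreeGroup.lift_apply_of]; exact ND_mem (by simpa [vc_pv] using hw), 0, by simp⟩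
  induction X using FreeGroup.induction_on with
  | C1 => exact ⟨1, one_mem _, 0, by simp⟩
  | of x => exact hof x
  | inv_of x h =>
    obtain ⟨n, hn, m, h⟩ := h
    refine ⟨z ^ (-m) * n⁻¹ * (z ^ (-m))⁻¹, ND_conj (inv_mem hn) (hzv _), -m, ?_⟩
    rw [map_inv, h]; simp
  | mul x y hx hy =>
    obtain ⟨n, hn, m, h⟩ := hx
    obtain ⟨n', hn', m', h'⟩ := hy
    refine ⟨n * (z ^ m * n' * (z ^ m)⁻¹), mul_mem hn (ND_conj hn' (hzv _)), m + m', ?_⟩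
    rw [map_mul, h, h', zpow_add]; simp [mul_assoc]

lemma comm_ND (v : V2) {x y : F} (hx : vc x = 0) (hy : vc y = 0) : x * y * (y * x)⁻¹ ∈ ND {w | w ≠ v} := by
  obtain ⟨n, hn, m, h⟩ := Psi_form v (lam 0 x)
  obtain ⟨n', hn', m', h'⟩ := Psi_form v (lam 0 y)
  rw [Psi_lam0 hx] at h; rw [Psi_lam0 hy] at h'
  set z := (pv v)⁻¹ * cm ga gb * pv v with hz
  have hzv : ∀ m : ℤ, vc (z ^ m) = 0 := by
    intro m
    have : vc z = 0 := by simp [hz, vc_mul, vc_inv, vc_c]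
    simp only [vc, Prod.mk_eq_zero] at this ⊢
    rw [e_zpow, e_zpow, this.1, this.2]; simp
  have e : x * y * (y * x)⁻¹ = n * (z ^ m * n' * (z ^ m)⁻¹) * ((z ^ m' * n⁻¹ * (z ^ m')⁻¹) * n'⁻¹) := by
    rw [h, h']; group
  rw [e]
  exact mul_mem (mul_mem hn (ND_conj hn' (hzv _))) (mul_mem (ND_conj (inv_mem hn) (hzv _)) (inv_mem hn'))

open Classical in
noncomputable def kill (E : Set V2) : Fr →* Fr := FreeGroup.lift fun v => if v ∈ E then FreeGroup.of v else 1

lemma kill_fin (G : Fr) : ∃ E : Finset V2, ∀ E' : Set V2, (E : Set V2) ⊆ E' → kill E' G = G := by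
  classical
  induction G using FreeGroup.induction_on with
  | C1 => exact ⟨∅, fun E' _ => map_one _⟩
  | of x => exact ⟨{x}, fun E' h => by simp at h; simp [kill, h]⟩
  | inv_of x h => obtain ⟨E, h⟩ := h; exact ⟨E, fun E' hE => by rw [map_inv, h E' hE]⟩
  | mul x y hx hy =>
    obtain ⟨E, hx⟩ := hx
    obtain ⟨E2, hy⟩ := hy
    refine ⟨E ∪ E2, fun E' hE => ?_⟩
    rw [map_mul, hx E' (fun a ha => hE (by simp at ha; simp [ha])), hy E' (fun a ha => hE (by simp at ha; simp [ha]))]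

lemma kill_ND {D E : Set V2} (hDE : Disjoint D E) {x : F} (h : x ∈ ND D) : kill E (lam 0 x) = 1 := by
  have : ∀ x ∈ ND D, vc x = 0 := fun x => ND_vec
  induction h using Subgroup.closure_induction with
  | mem x hx =>
    obtain ⟨g, hg, rfl⟩ := hx
    rw [lam_conj, zero_add, map_mul, map_mul, map_inv]
    have : vc g ∉ E := fun h => Set.disjoint_left.1 hDE hg h
    have : kill E (FreeGroup.of (vc g)) = 1 := by simp [kill, this]
    rw [this]; simp
  | one => rw [lam_one, map_one]
  | mul x y _ hy h1 h2 => rw [lam_mul, this y hy, add_zero, map_mul, h1, h2, one_mul]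
  | inv x hx h1 =>
    have := lam_inv 0 x
    rw [ND_vec hx, add_zero] at this
    rw [this, map_inv, h1, inv_one]

theorem hyp (α : F →* F) (w : F) (hc : α (cm ga gb) = w⁻¹ * cm ga gb * w ∨ α (cm ga gb) = w⁻¹ * (cm ga gb)⁻¹ * w)
    (T : V2 → V2) (hT : ∀ g, vc (w * α g) = T (vc g)) (hinj : Function.Injective T) (v0 : V2)
    (hper : ∀ v, v ≠ v0 → ∀ k, 0 < k → T^[k] v ≠ v) {x y : F} (hx : vc x = 0) (hy : vc y = 0) (hax : α x = x)
    (hay : α y = y) : x * y = y * x := by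
  set γ := x * y * (y * x)⁻¹ with hγ
  have hfix : α γ = γ := by rw [hγ]; simp [hax, hay]
  obtain ⟨D, hD, hmem⟩ := ND_fin (comm_ND v0 hx hy)
  rw [← hγ] at hmem
  have hstep : ∀ (D : Set V2), γ ∈ ND D → γ ∈ ND (T '' D) := by
    intro D h
    have : ∀ z ∈ ND D, α z ∈ ND (T '' D) := by
      intro z hz
      induction hz using Subgroup.closure_induction with
      | mem z hz =>
        obtain ⟨g, hg, rfl⟩ := hz
        have h1 : (w * α g)⁻¹ * cm ga gb * (w * α g) ∈ ND (T '' D) := ND_mem (by rw [hT]; exact ⟨_, hg, rfl⟩)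
        rw [map_mul, map_mul, map_inv]
        rcases hc with h | h <;> rw [h]
        · simpa [mul_assoc] using h1
        · simpa [mul_assoc] using inv_mem h1
      | one => simp
      | mul x y _ _ h1 h2 => rw [map_mul]; exact mul_mem h1 h2
      | inv x _ h1 => rw [map_inv]; exact inv_mem h1
    have := this γ h
    rwa [hfix] at this
  have hk : ∀ k, γ ∈ ND (T^[k] '' D) := by
    intro k
    induction k with
    | zero => simpa using hmem
    | succ k ih =>
      have := hstep _ ih
      rwa [← Set.image_comp, ← Function.iterate_succ'] at this
  have hvγ : vc γ = 0 := ND_vec hmem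
  obtain ⟨E, hE⟩ := kill_fin (lam 0 γ)
  have hfin : ∀ d ∈ D, {k : ℕ | T^[k] d ∈ E}.Finite := by
    intro d hd
    have hd' : d ≠ v0 := hD hd
    have hi : Function.Injective (fun k : ℕ => T^[k] d) := by
      have hlt : ∀ k l, k < l → T^[k] d ≠ T^[l] d := by
        intro k l hkl h
        have e : l = k + (l - k) := by omega
        rw [e, Function.iterate_add_apply] at h
        exact hper d hd' (l - k) (by omega) ((hinj.iterate k) h).symm
      intro k l h
      rcases lt_trichotomy k l with h1 | h1 | h1
      · exact absurd h (hlt _ _ h1)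
      · exact h1
      · exact absurd h.symm (hlt _ _ h1)
    exact Set.Finite.preimage hi.injOn E.finite_toSet
  have hfin2 : (⋃ d ∈ D, {k : ℕ | T^[k] d ∈ E}).Finite := Set.Finite.biUnion D.finite_toSet hfin
  obtain ⟨k, hk'⟩ := hfin2.exists_notMem
  have hdis : Disjoint (T^[k] '' (D : Set V2)) (E : Set V2) := by
    rw [Set.disjoint_left]
    rintro _ ⟨d, hd, rfl⟩ h
    apply hk'
    simp only [Set.mem_iUnion]
    exact ⟨d, hd, h⟩
  have h1 := kill_ND hdis (hk k)
  rw [hE _ (le_refl _)] at h1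
  have h2 := Psi_lam0 hvγ
  rw [h1, map_one] at h2
  exact (mul_inv_eq_one.1 h2.symm)

end Eq9

namespace Eq9

structure QQ (α : F ≃* F) (K : Subgroup F) : Prop where
  fix : ∀ x ∈ K, α x = x
  nc : ¬ Comm K
  gen : ∀ R, Gen2 R → K ≤ R → R = ⊤

lemma e_hom (φ : F →* F) (c : Bool) (g : F) : e c (φ g) = e c (φ ga) * e true g + e c (φ gb) * e false g := by
  induction g using right_induction with
  | h1 => simp [e_one]
  | hm w d ih =>
    rw [map_mul, e_mul, ih, e_mul, e_mul]
    cases d <;> simp [e_of] <;> ring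
  | hm' w d ih =>
    rw [map_mul, map_inv, e_mul, e_inv, ih, e_mul, e_mul, e_inv, e_inv]
    cases d <;> simp [e_of] <;> ring

lemma e_aut (α : F ≃* F) (c : Bool) (g : F) : e c (α g) = e c (α ga) * e true g + e c (α gb) * e false g :=
  e_hom α.toMonoidHom c g

lemma ett : e true ga = 1 := by simp [e_of]
lemma eft : e false ga = 0 := by simp [e_of]
lemma etf : e true gb = 0 := by simp [e_of]
lemma eff : e false gb = 1 := by simp [e_of]

def det (α : F ≃* F) : ℤ := e true (α ga) * e false (α gb) - e true (α gb) * e false (α ga)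
def tr (α : F ≃* F) : ℤ := e true (α ga) + e false (α gb)

lemma det_unit (α : F ≃* F) : det α = 1 ∨ det α = -1 := by
  apply Int.isUnit_iff.1
  apply IsUnit.of_mul_eq_one (det α.symm)
  have h1 := e_aut α.symm true (α ga)
  have h2 := e_aut α.symm false (α ga)
  have h3 := e_aut α.symm true (α gb)
  have h4 := e_aut α.symm false (α gb)
  rw [MulEquiv.symm_apply_apply] at h1 h2 h3 h4
  rw [ett] at h1; rw [eft] at h2; rw [etf] at h3; rw [eff] at h4
  unfold det
  linear_combination (-1 : ℤ) * h1 + (-1 : ℤ) * h4 * (e true (α.symm ga) * e true (α ga) + e true (α.symm gb) * e false (α ga)) + h3 * (e false (α.symm ga) * e true (α ga) + e false (α.symm gb) * e false (α ga))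

lemma hom_ext2 {G : Type*} [Group G] {f g : F →* G} (h1 : f ga = g ga) (h2 : f gb = g gb) : f = g := by
  ext c; cases c
  · exact h2
  · exact h1

def hm2 (x y : F) : F →* F := FreeGroup.lift fun c => if c then x else y
@[simp] lemma hm2_a (x y : F) : hm2 x y ga = x := by simp [hm2]
@[simp] lemma hm2_b (x y : F) : hm2 x y gb = y := by simp [hm2]

lemma mkaut (x y x' y' : F) (h1 : hm2 x' y' x = ga) (h2 : hm2 x' y' y = gb) (h3 : hm2 x y x' = ga) (h4 : hm2 x y y' = gb) :
    ∃ α : F ≃* F, α ga = x ∧ α gb = y := by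
  refine ⟨MonoidHom.toMulEquiv (hm2 x y) (hm2 x' y') (hom_ext2 ?_ ?_) (hom_ext2 ?_ ?_), ?_, ?_⟩
  · simpa using h1
  · simpa using h2
  · simpa using h3
  · simpa using h4
  · exact hm2_a x y
  · exact hm2_b x y

lemma aut_neg : ∃ α : F ≃* F, α ga = ga⁻¹ ∧ α gb = gb⁻¹ := mkaut _ _ ga⁻¹ gb⁻¹ (by simp) (by simp) (by simp) (by simp)
lemma aut_inv : ∃ α : F ≃* F, α ga = ga⁻¹ ∧ α gb = gb := mkaut _ _ ga⁻¹ gb (by simp) (by simp) (by simp) (by simp)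
lemma aut_swap : ∃ α : F ≃* F, α ga = gb ∧ α gb = ga := mkaut _ _ gb ga (by simp) (by simp) (by simp) (by simp)
lemma aut_three : ∃ α : F ≃* F, α ga = gb ∧ α gb = gb⁻¹ * ga⁻¹ := mkaut _ _ (gb⁻¹ * ga⁻¹) ga (by simp) (by simp) (by simp) (by simp)
lemma aut_sh (n : ℤ) : ∃ α : F ≃* F, α ga = ga ∧ α gb = gb * ga ^ n :=
  mkaut _ _ ga (gb * ga ^ (-n)) (by simp) (by simp) (by simp) (by simp)
lemma aut_refl (n : ℤ) : ∃ α : F ≃* F, α ga = ga ∧ α gb = gb⁻¹ * ga ^ n :=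
  mkaut _ _ ga (ga ^ n * gb⁻¹) (by simp) (by simp) (by simp) (by simp)

lemma GP_ab : GP ga gb := by
  rw [GP, eq_top_iff, ← FreeGroup.closure_range_of, Subgroup.closure_le]
  rintro _ ⟨c, rfl⟩
  cases c
  · exact mem2 _ _
  · exact mem1 _ _

lemma GP_aut (α : F ≃* F) : GP (α ga) (α gb) := by
  have := congrArg (Subgroup.map α.toMonoidHom) GP_ab
  rw [MonoidHom.map_closure, Set.image_pair, Subgroup.map_top_of_surjective _ α.surjective] at this
  exact this

structure Same (α β : F ≃* F) : Prop where
  h1 : e true (α ga) = e true (β ga)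
  h2 : e false (α ga) = e false (β ga)
  h3 : e true (α gb) = e true (β gb)
  h4 : e false (α gb) = e false (β gb)

lemma twist {α β : F ≃* F} (h : Same α β) : ∃ x, ∀ s, α s = x * β s * x⁻¹ := by
  have hG := GP_aut (α.trans β.symm)
  have key : ∀ c z, (∀ d, e d (α z) = e d (β z)) → e c ((α.trans β.symm) z) = e c z := by
    intro c z h
    rw [MulEquiv.trans_apply, e_aut β.symm, h, h, ← e_aut β.symm, MulEquiv.symm_apply_apply]
  have ha : ∀ d, e d (α ga) = e d (β ga) := fun d => by cases d; exacts [h.h2, h.h1]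
  have hb : ∀ d, e d (α gb) = e d (β gb) := fun d => by cases d; exacts [h.h4, h.h3]
  obtain ⟨g, h1, h2⟩ := ia_inn hG (by rw [key _ _ ha, ett]) (by rw [key _ _ ha, eft]) (by rw [key _ _ hb, etf]) (by rw [key _ _ hb, eff])
  have h3 : (α.trans β.symm).toMonoidHom = (MulAut.conj g).toMonoidHom := hom_ext2 (by simpa using h1) (by simpa using h2)
  refine ⟨β g, fun s => ?_⟩
  have h4 := DFunLike.congr_fun h3 s
  have h5 := congrArg β h4
  simpa using h5

lemma twist_fix {α β : F ≃* F} {x : F} (h : ∀ s, α s = x * β s * x⁻¹) {s : F} (hs : α s = s) : tw β.toMonoidHom x s = x := by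
  have := h s
  rw [hs] at this
  show s⁻¹ * x * β s = x
  nth_rewrite 1 [this]
  simp [mul_assoc]

lemma QQ.tw_false {α : F ≃* F} {K : Subgroup F} (q : QQ α K) {β : F ≃* F} (h : Same α β)
    (hf : ∀ x u v, tw β.toMonoidHom x u = x → tw β.toMonoidHom x v = x → u * v = v * u) : False := by
  obtain ⟨x, hx⟩ := twist h
  exact q.nc fun u hu v hv => hf x u v (twist_fix hx (q.fix u hu)) (twist_fix hx (q.fix v hv))

lemma cen {u v w : F} (huv : u * v ≠ v * u) (h1 : w * u = u * w) (h2 : w * v = v * w) : w = 1 := by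
  by_contra hw
  have key : ∀ u, w * u = u * w → ∃ i j : ℤ, i ≠ 0 ∧ u ^ i = w ^ j := by
    intro u h
    obtain ⟨z, hz⟩ := comm_cyclic _ (closure_comm h)
    have m1 := mem1 w u
    have m2 := mem2 w u
    rw [hz, Subgroup.mem_closure_singleton] at m1 m2
    obtain ⟨i, hi⟩ := m1
    obtain ⟨j, hj⟩ := m2
    refine ⟨i, j, ?_, ?_⟩
    · rintro rfl; exact hw (by simpa using hi.symm)
    · rw [← hi, ← hj, ← zpow_mul, ← zpow_mul, mul_comm]
  obtain ⟨i, j, hi, h⟩ := key u h1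
  by_cases hj : j = 0
  · rw [hj, zpow_zero] at h
    apply huv
    exact comm_of_zpow (j := 0) hi (by rw [h, zpow_zero])
  obtain ⟨i', j', hi', h'⟩ := key v h2
  apply huv
  apply comm_of_zpow (i := i * j') (j := i' * j)
  · refine mul_ne_zero hi ?_
    rintro rfl
    apply huv
    exact (comm_of_zpow (j := 0) hi' (by rw [h', zpow_zero, zpow_zero])).symm
  · rw [zpow_mul, zpow_mul, h, h', ← zpow_mul, ← zpow_mul, mul_comm]

lemma QQ.inner {α : F ≃* F} {K : Subgroup F} (q : QQ α K) (h : Same α (MulEquiv.refl F)) : ∀ x, α x = x := by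
  obtain ⟨x, hx⟩ := twist h
  have hn := q.nc
  unfold Comm at hn
  push Not at hn
  obtain ⟨u, hu, v, hv, huv⟩ := hn
  have : x = 1 := by
    apply cen huv
    · have := hx u; rw [q.fix u hu, eq_mul_inv_iff_mul_eq] at this; exact this.symm
    · have := hx v; rw [q.fix v hv, eq_mul_inv_iff_mul_eq] at this; exact this.symm
  intro s; rw [hx, this]; simp

def cj (β α : F ≃* F) : F ≃* F := (β.trans α).trans β.symm

lemma QQ.cj {α : F ≃* F} {K : Subgroup F} (q : QQ α K) (β : F ≃* F) : QQ (cj β α) (K.comap β.toMonoidHom) := by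
  refine ⟨fun x hx => ?_, fun h => q.nc fun u hu v hv => ?_, fun R hR hK => ?_⟩
  · show β.symm (α (β x)) = x
    rw [q.fix (β x) hx, MulEquiv.symm_apply_apply]
  · have := h (β.symm u) (by show β (β.symm u) ∈ K; simpa using hu) (β.symm v) (by show β (β.symm v) ∈ K; simpa using hv)
    have := congrArg β this
    simpa using this
  · have h1 : Gen2 (R.map β.toMonoidHom) := by
      obtain ⟨x, y, rfl⟩ := hR
      exact ⟨β x, β y, by rw [MonoidHom.map_closure, Set.image_pair]; rfl⟩
    have h2 : K ≤ R.map β.toMonoidHom := by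
      intro z hz
      exact ⟨β.symm z, hK (by show β (β.symm z) ∈ K; simpa using hz), β.apply_symm_apply z⟩
    have h3 := q.gen _ h1 h2
    rw [eq_top_iff]
    intro z _
    have : β z ∈ R.map β.toMonoidHom := by rw [h3]; trivial
    obtain ⟨z', hz', e⟩ := this
    have := β.injective e
    rwa [← this]

lemma cj_id {α β : F ≃* F} (h : ∀ x, cj β α x = x) (x : F) : α x = x := by
  have := h (β.symm x)
  have := congrArg β this
  simpa [cj] using this

lemma QQ.sq {α : F ≃* F} {K : Subgroup F} (q : QQ α K) : QQ (α.trans α) K :=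
  ⟨fun x hx => by simp [q.fix x hx], q.nc, q.gen⟩
lemma QQ.cube {α : F ≃* F} {K : Subgroup F} (q : QQ α K) : QQ ((α.trans α).trans α) K :=
  ⟨fun x hx => by simp [q.fix x hx], q.nc, q.gen⟩

lemma QQ.neg {α : F ≃* F} {K : Subgroup F} (q : QQ α K) (h1 : e true (α ga) = -1) (h2 : e false (α ga) = 0)
    (h3 : e true (α gb) = 0) (h4 : e false (α gb) = -1) : False := by
  obtain ⟨β, ha, hb⟩ := aut_neg
  refine q.tw_false (β := β) ⟨?_, ?_, ?_, ?_⟩ (flow1 _ fun c => ?_)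
  · simp [ha, h1, e_inv, e_of]
  · simp [ha, h2, e_inv, e_of]
  · simp [hb, h3, e_inv, e_of]
  · simp [hb, h4, e_inv, e_of]
  · have : β.toMonoidHom (FreeGroup.of c) = lt (c, false) := by
      have : lt (c, false) = (FreeGroup.of c)⁻¹ := by rw [of_eq_lt, ← lt_iv]; rfl
      rw [this]
      cases c
      · exact hb
      · exact ha
    rw [this]; exact NoL.lt (by simp)

lemma NoL.zp {s : Lt} {c : Bool} (h : c ≠ s.1) : NoL s (FreeGroup.of c) := by
  have := NoL.zpow h 1
  rwa [zpow_one] at this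
lemma NoL.iz {s : Lt} {c : Bool} (h : c ≠ s.1) : NoL s (FreeGroup.of c)⁻¹ := by
  have := NoL.zpow h (-1)
  rwa [zpow_neg, zpow_one] at this
lemma NoL.ii (c : Bool) : NoL (c, true) (FreeGroup.of c)⁻¹ := by
  rw [of_eq_lt, ← lt_iv]; exact NoL.lt (by simp [iv])

lemma QQ.swap {α : F ≃* F} {K : Subgroup F} (q : QQ α K) (h1 : e true (α ga) = 0) (h2 : e false (α ga) = 1)
    (h3 : e true (α gb) = 1) (h4 : e false (α gb) = 0) : False := by
  obtain ⟨β, ha, hb⟩ := aut_swap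
  refine q.tw_false (β := β) ⟨?_, ?_, ?_, ?_⟩ (flow1 _ fun c => ?_)
  · simp [ha, h1, e_of]
  · simp [ha, h2, e_of]
  · simp [hb, h3, e_of]
  · simp [hb, h4, e_of]
  · cases c
    · show NoL _ (β gb); rw [hb]; exact NoL.zp (by simp)
    · show NoL _ (β ga); rw [ha]; exact NoL.zp (by simp)

lemma QQ.three {α : F ≃* F} {K : Subgroup F} (q : QQ α K) (h1 : e true (α ga) = 0) (h2 : e false (α ga) = 1)
    (h3 : e true (α gb) = -1) (h4 : e false (α gb) = -1) : False := by
  obtain ⟨β, ha, hb⟩ := aut_three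
  refine q.tw_false (β := β) ⟨?_, ?_, ?_, ?_⟩ (flow1 _ fun c => ?_)
  · simp [ha, h1, e_of]
  · simp [ha, h2, e_of]
  · simp [hb, h3, e_of, e_inv, e_mul]
  · simp [hb, h4, e_of, e_inv, e_mul]
  · cases c
    · show NoL _ (β gb); rw [hb]; exact NoL.mul (NoL.ii _) (NoL.iz (by simp))
    · show NoL _ (β ga); rw [ha]; exact NoL.zp (by simp)

lemma QQ.refl {α : F ≃* F} {K : Subgroup F} (q : QQ α K) (h1 : e true (α ga) = 1) (h2 : e false (α ga) = 0)
    (h4 : e false (α gb) = -1) : False := by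
  obtain ⟨β, ha, hb⟩ := aut_refl (e true (α gb))
  refine q.tw_false (β := β) ⟨?_, ?_, ?_, ?_⟩ (flow2 _ ha ?_)
  · simp [ha, h1, e_of]
  · simp [ha, h2, e_of]
  · simp [hb, e_of, e_inv, e_mul, e_zpow]
  · simp [hb, h4, e_of, e_inv, e_mul, e_zpow]
  · show NoL _ (β gb); rw [hb]; exact NoL.mul (NoL.ii _) (NoL.zpow (by simp) _)

lemma QQ.unip {α : F ≃* F} {K : Subgroup F} (q : QQ α K) (h1 : e true (α ga) = 1) (h2 : e false (α ga) = 0)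
    (h3 : e true (α gb) ≠ 0) (h4 : e false (α gb) = 1) : False := by
  obtain ⟨β, ha, hb⟩ := aut_sh (e true (α gb))
  have hS : Same α β := by
    refine ⟨?_, ?_, ?_, ?_⟩
    · simp [ha, h1, e_of]
    · simp [ha, h2, e_of]
    · simp [hb, e_of, e_mul, e_zpow]
    · simp [hb, h4, e_of, e_mul, e_zpow]
  obtain ⟨x, hx⟩ := twist hS
  by_cases ho : ∀ w, tw β.toMonoidHom x w ≠ 1
  · exact q.nc fun u hu v hv => flow3 _ _ ha hb x u v ho (twist_fix hx (q.fix u hu)) (twist_fix hx (q.fix v hv))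
  push Not at ho
  obtain ⟨w, hw⟩ := ho
  have hw' : x = w * (β w)⁻¹ := by
    have : w⁻¹ * x * β w = 1 := hw
    rw [mul_assoc, inv_mul_eq_one] at this
    rw [eq_mul_inv_iff_mul_eq]; exact this.symm
  have hR := q.gen (Subgroup.closure {w * ga * w⁻¹, w * (gb * ga * gb⁻¹) * w⁻¹}) ⟨_, _, rfl⟩ (by
    intro s hs
    have h5 : β (w⁻¹ * s * w) = w⁻¹ * s * w := by
      have := hx s
      rw [q.fix s hs, hw'] at this
      nth_rewrite 2 [this]
      simp [mul_assoc]
    have h6 := flow4 β.toMonoidHom _ h3 ha hb _ h5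
    have h7 := Subgroup.mem_map_of_mem (MulAut.conj w).toMonoidHom h6
    rw [MonoidHom.map_closure, Set.image_pair] at h7
    simpa [mul_assoc] using h7)
  have h8 : ∀ z ∈ Subgroup.closure {w * ga * w⁻¹, w * (gb * ga * gb⁻¹) * w⁻¹}, e false z = 0 := by
    intro z hz
    induction hz using Subgroup.closure_induction with
    | mem z hz =>
      rcases hz with rfl | rfl
      · rw [e_conj]; exact eft
      · rw [e_conj, e_conj]; exact eft
    | one => exact e_one _
    | mul x y _ _ h1 h2 => rw [e_mul, h1, h2]; rfl
    | inv x _ h1 => rw [e_inv, h1]; rfl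
  have := h8 gb (by rw [hR]; trivial)
  rw [eff] at this
  exact one_ne_zero this

end Eq9

namespace Eq9

lemma seq_zero (t : ℤ) (ht : 3 ≤ |t|) (f : ℕ → ℤ) (hf : ∀ n, f (n + 2) = t * f (n + 1) - f n) (N : ℕ) (hN : 0 < N)
    (hp : ∀ n, f (n + N) = f n) : f 0 = 0 := by
  have hmod : ∀ n, f n = f (n % N) := by
    intro n
    have : ∀ k m, f (m + k * N) = f m := by
      intro k m
      induction k with
      | zero => simp
      | succ k ih => rw [Nat.succ_mul, ← add_assoc, hp, ih]
    have h := this (n / N) (n % N)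
    rwa [Nat.mod_add_div'] at h
  obtain ⟨m, _, hm⟩ := Finset.exists_max_image (Finset.range N) (fun n => |f n|) ⟨0, by simpa using hN⟩
  have hall : ∀ n, |f n| ≤ |f m| := by
    intro n; rw [hmod n]; exact hm _ (by simpa using Nat.mod_lt n hN)
  have h1 := hf (m + N - 1)
  have e1 : m + N - 1 + 2 = m + 1 + N := by omega
  have e2 : m + N - 1 + 1 = m + N := by omega
  rw [e1, e2, hp, hp] at h1
  have h2 := hall (m + 1)
  have h3 := hall (m + N - 1)
  have h4 : |t * f m| ≤ 2 * |f m| := by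
    have : t * f m = f (m + 1) + f (m + N - 1) := by linarith
    rw [this]
    exact (abs_add_le _ _).trans (by linarith)
  rw [abs_mul] at h4
  have h5 : |f m| = 0 := by nlinarith [abs_nonneg (f m)]
  have h6 := hall 0
  rw [h5] at h6
  exact abs_nonpos_iff.1 h6

lemma QQ.hyper {α : F ≃* F} {K : Subgroup F} (q : QQ α K) (hd : det α = 1) (ht : 3 ≤ |tr α|) : False := by
  set p := e true (α ga) with hp
  set r := e false (α ga) with hr
  set u := e true (α gb) with hu
  set s := e false (α gb) with hs
  have hd' : p * s - u * r = 1 := hd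
  have ht' : 3 ≤ |p + s| := ht
  have ht2 : (2 - (p + s)) ≠ 0 := by
    intro h
    have : p + s = 2 := by linarith
    rw [this] at ht'; norm_num at ht'
  have hz : ∀ z ∈ K, vc z = 0 := by
    intro z hz
    have h1 := e_aut α true z
    have h2 := e_aut α false z
    rw [q.fix z hz] at h1 h2
    rw [← hp, ← hu] at h1
    rw [← hr, ← hs] at h2
    have h3 : (2 - (p + s)) * e true z = 0 := by linear_combination (1 - s) * h1 + u * h2 + e true z * (-hd')
    have h4 : (2 - (p + s)) * e false z = 0 := by linear_combination (1 - p) * h2 + r * h1 + e false z * (-hd')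
    rw [vc, (mul_eq_zero.1 h3).resolve_left ht2, (mul_eq_zero.1 h4).resolve_left ht2]; rfl
  have hcm : ∃ w, α (cm ga gb) = w⁻¹ * cm ga gb * w ∨ α (cm ga gb) = w⁻¹ * (cm ga gb)⁻¹ * w := by
    have : α (cm ga gb) = cm (α ga) (α gb) := by simp [cm]
    rw [this]
    exact cm_conj (GP_aut α)
  obtain ⟨w, hw⟩ := hcm
  obtain ⟨w1, w2⟩ : ∃ w1 w2, vc w = (w1, w2) := ⟨_, _, rfl⟩
  let T : V2 → V2 := fun v => (p * v.1 + u * v.2 + e true w, r * v.1 + s * v.2 + e false w)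
  have hT : ∀ g, vc (w * α.toMonoidHom g) = T (vc g) := by
    intro g
    show vc (w * α g) = _
    simp only [vc, e_mul, T]
    rw [e_aut α true g, e_aut α false g]
    ext <;> simp only [hp, hu, hr, hs] <;> ring
  have hTi : Function.Injective T := by
    intro x y h
    simp only [T, Prod.mk.injEq] at h
    obtain ⟨h1, h2⟩ := h
    ext
    · linear_combination s * h1 - u * h2 - (x.1 - y.1) * hd'
    · linear_combination p * h2 - r * h1 - (x.2 - y.2) * hd'
  have huniq : ∀ v v' k l, 0 < k → 0 < l → T^[k] v = v → T^[l] v' = v' → v = v' := by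
    intro v v' k l hk hl h h'
    have hper : ∀ v k, T^[k] v = v → ∀ m n, T^[n + m * k] v = T^[n] v := by
      intro v k h m n
      rw [Function.iterate_add_apply, mul_comm, Function.iterate_mul, Function.iterate_fixed h]
    have hstep : ∀ v n, T^[n + 1] v = T (T^[n] v) := fun v n => Function.iterate_succ_apply' _ _ _
    have hstep2 : ∀ v n, T^[n + 2] v = T (T (T^[n] v)) := fun v n => by
      rw [hstep, hstep]
    have f1 := seq_zero (p + s) ht' (fun n => (T^[n] v).1 - (T^[n] v').1) (fun n => by
      simp only [hstep2, hstep]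
      generalize T^[n] v = x
      generalize T^[n] v' = y
      simp only [T]
      linear_combination (-(x.1 - y.1)) * hd') (l * k) (by positivity) (fun n => by
      simp only [hper v k h]; rw [mul_comm l k, hper v' l h'])
    have f2 := seq_zero (p + s) ht' (fun n => (T^[n] v).2 - (T^[n] v').2) (fun n => by
      simp only [hstep2, hstep]
      generalize T^[n] v = x
      generalize T^[n] v' = y
      simp only [T]
      linear_combination (-(x.2 - y.2)) * hd') (l * k) (by positivity) (fun n => by
      simp only [hper v k h]; rw [mul_comm l k, hper v' l h'])
    simp only [Function.iterate_zero, id] at f1 f2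
    ext <;> linarith
  have hv0 : ∃ v0 : V2, ∀ v, v ≠ v0 → ∀ k, 0 < k → T^[k] v ≠ v := by
    by_cases hex : ∃ v k, 0 < k ∧ T^[k] v = v
    · obtain ⟨v0, l, hl, h⟩ := hex
      exact ⟨v0, fun v hv k hk h' => hv (huniq _ _ _ _ hk hl h' h)⟩
    · push Not at hex
      exact ⟨0, fun v _ k hk => hex v k hk⟩
  obtain ⟨v0, hv0⟩ := hv0
  exact q.nc fun x hx y hy => hyp α.toMonoidHom w hw T hT hTi v0 hv0 (hz x hx) (hz y hy) (q.fix x hx) (q.fix y hy)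

structure Ent (α : F ≃* F) (p u r s : ℤ) : Prop where
  h1 : e true (α ga) = p
  h2 : e true (α gb) = u
  h3 : e false (α ga) = r
  h4 : e false (α gb) = s

lemma ent_trans {α β : F ≃* F} {p u r s p' u' r' s' : ℤ} (h : Ent α p u r s) (h' : Ent β p' u' r' s') :
    Ent (α.trans β) (p' * p + u' * r) (p' * u + u' * s) (r' * p + s' * r) (r' * u + s' * s) := by
  constructor <;> rw [MulEquiv.trans_apply, e_aut β] <;> simp only [h.1, h.2, h.3, h.4, h'.1, h'.2, h'.3, h'.4]

lemma ent_swap {α : F ≃* F} {p u r s : ℤ} (h : Ent α p u r s) : ∃ β, Ent (cj β α) s r u p := by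
  obtain ⟨β, ha, hb⟩ := aut_swap
  have ha' : β.symm ga = gb := by rw [MulEquiv.symm_apply_eq, hb]
  have hb' : β.symm gb = ga := by rw [MulEquiv.symm_apply_eq, ha]
  have e1 : Ent β 0 1 1 0 := by constructor <;> simp [ha, hb, e_of]
  have e2 : Ent β.symm 0 1 1 0 := by constructor <;> simp [ha', hb', e_of]
  have := ent_trans (ent_trans e1 h) e2
  exact ⟨β, this.h1.trans (by ring), this.h2.trans (by ring), this.h3.trans (by ring), this.h4.trans (by ring)⟩

lemma ent_inv {α : F ≃* F} {p u r s : ℤ} (h : Ent α p u r s) : ∃ β, Ent (cj β α) p (-u) (-r) s := by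
  obtain ⟨β, ha, hb⟩ := aut_inv
  have ha' : β.symm ga = ga⁻¹ := by rw [MulEquiv.symm_apply_eq, map_inv, ha, inv_inv]
  have hb' : β.symm gb = gb := by rw [MulEquiv.symm_apply_eq, hb]
  have e1 : Ent β (-1) 0 0 1 := by constructor <;> simp [ha, hb, e_of, e_inv]
  have e2 : Ent β.symm (-1) 0 0 1 := by constructor <;> simp [ha', hb', e_of, e_inv]
  have := ent_trans (ent_trans e1 h) e2
  exact ⟨β, this.h1.trans (by ring), this.h2.trans (by ring), this.h3.trans (by ring), this.h4.trans (by ring)⟩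

lemma ent_sh {α : F ≃* F} {p u r s : ℤ} (h : Ent α p u r s) (k : ℤ) :
    ∃ β, Ent (cj β α) (p - r * k) (u + k * (p - s) - k ^ 2 * r) r (s + r * k) := by
  obtain ⟨β, ha, hb⟩ := aut_sh k
  have ha' : β.symm ga = ga := by rw [MulEquiv.symm_apply_eq, ha]
  have hb' : β.symm gb = gb * ga ^ (-k) := by rw [MulEquiv.symm_apply_eq, map_mul, map_zpow, ha, hb]; simp
  have e1 : Ent β 1 k 0 1 := by constructor <;> simp [ha, hb, e_of, e_mul, e_zpow]
  have e2 : Ent β.symm 1 (-k) 0 1 := by constructor <;> simp [ha', hb', e_of, e_mul, e_inv, e_zpow]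
  have := ent_trans (ent_trans e1 h) e2
  exact ⟨β, this.h1.trans (by ring), this.h2.trans (by ring), this.h3.trans (by ring), this.h4.trans (by ring)⟩

lemma round2 (m r : ℤ) (hr : r ≠ 0) : ∃ k, |m - 2 * r * k| ≤ |r| := by
  have h2 : (2 * |r|) > 0 := by positivity
  have h0 := Int.emod_nonneg (m + |r|) (ne_of_gt h2)
  have h1 := Int.emod_lt_of_pos (m + |r|) h2
  have h3 := Int.emod_add_mul_ediv (m + |r|) (2 * |r|)
  have h4 : |m - 2 * |r| * ((m + |r|) / (2 * |r|))| ≤ |r| := by rw [abs_le]; constructor <;> linarith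
  rcases abs_choice r with h | h
  · rw [h] at h4; rw [h]; exact ⟨_, h4⟩
  · refine ⟨-((m + |r|) / (2 * |r|)), ?_⟩
    have e : 2 * r * -((m + |r|) / (2 * |r|)) = 2 * |r| * ((m + |r|) / (2 * |r|)) := by
      have : r = - |r| := by linarith
      nth_rewrite 1 [this]; ring
    rw [e]; exact h4

/-- trace -1, det 1 or trace 0, det -1, with unit corner -/
lemma QQ.unit_r {α : F ≃* F} {K : Subgroup F} (q : QQ α K) {p u r s : ℤ} (h : Ent α p u r s) (hr : r = 1 ∨ r = -1)
    (hdt : (p * s - u * r = 1 ∧ p + s = -1) ∨ (p * s - u * r = -1 ∧ p + s = 0)) : False := by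
  have main : ∀ (α : F ≃* F) (K : Subgroup F) (_ : QQ α K) (p u s : ℤ) (_ : Ent α p u 1 s)
    (_ : (p * s - u * 1 = 1 ∧ p + s = -1) ∨ (p * s - u * 1 = -1 ∧ p + s = 0)), False := by
    intro α K q p u s h hdt
    obtain ⟨β, hβ⟩ := ent_sh h p
    have q' := q.cj β
    rcases hdt with ⟨hd, ht⟩ | ⟨hd, ht⟩
    · refine q'.three (by rw [hβ.h1]; ring) hβ.h3 ?_ ?_
      · rw [hβ.h2]; linear_combination -hd
      · rw [hβ.h4]; linear_combination ht
    · refine q'.swap (by rw [hβ.h1]; ring) hβ.h3 ?_ ?_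
      · rw [hβ.h2]; linear_combination -hd
      · rw [hβ.h4]; linear_combination ht
  rcases hr with rfl | rfl
  · exact main α K q p u s h hdt
  · obtain ⟨β, hβ⟩ := ent_inv h
    refine main _ _ (q.cj β) p (-u) s (by simpa using hβ) ?_
    rcases hdt with ⟨hd, ht⟩ | ⟨hd, ht⟩
    · left; exact ⟨by linarith, ht⟩
    · right; exact ⟨by linarith, ht⟩

lemma red (n : ℕ) : ∀ (α : F ≃* F) (K : Subgroup F) (_ : QQ α K) (p u r s : ℤ) (_ : Ent α p u r s) (_ : r.natAbs = n)
    (_ : ¬ ∀ x, α x = x)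
    (_ : (p * s - u * r = 1 ∧ p + s = -1) ∨ (p * s - u * r = -1 ∧ p + s = 0) ∨ (p * s - u * r = 1 ∧ p + s = 2)), False := by
  induction n using Nat.strong_induction_on with
  | _ n ih =>
  intro α K q p u r s h hn hid hdt
  by_cases hr : r = 0
  · subst hr
    simp only [mul_zero, sub_zero] at hdt
    rcases hdt with ⟨hd, ht⟩ | ⟨hd, ht⟩ | ⟨hd, ht⟩
    · rcases Int.eq_one_or_neg_one_of_mul_eq_one hd with rfl | rfl <;> omega
    · have hs : s = -p := by linarith
      subst hs
      have : p * p = 1 := by linarith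
      rcases Int.eq_one_or_neg_one_of_mul_eq_one this with rfl | rfl
      · exact q.refl h.h1 h.h3 h.h4
      · obtain ⟨β, hβ⟩ := ent_sh h (u / 2)
        have q1 := q.cj β
        obtain ⟨γ, hγ⟩ := ent_swap hβ
        have q2 := q1.cj γ
        have hm := Int.emod_two_eq_zero_or_one u
        have hm' := Int.emod_add_mul_ediv u 2
        rcases hm with hm | hm
        · refine q2.refl ?_ ?_ ?_
          · rw [hγ.h1]; ring
          · rw [hγ.h3]; linarith
          · rw [hγ.h4]; ring
        · refine q2.unit_r hγ (Or.inl (by linarith)) (Or.inr ⟨by ring, by ring⟩)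
    · have hp : p = 1 := by nlinarith [sq_nonneg (p - 1)]
      have hs : s = 1 := by linarith
      subst hp; subst hs
      by_cases hu : u = 0
      · subst hu
        exact hid (q.inner ⟨h.h1.trans ett.symm, h.h3.trans eft.symm, h.h2.trans etf.symm, h.h4.trans eff.symm⟩)
      · exact q.unip h.h1 h.h3 (by rw [h.h2]; exact hu) h.h4
  obtain ⟨k, hk⟩ := round2 (p - s) r hr
  obtain ⟨β, hβ⟩ := ent_sh h k
  have q1 := q.cj β
  have hid1 : ¬ ∀ x, cj β α x = x := fun h => hid (cj_id h)
  set p1 := p - r * k with hp1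
  set s1 := s + r * k with hs1
  set u1 := u + k * (p - s) - k ^ 2 * r with hu1
  have hdd : p1 * s1 - u1 * r = p * s - u * r := by rw [hp1, hs1, hu1]; ring
  have htt : p1 + s1 = p + s := by rw [hp1, hs1]; ring
  rw [← hdd, ← htt] at hdt
  have hk' : |p1 - s1| ≤ |r| := by
    have : p1 - s1 = p - s - 2 * r * k := by rw [hp1, hs1]; ring
    rw [this]; exact hk
  clear_value p1 s1 u1
  have hsq : (p1 - s1) ^ 2 ≤ r ^ 2 := sq_le_sq.2 hk'
  by_cases hlt : u1.natAbs < r.natAbs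
  · obtain ⟨γ, hγ⟩ := ent_swap hβ
    refine ih _ (hn ▸ hlt) _ _ (q1.cj γ) _ _ _ _ hγ rfl (fun h => hid1 (cj_id h)) ?_
    rwa [mul_comm s1, mul_comm r, add_comm s1]
  have hle : |r| ≤ |u1| := by
    rw [Int.abs_eq_natAbs, Int.abs_eq_natAbs]; exact_mod_cast not_lt.1 hlt
  have hr1 : 1 ≤ |r| := Int.one_le_abs hr
  have habs : r ^ 2 ≤ |u1 * r| := by
    rw [abs_mul, ← sq_abs]; nlinarith
  have hpos : 0 ≤ (p1 - s1) ^ 2 := sq_nonneg _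
  have hrr : 1 ≤ r ^ 2 := by rw [← sq_abs]; nlinarith
  have key : ∀ D : ℤ, (D = -3 ∨ D = 4 ∨ D = 0) → (p1 - s1) ^ 2 = D - 4 * (u1 * r) → D ≠ 0 ∧ r ^ 2 ≤ 1 := by
    intro D hD h
    rcases abs_cases (u1 * r) with ⟨h1, _⟩ | ⟨h1, _⟩ <;> rw [h1] at habs <;> rcases hD with rfl | rfl | rfl <;> constructor <;> omega
  have fin : r ^ 2 ≤ 1 → r = 1 ∨ r = -1 := by
    intro h
    have h1 : |r| ≤ 1 := by rw [← sq_abs] at h; nlinarith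
    rw [abs_le] at h1
    omega
  rcases hdt with ⟨hd, ht⟩ | ⟨hd, ht⟩ | ⟨hd, ht⟩
  · have := key (-3) (by simp) (by linear_combination (p1 + s1 - 1) * ht - 4 * hd)
    exact q1.unit_r hβ (fin this.2) (Or.inl ⟨hd, ht⟩)
  · have := key 4 (by simp) (by linear_combination (p1 + s1) * ht - 4 * hd)
    exact q1.unit_r hβ (fin this.2) (Or.inr ⟨hd, ht⟩)
  · have := key 0 (by simp) (by linear_combination (p1 + s1 + 2) * ht - 4 * hd)
    exact this.1 rfl

theorem aut_thm {α : F ≃* F} {K : Subgroup F} (q : QQ α K) : ∀ x, α x = x := by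
  by_contra hid
  obtain ⟨p, u, r, s, h⟩ : ∃ p u r s, Ent α p u r s := ⟨_, _, _, _, rfl, rfl, rfl, rfl⟩
  have hdet : ∀ {α : F ≃* F} {p u r s : ℤ}, Ent α p u r s → det α = p * s - u * r := by
    intro α p u r s h; rw [det, h.1, h.2, h.3, h.4]
  have htr : ∀ {α : F ≃* F} {p u r s : ℤ}, Ent α p u r s → tr α = p + s := by
    intro α p u r s h; rw [tr, h.1, h.4]
  have h2 := ent_trans h h
  have hd := det_unit α
  rw [hdet h] at hd
  rcases hd with hd | hd
  · by_cases ht : 3 ≤ |p + s|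
    · exact q.hyper (by rw [hdet h, hd]) (by rw [htr h]; exact ht)
    have ht' : |p + s| ≤ 2 := by omega
    rw [abs_le] at ht'
    have hcases : p + s = 2 ∨ p + s = 1 ∨ p + s = 0 ∨ p + s = -1 ∨ p + s = -2 := by omega
    rcases hcases with ht | ht | ht | ht | ht
    · exact red _ α K q p u r s h rfl hid (Or.inr (Or.inr ⟨hd, ht⟩))
    · have h3 := ent_trans h2 h
      refine q.cube.neg (h3.h1.trans ?_) (h3.h3.trans ?_) (h3.h2.trans ?_) (h3.h4.trans ?_)
      · have hs : s = 1 - p := by linarith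
        subst hs
        linear_combination (-p - 1) * hd
      · have hs : s = 1 - p := by linarith
        subst hs
        linear_combination (-r) * hd
      · have hs : s = 1 - p := by linarith
        subst hs
        linear_combination (-u) * hd
      · have hs : s = 1 - p := by linarith
        subst hs
        linear_combination (p - 2) * hd
    · have hs : s = -p := by linarith
      subst hs
      refine q.sq.neg (h2.h1.trans ?_) (h2.h3.trans ?_) (h2.h2.trans ?_) (h2.h4.trans ?_)
      · linear_combination -hd
      · ring
      · ring
      · linear_combination -hd
    · exact red _ α K q p u r s h rfl hid (Or.inl ⟨hd, ht⟩)
    · have hs : s = -2 - p := by linarith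
      subst hs
      by_cases hid2 : ∀ x, (α.trans α) x = x
      · have a1 : e true ((α.trans α) ga) = 1 := by rw [hid2]; exact ett
        have a2 : e false ((α.trans α) ga) = 0 := by rw [hid2]; exact eft
        have a3 : e true ((α.trans α) gb) = 0 := by rw [hid2]; exact etf
        rw [h2.h1] at a1; rw [h2.h3] at a2; rw [h2.h2] at a3
        have hr : r = 0 := by linarith
        have hu : u = 0 := by linarith
        have hp : p = -1 := by subst hr; linarith
        subst hp
        exact q.neg h.h1 (h.h3.trans hr) (h.h2.trans hu) (h.h4.trans (by norm_num))
      · refine red _ _ K q.sq _ _ _ _ h2 rfl hid2 (Or.inr (Or.inr ⟨?_, ?_⟩))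
        · linear_combination (p * (-2 - p) - u * r + 1) * hd
        · linear_combination (-2 : ℤ) * hd
  · by_cases ht : p + s = 0
    · exact red _ α K q p u r s h rfl hid (Or.inr (Or.inl ⟨hd, ht⟩))
    · refine q.sq.hyper ?_ ?_
      · rw [hdet h2]; linear_combination (p * s - u * r - 1) * hd
      · rw [htr h2]
        have e : p * p + u * r + (r * u + s * s) = (p + s) ^ 2 + 2 := by linear_combination (-2 : ℤ) * hd
        rw [e]
        have : 0 < (p + s) ^ 2 := by positivity
        rw [abs_of_pos (by positivity)]; omega

end Eq9

namespace Eq9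

lemma lam_pow_a (n : ℤ) : ∀ i : ℤ, lam (i, 0) (ga ^ n) = 1 := by
  have hv : ∀ i n : ℤ, (i, (0 : ℤ)) + vc (ga ^ n) = (i + n, 0) := by
    intro i n; simp [vc, e_zpow, e_of]
  induction n using Int.induction_on with
  | zero => intro i; simp [lam_one]
  | succ n ih => intro i; rw [add_comm, zpow_one_add, lam_mul, ih, hv, lam_a, hh_zero, mul_one]
  | pred n ih =>
    intro i
    rw [sub_eq_add_neg, add_comm, zpow_add, lam_mul, ih, hv, zpow_neg_one, lam_ainv]
    have : ((i + -(n : ℤ), (0 : ℤ)) - (1, 0) : V2) = (i + -(n : ℤ) - 1, 0) := by simp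
    rw [this, hh_zero]; simp

lemma lam_pow_b (n : ℤ) : ∀ v, lam v (gb ^ n) = 1 := by
  induction n using Int.induction_on with
  | zero => intro i; simp [lam_one]
  | succ n ih => intro i; rw [zpow_add_one, lam_mul, ih, lam_b, mul_one]
  | pred n ih => intro i; rw [zpow_sub_one, lam_mul, ih, lam_binv, mul_one]

lemma lam_pv (v : V2) : lam 0 (pv v) = 1 := by
  rw [pv, lam_mul, lam_pow_b, show (0 : V2) = (0, 0) from rfl, lam_pow_a, mul_one]

lemma vc_Psi (X : Fr) : vc (Psi X) = 0 := by
  induction X using FreeGroup.induction_on with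
  | C1 => rw [map_one, vc_one]
  | of x => simp [Psi, vc_mul, vc_inv, vc_c]
  | inv_of x h => rw [map_inv, vc_inv, h, neg_zero]
  | mul x y hx hy => rw [map_mul, vc_mul, hx, hy, add_zero]

lemma lam_Psi (X : Fr) : lam 0 (Psi X) = X := by
  induction X using FreeGroup.induction_on with
  | C1 => rw [map_one, lam_one]
  | of x =>
    simp only [Psi, FreeGroup.lift_apply_of]
    rw [lam_conj, lam_pv, vc_pv, zero_add]; simp
  | inv_of x h =>
    have := lam_inv 0 (Psi (FreeGroup.of x))
    rw [vc_Psi, add_zero, h] at this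
    rw [map_inv, this]
  | mul x y hx hy => rw [map_mul, lam_mul, vc_Psi, add_zero, hx, hy]

lemma Psi_inj : Function.Injective Psi := fun x y h => by rw [← lam_Psi x, h, lam_Psi]

lemma to_F {β : Type} (g h : F →* FreeGroup β) : ∃ g1 h1 : F →* F, (∀ x y, g1 x = g1 y ↔ g x = g y) ∧
    (∀ x y, h1 x = h1 y ↔ h x = h y) ∧ (∀ x y, g1 x = h1 y ↔ g x = h y) := by
  let φ : FreeGroup (Bool ⊕ Bool) →* FreeGroup β := FreeGroup.lift (Sum.elim (fun c => g (FreeGroup.of c)) (fun c => h (FreeGroup.of c)))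
  have hg : φ.comp (FreeGroup.map Sum.inl) = g := by ext c; simp [φ]
  have hh : φ.comp (FreeGroup.map Sum.inr) = h := by ext c; simp [φ]
  have hc : Countable φ.range := φ.rangeRestrict_surjective.countable
  let ee := IsFreeGroup.mulEquiv (G := φ.range)
  have hc2 : Countable (IsFreeGroup.Generators φ.range) :=
    Function.Injective.countable (f := fun x => ee (FreeGroup.of x)) (ee.injective.comp FreeGroup.of_injective)
  obtain ⟨f, hf⟩ := exists_injective_nat (IsFreeGroup.Generators φ.range)
  let i : IsFreeGroup.Generators φ.range → V2 := fun x => ((f x : ℤ), 0)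
  have hi : Function.Injective i := by
    intro x y h
    simp only [i, Prod.mk.injEq, and_true, Nat.cast_inj] at h
    exact hf h
  let θ : φ.range →* F := (Psi.comp (FreeGroup.map i)).comp ee.symm.toMonoidHom
  have hθ : Function.Injective θ := (Psi_inj.comp (FreeGroup.map_injective hi)).comp ee.symm.injective
  have hg' : ∀ x, (φ.rangeRestrict (FreeGroup.map Sum.inl x) : FreeGroup β) = g x := fun x => DFunLike.congr_fun hg x
  have hh' : ∀ x, (φ.rangeRestrict (FreeGroup.map Sum.inr x) : FreeGroup β) = h x := fun x => DFunLike.congr_fun hh x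
  refine ⟨θ.comp (φ.rangeRestrict.comp (FreeGroup.map Sum.inl)), θ.comp (φ.rangeRestrict.comp (FreeGroup.map Sum.inr)), ?_, ?_, ?_⟩ <;>
  · intro x y
    simp only [MonoidHom.comp_apply]
    rw [hθ.eq_iff, Subtype.ext_iff]
    simp only [hg', hh']

lemma two_free {M : Subgroup F} (hM : Gen2 M) (hnc : ¬ Comm M) : ∃ μ : F →* F, Function.Injective μ ∧ μ.range = M := by
  let ee := IsFreeGroup.mulEquiv (G := M)
  obtain ⟨x, y, hxy⟩ := hM
  have hx : x ∈ M := by rw [hxy]; exact mem1 _ _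
  have hy : y ∈ M := by rw [hxy]; exact mem2 _ _
  let X := IsFreeGroup.Generators M
  let J : (X → Multiplicative (ZMod 2)) → Multiplicative (ZMod 2) × Multiplicative (ZMod 2) := fun f =>
    (FreeGroup.lift f (ee.symm ⟨x, hx⟩), FreeGroup.lift f (ee.symm ⟨y, hy⟩))
  have hJ : Function.Injective J := by
    intro f g h
    simp only [J, Prod.mk.injEq] at h
    have key : ∀ z (hz : z ∈ M), FreeGroup.lift f (ee.symm ⟨z, hz⟩) = FreeGroup.lift g (ee.symm ⟨z, hz⟩) := by
      have : ∀ z ∈ Subgroup.closure {x, y}, ∀ hz : z ∈ M, FreeGroup.lift f (ee.symm ⟨z, hz⟩) = FreeGroup.lift g (ee.symm ⟨z, hz⟩) := by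
        intro z hz
        induction hz using Subgroup.closure_induction with
        | mem z hz =>
          rcases hz with rfl | rfl
          · intro _; exact h.1
          · intro _; exact h.2
        | one => intro hz; rw [show (⟨1, hz⟩ : M) = 1 from rfl]; simp
        | mul a b ha hb h1 h2 =>
          intro hz
          rw [← hxy] at ha hb
          rw [show (⟨a * b, hz⟩ : M) = ⟨a, ha⟩ * ⟨b, hb⟩ from rfl, map_mul, map_mul, map_mul, h1, h2]
        | inv a ha h1 =>
          intro hz
          rw [← hxy] at ha
          rw [show (⟨a⁻¹, hz⟩ : M) = ⟨a, ha⟩⁻¹ from rfl, map_inv, map_inv, map_inv, h1]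
      intro z hz; exact this z (hxy ▸ hz) hz
    funext c
    have := key (ee (FreeGroup.of c)) (ee (FreeGroup.of c)).2
    simpa using this
  have hfin : Finite (X → Multiplicative (ZMod 2)) := Finite.of_injective J hJ
  have hX : Finite X := by
    classical
    refine Finite.of_injective (fun c : X => (fun d => if d = c then Multiplicative.ofAdd (1 : ZMod 2) else 1 : X → Multiplicative (ZMod 2))) ?_
    intro c d h
    have := congrFun h c
    by_contra hne
    simp [hne] at this
  have hle : Nat.card X ≤ 2 := by
    have := Nat.card_le_card_of_injective J hJ
    rw [Nat.card_fun, Nat.card_prod] at this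
    have h2 : Nat.card (Multiplicative (ZMod 2)) = 2 := by simp
    rw [h2] at this
    have : 2 ^ Nat.card X ≤ 2 ^ 2 := this
    exact (Nat.pow_le_pow_iff_right (by norm_num)).1 this
  have hge : ¬ Nat.card X ≤ 1 := by
    intro h
    have hs : Subsingleton X := Finite.card_le_one_iff_subsingleton.1 h
    apply hnc
    intro u hu v hv
    have : ∀ a b : FreeGroup X, a * b = b * a := by
      intro a b
      rcases isEmpty_or_nonempty X with hE | ⟨⟨c⟩⟩
      · exact Subsingleton.elim _ _
      · have : ∀ a : FreeGroup X, ∃ n : ℤ, a = FreeGroup.of c ^ n := by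
          intro a
          induction a using FreeGroup.induction_on with
          | C1 => exact ⟨0, by simp⟩
          | of d => exact ⟨1, by rw [Subsingleton.elim d c]; simp⟩
          | inv_of d h => obtain ⟨n, h⟩ := h; exact ⟨-n, by rw [h]; simp⟩
          | mul a b ha hb => obtain ⟨n, h⟩ := ha; obtain ⟨m, h'⟩ := hb; exact ⟨n + m, by rw [h, h', zpow_add]⟩
        obtain ⟨n, rfl⟩ := this a
        obtain ⟨m, rfl⟩ := this b
        rw [← zpow_add, ← zpow_add, add_comm]
    have h3 := congrArg ee (this (ee.symm ⟨u, hu⟩) (ee.symm ⟨v, hv⟩))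
    simp only [map_mul, MulEquiv.apply_symm_apply] at h3
    exact congrArg Subtype.val h3
  have hcard : Nat.card X = Nat.card Bool := by
    rw [Nat.card_eq_fintype_card (α := Bool), Fintype.card_bool]; omega
  obtain ⟨eq⟩ := (Finite.card_eq (α := X) (β := Bool)).1 hcard
  refine ⟨M.subtype.comp ((FreeGroup.freeGroupCongr eq.symm).trans ee).toMonoidHom, ?_, ?_⟩
  · exact M.subtype_injective.comp (MulEquiv.injective _)
  · rw [MonoidHom.range_comp, MonoidHom.range_eq_top.2 (MulEquiv.surjective _), ← MonoidHom.range_eq_map, Subgroup.range_subtype]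

lemma Gen2_map {J : Subgroup F} (h : Gen2 J) (f : F →* F) : Gen2 (J.map f) := by
  obtain ⟨x, y, rfl⟩ := h
  exact ⟨f x, f y, by rw [MonoidHom.map_closure, Set.image_pair]⟩

lemma Gen2_comap {J : Subgroup F} (h : Gen2 J) (f : F →* F) (hf : Function.Injective f) (hJ : J ≤ f.range) : Gen2 (J.comap f) := by
  obtain ⟨x, y, rfl⟩ := h
  obtain ⟨u, rfl⟩ := hJ (mem1 _ _)
  obtain ⟨v, rfl⟩ := hJ (mem2 _ _)
  refine ⟨u, v, ?_⟩
  rw [← Set.image_pair, ← MonoidHom.map_closure, Subgroup.comap_map_eq_self_of_injective hf]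

lemma core (E M : Subgroup F) (hE : ¬ Comm E) (hEM : E ≤ M) (hM : Gen2 M) (hmin : ∀ R, Gen2 R → E ≤ R → M ≤ R)
    (g h : F →* F) (hg : Function.Injective g) (hh : Function.Injective h) (hgh : ∀ x ∈ E, g x = h x) : ∀ x ∈ M, g x = h x := by
  have hmap : E.map g = E.map h := by
    ext z; constructor
    · rintro ⟨x, hx, rfl⟩; exact ⟨x, hx, (hgh x hx).symm⟩
    · rintro ⟨x, hx, rfl⟩; exact ⟨x, hx, hgh x hx⟩
  have hI : Gen2 (M.map g ⊓ M.map h) := by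
    rw [← sInf_pair]
    refine hn _ ⟨_, Set.mem_insert _ _⟩ ?_ ?_
    · rintro H (rfl | rfl)
      exacts [Gen2_map hM g, Gen2_map hM h]
    · intro hc
      apply hE
      intro u hu v hv
      rw [sInf_pair] at hc
      have m : ∀ u ∈ E, g u ∈ M.map g ⊓ M.map h := fun u hu => ⟨⟨u, hEM hu, rfl⟩, ⟨u, hEM hu, (hgh u hu).symm⟩⟩
      have := hc (g u) (m u hu) (g v) (m v hv)
      rw [← map_mul, ← map_mul] at this
      exact hg this
  have sub : ∀ f : F →* F, Function.Injective f → M.map g ⊓ M.map h ≤ f.range → E.map f ≤ M.map g ⊓ M.map h → M.map f ≤ M.map g ⊓ M.map h := by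
    intro f hf h1 h2
    rw [Subgroup.map_le_iff_le_comap] at h2 ⊢
    exact hmin _ (Gen2_comap hI f hf h1) h2
  have hEI : E.map g ≤ M.map g ⊓ M.map h := le_inf (Subgroup.map_mono hEM) (hmap ▸ Subgroup.map_mono hEM)
  have s1 := sub g hg (inf_le_left.trans (Subgroup.map_le_range _ _)) hEI
  have s2 := sub h hh (inf_le_right.trans (Subgroup.map_le_range _ _)) (hmap ▸ hEI)
  have hN : M.map h = M.map g := le_antisymm (s2.trans inf_le_left) (s1.trans inf_le_right)
  obtain ⟨μ, hμ, hμM⟩ := two_free hM (fun hc => hE fun u hu v hv => hc u (hEM hu) v (hEM hv))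
  have i1 : Function.Injective (g.comp μ) := hg.comp hμ
  have i2 : Function.Injective (h.comp μ) := hh.comp hμ
  have hr : (h.comp μ).range = (g.comp μ).range := by
    rw [MonoidHom.range_comp, MonoidHom.range_comp, hμM, hN]
  let α : F ≃* F := ((MonoidHom.ofInjective i2).trans (MulEquiv.subgroupCongr hr)).trans (MonoidHom.ofInjective i1).symm
  have hα : ∀ x, g (μ (α x)) = h (μ x) := by
    intro x
    have : MonoidHom.ofInjective i1 (α x) = MulEquiv.subgroupCongr hr (MonoidHom.ofInjective i2 x) := by
      simp only [α, MulEquiv.trans_apply, MulEquiv.apply_symm_apply]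
    exact congrArg Subtype.val this
  have q : QQ α (E.comap μ) := by
    refine ⟨fun x hx => ?_, fun hc => hE fun u hu v hv => ?_, fun R hR hK => ?_⟩
    · apply i1
      show g (μ (α x)) = g (μ x)
      rw [hα, hgh _ hx]
    · have hu' := hEM hu
      have hv' := hEM hv
      rw [← hμM] at hu' hv'
      obtain ⟨u, rfl⟩ := hu'
      obtain ⟨v, rfl⟩ := hv'
      rw [← map_mul, ← map_mul, hc u hu v hv]
    · have h1 := hmin _ (Gen2_map hR μ) (by
        intro u hu
        have hu' := hEM hu
        rw [← hμM] at hu'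
        obtain ⟨u, rfl⟩ := hu'
        exact ⟨u, hK hu, rfl⟩)
      rw [eq_top_iff]
      intro z _
      have : μ z ∈ R.map μ := h1 (by rw [← hμM]; exact ⟨z, rfl⟩)
      obtain ⟨z', hz', e⟩ := this
      rwa [← hμ e]
  intro x hx
  rw [← hμM] at hx
  obtain ⟨x, rfl⟩ := hx
  rw [← hα, aut_thm q]

end Eq9

/-- a set `S` of at least two injective homomorphisms `F(a,b) → F(Δ)`
has equaliser of rank at most `2`. (`F(a,b)` is modelled as `FreeGroup Bool`.) -/
theorem stmt_9 {β : Type} (S : Set (FreeGroup Bool →* FreeGroup β))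
    (hcard : S.Nontrivial) (hinj : ∀ g ∈ S, Function.Injective g) :
    rkLe (⨅ g ∈ S, ⨅ h ∈ S, MonoidHom.eqLocus g h) 2 := by
  classical
  set E : Subgroup (FreeGroup Bool) := ⨅ g ∈ S, ⨅ h ∈ S, MonoidHom.eqLocus g h with hE
  have hmem : ∀ x, x ∈ E ↔ ∀ g ∈ S, ∀ h ∈ S, g x = h x := by
    intro x
    simp only [hE, Subgroup.mem_iInf]
    rfl
  by_cases hc : Eq9.Comm E
  · obtain ⟨x, hx⟩ := Eq9.comm_cyclic E hc
    exact ⟨{x}, by simp, by rw [hx]; simp⟩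
  let C : Set (Subgroup (FreeGroup Bool)) := {R | Eq9.Gen2 R ∧ E ≤ R}
  have hEM : E ≤ sInf C := le_sInf fun R hR => hR.2
  have hM : Eq9.Gen2 (sInf C) := by
    refine Eq9.hn C ⟨⊤, ⟨_, _, Eq9.GP_ab.symm⟩, le_top⟩ (fun R hR => hR.1) (fun h => hc fun u hu v hv => h u (hEM hu) v (hEM hv))
  have hME : sInf C ≤ E := by
    intro x hx
    rw [hmem]
    intro g hg h hh
    obtain ⟨g1, h1, k1, k2, k3⟩ := Eq9.to_F g h
    rw [← k3]
    refine Eq9.core E (sInf C) hc hEM hM (fun R hR hER => sInf_le ⟨hR, hER⟩) g1 h1 (fun x y e => hinj g hg ((k1 _ _).1 e))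
      (fun x y e => hinj h hh ((k2 _ _).1 e)) (fun y hy => ?_) x hx
    rw [k3]; exact (hmem y).1 hy g hg h hh
  obtain ⟨x, y, hxy⟩ := hM
  exact ⟨{x, y}, Finset.card_le_two, by rw [le_antisymm hEM hME, hxy]; simp⟩
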